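/- arXiv:1101.5367 — 11 statements merged into one kernel-verified Lean document; each statement's English description precedes it below -/
import Mathlib

section
/- There exists a function f : ℕ × ℕ × ℕ → ℕ such that the following holds. Let A = V⟨α⟩ be the dihedral group of order 8 acting on the Lie algebra L as in the context with C_L(V) = 0, and assume moreover that L is soluble with derived length k. Assume that there exists x₁ ∈ L₁ such that L is generated as a Lie algebra by x₁ and x₁^α, and that for the generating set X = {x₁, x₁^α} there exist positive integers m and n such that: every element of C_L(α) that is homogeneous with respect to X is ad-nilpotent in L of index at most m, and every pair of elements of C_L(α) that are homogeneous with respect to X generates a Lie subalgebra that is nilpotent of class at most n. Then L is nilpotent of class at most f(k, m, n). -/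
/-- Commutators of weight `w` in the two generators `x₁, x₂` of a Lie algebra:
a commutator of weight `1` is one of the generators, and a commutator of weight
`w₁ + w₂` is a bracket of commutators of weights `w₁` and `w₂`. -/
inductive IsCommutatorOfWeight {L : Type} [LieRing L] (x₁ x₂ : L) : ℕ → L → Prop
  | base₁ : IsCommutatorOfWeight x₁ x₂ 1 x₁
  | base₂ : IsCommutatorOfWeight x₁ x₂ 1 x₂
  | bracket {w₁ w₂ : ℕ} {a b : L} : IsCommutatorOfWeight x₁ x₂ w₁ a →
      IsCommutatorOfWeight x₁ x₂ w₂ b → IsCommutatorOfWeight x₁ x₂ (w₁ + w₂) ⁅a, b⁆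

/-- An element of a Lie algebra is homogeneous (of some weight `w`) with respect to
the generating set `{x₁, x₂}` if it is a linear combination of commutators of
weight `w` in `x₁, x₂`. -/
def IsHomogeneousElement (R : Type) {L : Type} [CommRing R] [LieRing L]
    [LieAlgebra R L] (x₁ x₂ : L) (y : L) : Prop :=
  ∃ w : ℕ, y ∈ Submodule.span R {z : L | IsCommutatorOfWeight x₁ x₂ w z}

namespace D8Aux

section Ideals
variable {R L : Type} [CommRing R] [LieRing L] [LieAlgebra R L]

theorem lie_sub_le {I J : LieIdeal R L} (W : Submodule R L)
    (h : ∀ x ∈ I, ∀ y ∈ J, ⁅x, y⁆ ∈ W) {z : L} (hz : z ∈ ⁅I, J⁆) : z ∈ W := by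
  rw [← LieSubmodule.mem_toSubmodule, LieSubmodule.lieIdeal_oper_eq_linear_span'] at hz
  refine (Submodule.span_le.2 ?_) hz
  rintro _ ⟨x, hx, y, hy, rfl⟩
  exact h x hx y hy

/-- `act D j X` is `[D, [D, ..., [D, X]]]` with `j` copies of `D`. -/
def act (D : LieIdeal R L) (j : ℕ) (X : LieIdeal R L) : LieIdeal R L :=
  (fun N => ⁅D, N⁆)^[j] X

theorem act_zero (D X : LieIdeal R L) : act D 0 X = X := rfl

theorem act_succ (D X : LieIdeal R L) (j : ℕ) : act D (j + 1) X = ⁅D, act D j X⁆ :=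
  Function.iterate_succ_apply' _ _ _

theorem act_succ' (D X : LieIdeal R L) (j : ℕ) : act D (j + 1) X = act D j ⁅D, X⁆ :=
  Function.iterate_succ_apply _ _ _

theorem act_add (D X : LieIdeal R L) (i j : ℕ) : act D (i + j) X = act D i (act D j X) :=
  Function.iterate_add_apply _ _ _ _

theorem act_mono (D : LieIdeal R L) {X Y : LieIdeal R L} (h : X ≤ Y) (j : ℕ) :
    act D j X ≤ act D j Y := by
  induction j with
  | zero => exact h
  | succ j ih => rw [act_succ, act_succ]; exact LieSubmodule.mono_lie le_rfl ih

theorem act_le (D X : LieIdeal R L) (j : ℕ) : act D j X ≤ X := by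
  induction j with
  | zero => exact le_rfl
  | succ j ih => rw [act_succ]; exact (LieSubmodule.lie_le_right _ _).trans ih

theorem act_sup (D X Y : LieIdeal R L) (j : ℕ) :
    act D j (X ⊔ Y) = act D j X ⊔ act D j Y := by
  induction j with
  | zero => rfl
  | succ j ih => rw [act_succ, act_succ, act_succ, ih, LieSubmodule.lie_sup]

theorem lie_leibniz (D A B : LieIdeal R L) : ⁅D, ⁅A, B⁆⁆ ≤ ⁅⁅D, A⁆, B⁆ ⊔ ⁅A, ⁅D, B⁆⁆ := by
  rw [LieSubmodule.lie_le_iff]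
  intro d hd z hz
  refine lie_sub_le (((⁅⁅D, A⁆, B⁆ ⊔ ⁅A, ⁅D, B⁆⁆ : LieIdeal R L) : Submodule R L).comap
    (LieAlgebra.ad R L d : L →ₗ[R] L)) ?_ hz
  intro a ha b hb
  change ⁅d, ⁅a, b⁆⁆ ∈ (⁅⁅D, A⁆, B⁆ ⊔ ⁅A, ⁅D, B⁆⁆ : LieIdeal R L)
  rw [leibniz_lie d a b]
  refine add_mem ?_ ?_
  · exact (le_sup_left : _ ≤ ⁅⁅D, A⁆, B⁆ ⊔ ⁅A, ⁅D, B⁆⁆)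
      (LieSubmodule.lie_mem_lie (LieSubmodule.lie_mem_lie hd ha) hb)
  · exact (le_sup_right : _ ≤ ⁅⁅D, A⁆, B⁆ ⊔ ⁅A, ⁅D, B⁆⁆)
      (LieSubmodule.lie_mem_lie ha (LieSubmodule.lie_mem_lie hd hb))

theorem act_lie (D : LieIdeal R L) (X' Y' : LieIdeal R L) :
    ∀ (N p q : ℕ) (X Y : LieIdeal R L), p + q = N → act D p X ≤ X' → act D q Y ≤ Y' →
      act D N ⁅X, Y⁆ ≤ ⁅X', Y⁆ ⊔ ⁅X, Y'⁆ := by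
  intro N
  induction N with
  | zero =>
    intro p q X Y h hp hq
    obtain rfl : p = 0 := by omega
    exact (LieSubmodule.mono_lie hp le_rfl).trans le_sup_left
  | succ N ih =>
    intro p q X Y h hp hq
    rcases p with _ | p
    · exact (act_le _ _ _).trans ((LieSubmodule.mono_lie hp le_rfl).trans le_sup_left)
    rcases q with _ | q
    · exact (act_le _ _ _).trans ((LieSubmodule.mono_lie le_rfl hq).trans le_sup_right)
    rw [act_succ']
    refine (act_mono D (lie_leibniz D X Y) N).trans ?_
    rw [act_sup]
    refine sup_le ?_ ?_
    · refine (ih p (q + 1) ⁅D, X⁆ Y (by omega) (by rwa [← act_succ']) hq).trans ?_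
      exact sup_le_sup le_rfl (LieSubmodule.mono_lie (LieSubmodule.lie_le_right _ _) le_rfl)
    · refine (ih (p + 1) q X ⁅D, Y⁆ (by omega) hp (by rwa [← act_succ'])).trans ?_
      exact sup_le_sup (LieSubmodule.mono_lie le_rfl (LieSubmodule.lie_le_right _ _)) le_rfl

theorem jac (E X : LieIdeal R L) : ⁅⁅E, E⁆, X⁆ ≤ ⁅E, ⁅E, X⁆⁆ := by
  rw [LieSubmodule.lie_comm, LieSubmodule.lie_le_iff]
  intro x hx z hz
  refine lie_sub_le (((⁅E, ⁅E, X⁆⁆ : LieIdeal R L) : Submodule R L).comap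
    (LieAlgebra.ad R L x)) ?_ hz
  intro a ha b hb
  change ⁅x, ⁅a, b⁆⁆ ∈ ⁅E, ⁅E, X⁆⁆
  rw [← lie_skew, neg_mem_iff, lie_lie]
  exact sub_mem (LieSubmodule.lie_mem_lie ha (LieSubmodule.lie_mem_lie hb hx))
    (LieSubmodule.lie_mem_lie hb (LieSubmodule.lie_mem_lie ha hx))

theorem hall_step (D E : LieIdeal R L) (r : ℕ) (h : act D r E ≤ ⁅E, E⁆) (i : ℕ) :
    act D ((i + 1) * r) (act E i E) ≤ act E (i + 1) E := by
  induction i with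
  | zero => simpa [act_succ, act_zero] using h
  | succ i ih =>
    have := act_lie D ⁅E, E⁆ (act E (i + 1) E) ((i + 1 + 1) * r) r ((i + 1) * r) E (act E i E)
      (by ring) h ih
    rw [← act_succ] at this
    refine this.trans (sup_le ?_ ?_)
    · rw [act_succ, act_succ]; exact jac _ _
    · rw [act_succ E E (i + 1)]

/-- The bound coming from the Hall-type theorem. -/
def tb (r : ℕ) : ℕ → ℕ
  | 0 => 0
  | c + 1 => (c + 1) * r + tb r c

theorem hall (D E : LieIdeal R L) (r : ℕ) (h : act D r E ≤ ⁅E, E⁆) (c : ℕ) :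
    act D (tb r c) E ≤ act E c E := by
  induction c with
  | zero => exact le_rfl
  | succ c ih =>
    rw [tb, act_add]
    exact (act_mono D ih _).trans (hall_step D E r h c)

end Ideals

section Graded
variable {R L : Type} [CommRing R] [LieRing L] [LieAlgebra R L]

/-- A grading by the nontrivial characters of a four-group. -/
structure Tri (G : Fin 3 → Submodule R L) : Prop where
  same : ∀ i, ∀ x ∈ G i, ∀ y ∈ G i, ⁅x, y⁆ = 0
  diff : ∀ i j k, i ≠ j → i ≠ k → j ≠ k → ∀ x ∈ G i, ∀ y ∈ G j, ⁅x, y⁆ ∈ G k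
  indep : ∀ y : Fin 3 → L, (∀ i, y i ∈ G i) → ∑ i, y i = 0 → ∀ i, y i = 0

/-- Graded ideals. -/
def Gr (G : Fin 3 → Submodule R L) (I : LieIdeal R L) : Prop :=
  ∀ x ∈ I, ∃ y : Fin 3 → L, (∀ i, y i ∈ G i ∧ y i ∈ I) ∧ ∑ i, y i = x

variable {G : Fin 3 → Submodule R L}

/-- span of brackets of degree `j`. -/
def brk (G : Fin 3 → Submodule R L) (j : Fin 3) : Submodule R L :=
  Submodule.span R {z | ∃ i k, i ≠ j ∧ k ≠ j ∧ i ≠ k ∧ ∃ x ∈ G i, ∃ y ∈ G k, ⁅x, y⁆ = z}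

theorem brk_le (hG : Tri G) (j : Fin 3) : brk G j ≤ G j := by
  refine Submodule.span_le.2 ?_
  rintro _ ⟨i, k, hi, hk, hik, x, hx, y, hy, rfl⟩
  exact hG.diff i k j hik hi hk x hx y hy

theorem third (i k : Fin 3) (h : i ≠ k) : ∃ j, i ≠ j ∧ k ≠ j := by
  revert i k; decide

theorem mem_brk (hG : Tri G) (hT : Gr G ⊤) (j : Fin 3) {b : L} (hb : b ∈ G j)
    (hb' : b ∈ ⁅(⊤ : LieIdeal R L), (⊤ : LieIdeal R L)⁆) : b ∈ brk G j := by
  have h1 : b ∈ ⨆ i, brk G i := by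
    refine lie_sub_le _ ?_ hb'
    intro x hx y hy
    obtain ⟨x, hx', rfl⟩ := hT x hx; replace hx := hx'
    obtain ⟨y, hy', rfl⟩ := hT y hy; replace hy := hy'
    simp only [sum_lie, lie_sum]
    refine sum_mem fun k _ => sum_mem fun i _ => ?_
    by_cases hik : i = k
    · subst hik
      rw [hG.same i _ (hx i).1 _ (hy i).1]; exact zero_mem _
    · obtain ⟨j, h1, h2⟩ := third i k hik
      exact (le_iSup (brk G) j)
        (Submodule.subset_span ⟨i, k, h1, h2, hik, _, (hx i).1, _, (hy k).1, rfl⟩)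
  rw [Submodule.mem_iSup_iff_exists_finsupp] at h1
  obtain ⟨f, hf, hs⟩ := h1
  have h2 : ∑ i, f i = b := by
    rw [← hs, Finsupp.sum_fintype _ _ (fun _ => rfl)]
  have h3 := hG.indep (fun i => f i - (if i = j then b else 0)) (fun i => by
    refine sub_mem (brk_le hG i (hf i)) ?_
    split_ifs with h
    · exact h ▸ hb
    · exact zero_mem _) (by simp [Finset.sum_sub_distrib, h2])
  have h4 := h3 j
  simp only [if_true, sub_eq_zero] at h4
  exact h4 ▸ hf j

theorem swap_mem {D E : LieIdeal R L} (hE : E = ⁅D, D⁆) {a b u : L} (ha : a ∈ D) (hb : b ∈ D)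
    (hu : u ∈ E) (h : ⁅b, ⁅a, u⁆⁆ ∈ ⁅E, E⁆) : ⁅a, ⁅b, u⁆⁆ ∈ ⁅E, E⁆ := by
  rw [leibniz_lie]
  exact add_mem (LieSubmodule.lie_mem_lie (hE ▸ LieSubmodule.lie_mem_lie ha hb) hu) h

theorem main_case (hG : Tri G) (hT : Gr G ⊤) {D E : LieIdeal R L} (hE : E = ⁅D, D⁆)
    (hD : D ≤ ⁅(⊤ : LieIdeal R L), (⊤ : LieIdeal R L)⁆) {i j : Fin 3} (hij : i ≠ j)
    {u a b c : L} (hu : u ∈ E) (ha : a ∈ D) (hb : b ∈ D) (hc : c ∈ D)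
    (hui : u ∈ G i) (haj : a ∈ G j) (hbj : b ∈ G j) (hcj : c ∈ G j) :
    ⁅c, ⁅b, ⁅a, u⁆⁆⁆ ∈ ⁅E, E⁆ := by
  have key : ∀ (i j k : Fin 3), i ≠ j → i ≠ k → j ≠ k → ∀ u ∈ E, u ∈ G i → ∀ a ∈ D, a ∈ G j →
      ∀ c ∈ D, c ∈ G j → ∀ p ∈ G i, ∀ q ∈ G k, ⁅c, ⁅⁅p, q⁆, ⁅a, u⁆⁆⁆ ∈ ⁅E, E⁆ := by
    intro i j k hij hik hjk u hu hui a ha haj c hc hcj p hp q hq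
    have h1 : ⁅q, ⁅a, u⁆⁆ = 0 :=
      hG.same k q hq _ (hG.diff j i k hij.symm hjk hik a haj u hui)
    have h2 : ⁅p, u⁆ = 0 := hG.same i p hp u hui
    have hpa : ⁅p, a⁆ ∈ G k := hG.diff i j k hij hik hjk p hp a haj
    have h3 : ⁅q, ⁅p, a⁆⁆ = 0 := hG.same k q hq _ hpa
    have h4 : ⁅c, ⁅q, u⁆⁆ = 0 :=
      hG.same j c hcj _ (hG.diff k i j hik.symm hjk.symm hij q hq u hui)
    have h5 : ⁅⁅p, q⁆, ⁅a, u⁆⁆ = -⁅⁅p, a⁆, ⁅q, u⁆⁆ := by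
      rw [lie_lie p q, h1, lie_zero, leibniz_lie p a u, h2, lie_zero, add_zero,
        leibniz_lie q ⁅p, a⁆ u, h3, zero_lie, zero_add, zero_sub]
    rw [h5, lie_neg, neg_mem_iff, leibniz_lie, h4, lie_zero, add_zero]
    refine LieSubmodule.lie_mem_lie ?_ (lie_mem_right R L E q u hu)
    rw [hE]
    exact LieSubmodule.lie_mem_lie hc (lie_mem_right R L D p a ha)
  have hb2 := mem_brk hG hT j hbj (hD hb)
  have : brk G j ≤ ((⁅E, E⁆ : LieIdeal R L) : Submodule R L).comap
      ((LieAlgebra.ad R L c) ∘ₗ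
        (-(LieAlgebra.ad R L ⁅a, u⁆) : L →ₗ[R] L)) := by
    refine Submodule.span_le.2 ?_
    rintro _ ⟨s, t, hs, ht, hst, p, hp, q, hq, rfl⟩
    change ⁅c, -⁅⁅a, u⁆, ⁅p, q⁆⁆⁆ ∈ ⁅E, E⁆
    rw [lie_skew]
    by_cases hsi : s = i
    · subst hsi
      exact key s j t hij hst ht.symm u hu hui a ha haj c hc hcj p hp q hq
    · have hti : t = i := by
        clear * - hs ht hst hsi hij
        omega
      subst hti
      rw [← lie_skew p q, neg_lie, lie_neg, neg_mem_iff]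
      exact key t j s hij hst.symm hs.symm u hu hui a ha haj c hc hcj q hq p hp
  have h := this hb2
  change ⁅c, -⁅⁅a, u⁆, b⁆⁆ ∈ ⁅E, E⁆ at h
  rwa [lie_skew] at h

theorem triple (hG : Tri G) (hT : Gr G ⊤) {D E : LieIdeal R L} (hE : E = ⁅D, D⁆)
    (hD : D ≤ ⁅(⊤ : LieIdeal R L), (⊤ : LieIdeal R L)⁆) {i j k l : Fin 3}
    {u a b c : L} (hu : u ∈ E) (ha : a ∈ D) (hb : b ∈ D) (hc : c ∈ D)
    (hui : u ∈ G i) (haj : a ∈ G j) (hbk : b ∈ G k) (hcl : c ∈ G l) :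
    ⁅c, ⁅b, ⁅a, u⁆⁆⁆ ∈ ⁅E, E⁆ := by
  -- two-step facts
  have two : ∀ {j k : Fin 3} {a b : L}, a ∈ D → b ∈ D → a ∈ G j → b ∈ G k →
      (j = i ∨ k = i ∨ j ≠ k) → ⁅b, ⁅a, u⁆⁆ ∈ ⁅E, E⁆ := by
    intro j k a b ha hb haj hbk h
    by_cases hj : j = i
    · subst hj
      rw [hG.same j a haj u hui, lie_zero]; exact zero_mem _
    by_cases hk : k = i
    · subst hk
      refine swap_mem hE hb ha hu ?_
      rw [hG.same k b hbk u hui, lie_zero]; exact zero_mem _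
    have hjk : j ≠ k := by tauto
    rw [hG.same k b hbk _ (hG.diff j i k hj hjk (Ne.symm hk) a haj u hui)]
    exact zero_mem _
  by_cases h1 : j = i ∨ k = i ∨ j ≠ k
  · exact lie_mem_right R L _ _ _ (two ha hb haj hbk h1)
  by_cases h2 : j = i ∨ l = i ∨ j ≠ l
  · refine swap_mem hE hc hb (lie_mem_right R L E a u hu) ?_
    exact lie_mem_right R L _ _ _ (two ha hc haj hcl h2)
  push Not at h1 h2
  obtain ⟨h1, -, rfl⟩ := h1
  obtain ⟨-, -, rfl⟩ := h2
  exact main_case hG hT hE hD (Ne.symm h1) hu ha hb hc hui haj hbk hcl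

theorem lemmaA (hG : Tri G) (hT : Gr G ⊤) {D E : LieIdeal R L} (hE : E = ⁅D, D⁆)
    (hD : D ≤ ⁅(⊤ : LieIdeal R L), (⊤ : LieIdeal R L)⁆) (gD : Gr G D) (gE : Gr G E) :
    act D 3 E ≤ ⁅E, E⁆ := by
  have key : ∀ u ∈ E, ∀ a ∈ D, ∀ b ∈ D, ∀ c ∈ D, ⁅c, ⁅b, ⁅a, u⁆⁆⁆ ∈ ⁅E, E⁆ := by
    intro u hu a ha b hb c hc
    obtain ⟨u, hu', rfl⟩ := gE u hu; replace hu := hu'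
    obtain ⟨a, ha', rfl⟩ := gD a ha; replace ha := ha'
    obtain ⟨b, hb', rfl⟩ := gD b hb; replace hb := hb'
    obtain ⟨c, hc', rfl⟩ := gD c hc; replace hc := hc'
    simp only [sum_lie, lie_sum]
    refine sum_mem fun i _ => sum_mem fun j _ => sum_mem fun k _ => sum_mem fun l _ => ?_
    exact triple hG hT hE hD (hu _).2 (ha _).2 (hb _).2 (hc _).2 (hu _).1 (ha _).1 (hb _).1 (hc _).1
  simp only [act_succ, act_zero]
  rw [LieSubmodule.lie_le_iff]
  intro c hc z hz
  refine lie_sub_le (((⁅E, E⁆ : LieIdeal R L) : Submodule R L).comap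
    (LieAlgebra.ad R L c)) ?_ hz
  intro b hb w hw
  refine lie_sub_le (((⁅E, E⁆ : LieIdeal R L) : Submodule R L).comap
    ((LieAlgebra.ad R L c) ∘ₗ (LieAlgebra.ad R L b))) ?_ hw
  intro a ha u hu
  exact key u hu a ha b hb c hc

/-- Bound for the nilpotency class of the derived subalgebra. -/
def gb : ℕ → ℕ
  | 0 => 0
  | i + 1 => tb 3 (gb i) + 1

theorem derived_nil (hG : Tri G) (hgr : ∀ j, Gr G (LieAlgebra.derivedSeries R L j)) (k : ℕ)
    (hk : LieAlgebra.derivedSeries R L k = ⊥) : ∀ i ≤ k,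
    act (LieAlgebra.derivedSeries R L (k - i + 1)) (gb i)
      (LieAlgebra.derivedSeries R L (k - i + 1)) = ⊥ := by
  intro i
  induction i with
  | zero =>
    intro _
    rw [Nat.sub_zero, eq_bot_iff, ← hk]
    exact (act_le _ _ _).trans (LieAlgebra.derivedSeriesOfIdeal_succ_le _ _)
  | succ i ih =>
    intro hi
    have h1 := ih (by omega)
    obtain ⟨t, ht⟩ : ∃ t, k - i = t + 1 := ⟨k - (i + 1), by omega⟩
    have ht' : k - (i + 1) = t := by omega
    rw [ht] at h1
    rw [ht', gb, act_succ', ← LieAlgebra.derivedSeriesOfIdeal_succ, eq_bot_iff, ← h1]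
    refine hall _ _ 3 ?_ _
    refine lemmaA hG (hgr 0) (LieAlgebra.derivedSeriesOfIdeal_succ R L _ _) ?_ (hgr _) (hgr _)
    exact LieAlgebra.derivedSeriesOfIdeal_le (le_refl (⊤ : LieIdeal R L)) (by omega : 1 ≤ t + 1)

end Graded

section Metabelian
variable {R L : Type} [CommRing R] [LieRing L] [LieAlgebra R L]

theorem iter_mem (I : LieIdeal R L) (s : L) (j : ℕ) {u : L} (hu : u ∈ I) :
    (fun z => ⁅s, z⁆)^[j] u ∈ I := by
  induction j generalizing u with
  | zero => exact hu
  | succ j ih => exact ih (lie_mem_right R L I s u hu)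

theorem iter_flip (s : L) (j : ℕ) (u : L) (h : (fun z => ⁅z, s⁆)^[j] u = 0) :
    (fun z => ⁅s, z⁆)^[j] u = 0 := by
  have : ∀ j, (fun z => ⁅s, z⁆)^[j] u = (fun z => ⁅z, s⁆)^[j] u ∨
      (fun z => ⁅s, z⁆)^[j] u = -(fun z => ⁅z, s⁆)^[j] u := by
    intro j
    induction j with
    | zero => left; rfl
    | succ j ih =>
      rw [Function.iterate_succ_apply', Function.iterate_succ_apply']
      rcases ih with ih | ih
      · right; rw [ih, lie_skew]
      · left; rw [ih, lie_neg, lie_skew]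
  rcases this j with h' | h' <;> rw [h', h]
  exact neg_zero

theorem iter_sub {E : LieIdeal R L} (hE : E = ⁅(⊤ : LieIdeal R L), (⊤ : LieIdeal R L)⁆)
    (x y : L) (j : ℕ) : ∀ u ∈ E, ⁅x, u⁆ ∈ ⁅E, E⁆ →
      (fun z => ⁅x + y, z⁆)^[j] u - (fun z => ⁅y, z⁆)^[j] u ∈ ⁅E, E⁆ := by
  induction j with
  | zero => intro u _ _; simp
  | succ j ih =>
    intro u hu hx
    have hadd : ∀ (j : ℕ) (s a b : L), (fun z => ⁅s, z⁆)^[j] (a + b) =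
        (fun z => ⁅s, z⁆)^[j] a + (fun z => ⁅s, z⁆)^[j] b := by
      intro j s
      induction j with
      | zero => intro a b; rfl
      | succ j ih => intro a b; simp only [Function.iterate_succ_apply, lie_add, ih]
    rw [Function.iterate_succ_apply, Function.iterate_succ_apply, add_lie, hadd, add_sub_assoc]
    refine add_mem (iter_mem _ _ _ hx) (ih _ (lie_mem_right R L E y u hu) ?_)
    exact swap_mem hE (LieSubmodule.mem_top _) (LieSubmodule.mem_top _) hu
      (lie_mem_right R L _ y _ hx)

/-- auxiliary submodule -/
def SS (E : LieIdeal R L) (x y : L) (j : ℕ) : Submodule R L :=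
  Submodule.span R ({z | z ∈ ⁅E, E⁆} ∪ {z | ∃ u ∈ E, (fun z => ⁅x, z⁆)^[j] u = z} ∪
    {z | ∃ u ∈ E, (fun z => ⁅y, z⁆)^[j] u = z})

theorem SS_symm (E : LieIdeal R L) (x y : L) (j : ℕ) : SS E x y j = SS E y x j := by
  unfold SS
  rw [Set.union_right_comm]

theorem SS_le (E : LieIdeal R L) (x y : L) (j : ℕ) {w : L} (hw : w ∈ SS E x y j) : w ∈ E := by
  have : SS E x y j ≤ (E : Submodule R L) := by
    refine Submodule.span_le.2 ?_
    rintro z ((hz | ⟨u, hu, rfl⟩) | ⟨u, hu, rfl⟩)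
    · exact LieSubmodule.lie_le_right _ _ hz
    · exact iter_mem _ _ _ hu
    · exact iter_mem _ _ _ hu
  exact this hw

theorem SS_step {E : LieIdeal R L} (hE : E = ⁅(⊤ : LieIdeal R L), (⊤ : LieIdeal R L)⁆)
    (x y : L) (hxy : ∀ u ∈ E, ⁅x, ⁅y, u⁆⁆ ∈ ⁅E, E⁆) (j : ℕ) {w : L} (hw : w ∈ SS E x y j) :
    ⁅x, w⁆ ∈ SS E x y (j + 1) := by
  have : SS E x y j ≤ (SS E x y (j + 1)).comap (LieAlgebra.ad R L x) := by
    refine Submodule.span_le.2 ?_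
    rintro z ((hz | ⟨u, hu, rfl⟩) | ⟨u, hu, rfl⟩)
    · exact Submodule.subset_span (Or.inl (Or.inl (lie_mem_right R L ⁅E, E⁆ x z hz)))
    · exact Submodule.subset_span (Or.inl (Or.inr ⟨u, hu, Function.iterate_succ_apply' _ _ _⟩))
    · rcases j with _ | j
      · exact Submodule.subset_span (Or.inl (Or.inr ⟨u, hu, rfl⟩))
      · refine Submodule.subset_span (Or.inl (Or.inl ?_))
        change ⁅x, _⁆ ∈ ⁅E, E⁆
        rw [Function.iterate_succ_apply']
        exact hxy _ (iter_mem _ _ _ hu)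
  exact this hw

theorem meta_nil {E : LieIdeal R L} (hE : E = ⁅(⊤ : LieIdeal R L), (⊤ : LieIdeal R L)⁆)
    (x y : L) (hxy : ∀ u ∈ E, ⁅x, ⁅y, u⁆⁆ ∈ ⁅E, E⁆)
    (hspan : LieSubalgebra.lieSpan R L {x, y} = ⊤) (m : ℕ)
    (hm : ∀ z : L, (fun u => ⁅x + y, u⁆)^[m] z = 0) :
    act ⊤ (m + 1) E ≤ ⁅E, E⁆ := by
  have hyx : ∀ u ∈ E, ⁅y, ⁅x, u⁆⁆ ∈ ⁅E, E⁆ := fun u hu =>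
    swap_mem hE (LieSubmodule.mem_top _) (LieSubmodule.mem_top _) hu (hxy u hu)
  have hy : ∀ u ∈ E, (fun z => ⁅y, z⁆)^[m + 1] u ∈ ⁅E, E⁆ := by
    intro u hu
    have := iter_sub hE x y m ⁅y, u⁆ (lie_mem_right R L E y u hu) (hxy u hu)
    rw [hm, zero_sub, neg_mem_iff] at this
    exact this
  have hx : ∀ u ∈ E, (fun z => ⁅x, z⁆)^[m + 1] u ∈ ⁅E, E⁆ := by
    intro u hu
    have := iter_sub hE y x m ⁅x, u⁆ (lie_mem_right R L E x u hu) (hyx u hu)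
    rw [add_comm y x, hm, zero_sub, neg_mem_iff] at this
    exact this
  have hstep : ∀ (j : ℕ) (z : L), ∀ w ∈ SS E x y j, ⁅z, w⁆ ∈ SS E x y (j + 1) := by
    intro j z
    have hz : z ∈ LieSubalgebra.lieSpan R L {x, y} := hspan ▸ LieSubalgebra.mem_top z
    induction hz using LieSubalgebra.lieSpan_induction with
    | mem z hz =>
      intro w hw
      rcases hz with rfl | rfl
      · exact SS_step hE _ _ hxy j hw
      · rw [SS_symm] at hw ⊢
        exact SS_step hE _ _ hyx j hw
    | zero => intro w hw; rw [zero_lie]; exact zero_mem _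
    | add a b _ _ ha hb => intro w hw; rw [add_lie]; exact add_mem (ha w hw) (hb w hw)
    | smul t a _ ha => intro w hw; rw [smul_lie]; exact Submodule.smul_mem _ _ (ha w hw)
    | lie a b _ _ _ _ =>
      intro w hw
      refine Submodule.subset_span (Or.inl (Or.inl ?_))
      refine LieSubmodule.lie_mem_lie ?_ (SS_le E x y j hw)
      rw [hE]
      exact LieSubmodule.lie_mem_lie (LieSubmodule.mem_top _) (LieSubmodule.mem_top _)
  have hall : ∀ j, ∀ w ∈ act ⊤ j E, w ∈ SS E x y j := by
    intro j
    induction j with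
    | zero => intro w hw; exact Submodule.subset_span (Or.inl (Or.inr ⟨w, hw, rfl⟩))
    | succ j ih =>
      intro w hw
      rw [act_succ] at hw
      exact lie_sub_le _ (fun z _ w hw => hstep j z w (ih w hw)) hw
  intro w hw
  have h1 := hall _ w hw
  have : SS E x y (m + 1) ≤ ((⁅E, E⁆ : LieIdeal R L) : Submodule R L) := by
    refine Submodule.span_le.2 ?_
    rintro z ((hz | ⟨u, hu, rfl⟩) | ⟨u, hu, rfl⟩)
    · exact hz
    · exact hx u hu
    · exact hy u hu
  exact this h1

theorem graded_xy {G : Fin 3 → Submodule R L} (hG : Tri G) {E : LieIdeal R L}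
    (hE : E = ⁅(⊤ : LieIdeal R L), (⊤ : LieIdeal R L)⁆) (gE : Gr G E) {x y : L}
    (hx : x ∈ G 0) (hy : y ∈ G 1) : ∀ u ∈ E, ⁅x, ⁅y, u⁆⁆ ∈ ⁅E, E⁆ := by
  intro u hu
  obtain ⟨u, hu', rfl⟩ := gE u hu; replace hu := hu'
  simp only [lie_sum]
  refine sum_mem fun i _ => ?_
  have hui := hu i
  fin_cases i
  · refine swap_mem hE (LieSubmodule.mem_top _) (LieSubmodule.mem_top _) hui.2 ?_
    rw [hG.same 0 x hx _ hui.1, lie_zero]; exact zero_mem _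
  · rw [hG.same 1 y hy _ hui.1, lie_zero]; exact zero_mem _
  · rw [hG.same 0 x hx _ (hG.diff 1 2 0 (by decide) (by decide) (by decide) y hy _ hui.1)]
    exact zero_mem _

theorem final {G : Fin 3 → Submodule R L} (hG : Tri G)
    (hgr : ∀ j, Gr G (LieAlgebra.derivedSeries R L j)) (k : ℕ)
    (hk : LieAlgebra.derivedSeries R L k = ⊥) {x y : L} (hx : x ∈ G 0) (hy : y ∈ G 1)
    (hspan : LieSubalgebra.lieSpan R L {x, y} = ⊤) (m : ℕ)
    (hm : ∀ z : L, (fun u => ⁅x + y, u⁆)^[m] z = 0) :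
    LieModule.lowerCentralSeries R L L (tb (m + 1) (gb k) + 1) = ⊥ := by
  have h1 := derived_nil hG hgr k hk k le_rfl
  rw [Nat.sub_self] at h1
  have hE : LieAlgebra.derivedSeries R L (0 + 1) = ⁅(⊤ : LieIdeal R L), (⊤ : LieIdeal R L)⁆ := rfl
  have h2 := hall ⊤ _ (m + 1) (meta_nil hE x y (graded_xy hG hE (hgr _) hx hy) hspan m hm) (gb k)
  rw [h1, le_bot_iff, hE, ← act_succ'] at h2
  exact h2

end Metabelian

section Action
variable {R L : Type} [CommRing R] [LieRing L] [LieAlgebra R L]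

/-- simultaneous eigenspaces for the pair of involutions. -/
def eig (v₁ v₂ : L ≃ₗ⁅R⁆ L) (a b : R) : Submodule R L where
  carrier := {x | v₁ x = a • x ∧ v₂ x = b • x}
  add_mem' := by
    rintro x y ⟨h1, h2⟩ ⟨h3, h4⟩
    exact ⟨by rw [map_add, h1, h3, smul_add], by rw [map_add, h2, h4, smul_add]⟩
  zero_mem' := by simp
  smul_mem' := by
    rintro c x ⟨h1, h2⟩
    exact ⟨by rw [map_smul, h1, smul_comm], by rw [map_smul, h2, smul_comm]⟩

/-- The grading. -/
def GG (v₁ v₂ : L ≃ₗ⁅R⁆ L) : Fin 3 → Submodule R L :=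
  ![eig v₁ v₂ 1 (-1), eig v₁ v₂ (-1) 1, eig v₁ v₂ (-1) (-1)]

theorem eig_lie {v₁ v₂ : L ≃ₗ⁅R⁆ L} {a b c d : R} {x y : L} (hx : x ∈ eig v₁ v₂ a b)
    (hy : y ∈ eig v₁ v₂ c d) : ⁅x, y⁆ ∈ eig v₁ v₂ (a * c) (b * d) := by
  obtain ⟨h1, h2⟩ := hx
  obtain ⟨h3, h4⟩ := hy
  constructor
  · rw [LieEquiv.map_lie, h1, h3, smul_lie, lie_smul, smul_smul]
  · rw [LieEquiv.map_lie, h2, h4, smul_lie, lie_smul, smul_smul]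

theorem two_tor {c : R} (hc : c * 2 = 1) {x : L} (h : x + x = 0) : x = 0 := by
  have : x = c • (x + x) := by
    rw [← two_smul R x, smul_smul, hc, one_smul]
  rw [this, h, smul_zero]

theorem tri {c : R} (hc : c * 2 = 1) (v₁ v₂ : L ≃ₗ⁅R⁆ L)
    (h0 : ∀ x : L, v₁ x = x → v₂ x = x → x = 0) : Tri (GG v₁ v₂) where
  same := by
    have key : ∀ x ∈ eig v₁ v₂ 1 1, x = 0 := by
      rintro x ⟨h1, h2⟩
      rw [one_smul] at h1 h2
      exact h0 x h1 h2
    intro i x hx y hy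
    apply key
    fin_cases i <;> simpa using eig_lie hx hy
  diff := by
    intro i j k hij hik hjk x hx y hy
    fin_cases i <;> fin_cases j <;> fin_cases k <;>
      first
      | exact absurd rfl hij
      | exact absurd rfl hik
      | exact absurd rfl hjk
      | simpa [GG] using eig_lie hx hy
  indep := by
    intro y hy hs
    obtain ⟨a1, a2⟩ : v₁ (y 0) = (1 : R) • y 0 ∧ v₂ (y 0) = (-1 : R) • y 0 := hy 0
    obtain ⟨b1, b2⟩ : v₁ (y 1) = (-1 : R) • y 1 ∧ v₂ (y 1) = (1 : R) • y 1 := hy 1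
    obtain ⟨c1, c2⟩ : v₁ (y 2) = (-1 : R) • y 2 ∧ v₂ (y 2) = (-1 : R) • y 2 := hy 2
    rw [Fin.sum_univ_three] at hs
    have e1 : v₁ (y 0 + y 1 + y 2) = 0 := by rw [hs, map_zero]
    have e2 : v₂ (y 0 + y 1 + y 2) = 0 := by rw [hs, map_zero]
    simp only [map_add, a1, a2, b1, b2, c1, c2, one_smul, neg_smul] at e1 e2
    have f0 : y 0 = 0 := two_tor hc (by
      have := congrArg₂ (· + ·) hs e1
      simp only [add_zero] at this
      rw [← this]; abel)
    have f1 : y 1 = 0 := two_tor hc (by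
      have := congrArg₂ (· + ·) hs e2
      simp only [add_zero] at this
      rw [← this]; abel)
    have f2 : y 2 = 0 := by simpa [f0, f1] using hs
    intro i
    fin_cases i
    · exact f0
    · exact f1
    · exact f2

theorem inv_mem (v : L ≃ₗ⁅R⁆ L) (j : ℕ) {x : L} (hx : x ∈ LieAlgebra.derivedSeries R L j) :
    v x ∈ LieAlgebra.derivedSeries R L j :=
  LieIdeal.derivedSeries_map_le (f := v.toLieHom) j (LieIdeal.mem_map hx)

theorem neg_of (v₁ v₂ : L ≃ₗ⁅R⁆ L) (h2 : ∀ x, v₂ (v₂ x) = x)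
    (h12 : ∀ x, v₁ (v₂ x) = v₂ (v₁ x))
    (h0 : ∀ x : L, v₁ x = x → v₂ x = x → x = 0) {x : L} (hx : v₁ x = x) : v₂ x = -x := by
  have : x + v₂ x = 0 := h0 _ (by rw [map_add, h12, hx]) (by rw [map_add, h2, add_comm])
  exact (neg_eq_of_add_eq_zero_right this).symm

theorem gr {c : R} (hc : c * 2 = 1) (v₁ v₂ : L ≃ₗ⁅R⁆ L) (h1 : ∀ x, v₁ (v₁ x) = x)
    (h2 : ∀ x, v₂ (v₂ x) = x) (h12 : ∀ x, v₁ (v₂ x) = v₂ (v₁ x))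
    (h0 : ∀ x : L, v₁ x = x → v₂ x = x → x = 0) (j : ℕ) :
    Gr (GG v₁ v₂) (LieAlgebra.derivedSeries R L j) := by
  intro x hx
  have hT : x + v₁ x + v₂ x + v₂ (v₁ x) = 0 :=
    h0 _ (by simp only [map_add, h1, h12]; abel) (by simp only [map_add, h2]; abel)
  have e : v₂ (v₁ x) = -(x + v₁ x + v₂ x) := (neg_eq_of_add_eq_zero_right hT).symm
  have hcc : x = c • (x + x) := by
    rw [← two_smul R x, smul_smul, hc, one_smul]
  refine ⟨![c • (x + v₁ x), c • (x + v₂ x), c • (x + v₂ (v₁ x))], ?_, ?_⟩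
  · have m1 := inv_mem v₁ j hx
    have m2 := inv_mem v₂ j hx
    have m3 := inv_mem v₂ j m1
    intro i
    fin_cases i
    · refine ⟨Submodule.smul_mem _ _ ⟨?_, ?_⟩, Submodule.smul_mem (LieAlgebra.derivedSeries R L j).toSubmodule _ (add_mem hx m1)⟩
      · rw [map_add, h1, one_smul, add_comm]
      · rw [map_add, e, neg_smul, one_smul]; abel
    · refine ⟨Submodule.smul_mem _ _ ⟨?_, ?_⟩, Submodule.smul_mem (LieAlgebra.derivedSeries R L j).toSubmodule _ (add_mem hx m2)⟩
      · rw [map_add, h12, e, neg_smul, one_smul]; abel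
      · rw [map_add, h2, one_smul, add_comm]
    · refine ⟨Submodule.smul_mem _ _ ⟨?_, ?_⟩, Submodule.smul_mem (LieAlgebra.derivedSeries R L j).toSubmodule _ (add_mem hx m3)⟩
      · rw [map_add, h12, h1, e, neg_smul, one_smul]; abel
      · rw [map_add, h2, e, neg_smul, one_smul]; abel
  · rw [Fin.sum_univ_three]
    change c • (x + v₁ x) + c • (x + v₂ x) + c • (x + v₂ (v₁ x)) = x
    rw [← smul_add, ← smul_add, e]
    conv_rhs => rw [hcc]
    congr 1
    abel

end Action

end D8Aux

/-- **Proposition 2.4.** There is a function `f : ℕ × ℕ × ℕ → ℕ` such that the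
following holds.  Let the dihedral group `A = V⟨α⟩` of order `8` (with
`V = {1,v₁,v₂,v₃}` a Klein four-group, `α` an involution, `v₁^α = v₂`) act by
automorphisms on a Lie algebra `L` over a commutative ring in which `2` is
invertible, with `C_L(V) = 0`, and assume `L` is soluble with derived length `k`.
Suppose `L = ⟨x₁, x₁^α⟩` for some `x₁ ∈ L₁`, every homogeneous element of `L_α`
(w.r.t. this generating set) is ad-nilpotent of index at most `m`, and every pair
of homogeneous elements of `L_α` generates a subalgebra nilpotent of class at most
`n`.  Then `L` is nilpotent of class at most `f (k, m, n)`. -/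
theorem lie_nilpotent_of_D8_action_of_solvable :
    ∃ f : ℕ × ℕ × ℕ → ℕ,
      ∀ (R : Type) [CommRing R] (L : Type) [LieRing L] [LieAlgebra R L],
        IsUnit (2 : R) →
      ∀ (v₁ v₂ α : L ≃ₗ⁅R⁆ L),
        (∀ x, v₁ (v₁ x) = x) → (∀ x, v₂ (v₂ x) = x) →
        (∀ x, v₁ (v₂ x) = v₂ (v₁ x)) →
        (∀ x, α (α x) = x) →
        (∀ x, α (v₁ (α x)) = v₂ x) →
        (∀ x : L, v₁ x = x → v₂ x = x → x = 0) →
      ∀ (k : ℕ), LieAlgebra.derivedSeries R L k = ⊥ →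
      ∀ (x₁ : L), v₁ x₁ = x₁ →
        LieSubalgebra.lieSpan R L {x₁, α x₁} = ⊤ →
      ∀ (m n : ℕ), 0 < m → 0 < n →
        (∀ y : L, α y = y → IsHomogeneousElement R x₁ (α x₁) y →
          ∀ z : L, (fun u => ⁅u, y⁆)^[m] z = 0) →
        (∀ y z : L, α y = y → α z = z →
          IsHomogeneousElement R x₁ (α x₁) y → IsHomogeneousElement R x₁ (α x₁) z →
          LieModule.lowerCentralSeries R (LieSubalgebra.lieSpan R L {y, z})
            (LieSubalgebra.lieSpan R L {y, z}) n = ⊥) →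
        LieModule.lowerCentralSeries R L L (f (k, m, n)) = ⊥ := by
  refine ⟨fun p => D8Aux.tb (p.2.1 + 1) (D8Aux.gb p.1) + 1, ?_⟩
  intro R _ L _ _ h2 v₁ v₂ α hv₁ hv₂ h12 hα hαv h0 k hk x₁ hx₁ hspan m n _ _ hm _
  obtain ⟨c, hc⟩ := h2.exists_left_inv
  have hx₂ : v₂ (α x₁) = α x₁ := by rw [← hαv, hα, hx₁]
  refine D8Aux.final (D8Aux.tri hc v₁ v₂ h0) (D8Aux.gr hc v₁ v₂ hv₁ hv₂ h12 h0) k hk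
    (x := x₁) (y := α x₁) ?_ ?_ hspan m ?_
  · refine ⟨by rw [hx₁, one_smul], ?_⟩
    rw [D8Aux.neg_of v₁ v₂ hv₂ h12 h0 hx₁, neg_smul, one_smul]
  · refine ⟨?_, by rw [hx₂, one_smul]⟩
    rw [D8Aux.neg_of v₂ v₁ hv₁ (fun x => (h12 x).symm) (fun x a b => h0 x b a) hx₂,
      neg_smul, one_smul]
  · intro z
    refine D8Aux.iter_flip _ _ _ (hm _ ?_ ⟨1, ?_⟩ z)
    · rw [map_add, hα, add_comm]
    · exact add_mem (Submodule.subset_span .base₁) (Submodule.subset_span .base₂)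
end

section
/- Let V act on the Lie algebra L as in the context with C_L(V) = 0. Suppose x ∈ L is written as x = x₁ + x₂ + x₃ with x_i ∈ L_i for i = 1, 2, 3. If y ∈ L_i for some i ∈ {1,2,3} and [y, x] = 0, then [y, x₁] = [y, x₂] = [y, x₃] = 0. -/
/-- **Lemma 2.5.**  Let the Klein four-group `V = {1, v₁, v₂, v₃}` (here encoded
by the automorphisms `g 0 = v₁`, `g 1 = v₂`, `g 2 = v₃ = v₁v₂`) act by
automorphisms on a Lie algebra `L` over a commutative ring in which `2` is
invertible, with `C_L(V) = 0`.  Write `x = x₁ + x₂ + x₃` with `xᵢ ∈ Lᵢ`.  If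
`y ∈ Lᵢ` for some `i` and `⁅y, x⁆ = 0`, then `⁅y, x₁⁆ = ⁅y, x₂⁆ = ⁅y, x₃⁆ = 0`. -/
theorem lie_centralizer_components_of_kleinFour_action
    (R : Type) [CommRing R] (L : Type) [LieRing L] [LieAlgebra R L]
    (h2 : IsUnit (2 : R))
    (g : Fin 3 → (L ≃ₗ⁅R⁆ L))
    (hinv : ∀ i x, g i (g i x) = x)
    (hcomm : ∀ x, g 0 (g 1 x) = g 1 (g 0 x))
    (hg2 : ∀ x, g 2 x = g 0 (g 1 x))
    (hfpf : ∀ x : L, g 0 x = x → g 1 x = x → x = 0)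
    (x x₁ x₂ x₃ : L)
    (h₁ : g 0 x₁ = x₁) (h₂ : g 1 x₂ = x₂) (h₃ : g 2 x₃ = x₃)
    (hx : x = x₁ + x₂ + x₃)
    (i : Fin 3) (y : L) (hy : g i y = y) (hyx : ⁅y, x⁆ = 0) :
    ⁅y, x₁⁆ = 0 ∧ ⁅y, x₂⁆ = 0 ∧ ⁅y, x₃⁆ = 0 := by
  have tor : ∀ a : L, a + a = 0 → a = 0 := by
    intro a ha
    obtain ⟨u, hu⟩ := h2
    have h : (2 : R) • a = 0 := by rw [two_smul]; exact ha
    rw [← hu] at h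
    have := congrArg (fun z => (↑u⁻¹ : R) • z) h
    simpa [smul_smul] using this
  have s0 : ∀ z, g 0 z = z → g 1 z = -z := by
    intro z hz
    have := hfpf (g 1 z + z) (by rw [map_add, hcomm, hz]) (by rw [map_add, hinv, add_comm])
    exact eq_neg_of_add_eq_zero_left this
  have s1 : ∀ z, g 1 z = z → g 0 z = -z := by
    intro z hz
    have := hfpf (g 0 z + z) (by rw [map_add, hinv, add_comm]) (by rw [map_add, ← hcomm, hz])
    exact eq_neg_of_add_eq_zero_left this
  have s2 : ∀ z, g 2 z = z → g 0 z = -z ∧ g 1 z = -z := by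
    intro z hz
    have e : g 1 z = g 0 z := by
      have := congrArg (g 0) hz
      rwa [hg2, hinv] at this
    have := hfpf (g 0 z + z) (by rw [map_add, hinv, add_comm])
      (by rw [map_add, ← hcomm, e, hinv, add_comm])
    have h := eq_neg_of_add_eq_zero_left this
    exact ⟨h, e.trans h⟩
  have ml : ∀ j (a b : L), g j ⁅a, b⁆ = ⁅g j a, g j b⁆ := fun j a b => (g j).map_lie a b
  have t1 := s0 _ h₁
  have t2 := s1 _ h₂
  obtain ⟨t3, t3'⟩ := s2 _ h₃
  have main : ∀ a b : L, a + b = 0 → ∀ j, g j a = a → g j b = -b → a = 0 ∧ b = 0 := by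
    intro a b hab j ha hb
    have h := congrArg (g j) hab
    rw [map_add, ha, hb, map_zero] at h
    have e : a = b := by rw [← sub_eq_zero, sub_eq_add_neg]; exact h
    subst e
    exact ⟨tor _ hab, tor _ hab⟩
  rw [hx, lie_add, lie_add] at hyx
  have hi : i = 0 ∨ i = 1 ∨ i = 2 := by fin_cases i <;> simp
  rcases hi with rfl | rfl | rfl
  · have q := s0 _ hy
    have z : ⁅y, x₁⁆ = 0 := hfpf _ (by simp [ml, hy, h₁]) (by simp [ml, q, t1])
    rw [z, zero_add, add_comm] at hyx
    obtain ⟨a, b⟩ := main _ _ hyx 1 (by simp [ml, q, t3']) (by simp [ml, q, h₂])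
    exact ⟨z, b, a⟩
  · have q := s1 _ hy
    have z : ⁅y, x₂⁆ = 0 := hfpf _ (by simp [ml, q, t2]) (by simp [ml, hy, h₂])
    rw [z, add_zero, add_comm] at hyx
    obtain ⟨a, b⟩ := main _ _ hyx 0 (by simp [ml, q, t3]) (by simp [ml, q, h₁])
    exact ⟨b, z, a⟩
  · obtain ⟨q, q'⟩ := s2 _ hy
    have z : ⁅y, x₃⁆ = 0 := hfpf _ (by simp [ml, q, t3]) (by simp [ml, q', t3'])
    rw [z, add_zero] at hyx
    obtain ⟨a, b⟩ := main _ _ hyx 1 (by simp [ml, q', t1]) (by simp [ml, q', h₂])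
    exact ⟨a, b, z⟩
end

section
/- Let V act on the Lie algebra L as in the context with C_L(V) = 0. Suppose [a, b] = 0, where a ∈ L_i and b ∈ L_j for some i ≠ j. Then the Lie ideal of L generated by the set [b, L_i] = {[b, u] : u ∈ L_i} is contained in C_L(a) = {x ∈ L : [a, x] = 0}. -/
/-- Membership in the sets of generators used for the ideal. -/
def KGen {R L : Type} [CommRing R] [LieRing L] [LieAlgebra R L]
    (A B : Submodule R L) (a : L) : Set L :=
  {s | ∃ b ∈ B, ∃ u ∈ A, ⁅a, b⁆ = 0 ∧ (s = ⁅b, u⁆ ∨ ∃ z ∈ B, s = ⁅⁅b, u⁆, z⁆)}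

theorem KGen_kill {R L : Type} [CommRing R] [LieRing L] [LieAlgebra R L]
    (A B C : Submodule R L) (a : L) (ha : a ∈ A)
    (hAA : ∀ x ∈ A, ∀ y ∈ A, ⁅x, y⁆ = 0)
    (hAB : ∀ x ∈ A, ∀ y ∈ B, ⁅x, y⁆ ∈ C) (hBC : ∀ x ∈ B, ∀ y ∈ C, ⁅x, y⁆ ∈ A)
    (s : L) (hs : s ∈ KGen A B a) : ⁅a, s⁆ = 0 := by
  obtain ⟨b, hb, u, hu, hab, rfl | ⟨z, hz, rfl⟩⟩ := hs
  · rw [leibniz_lie, hab, hAA a ha u hu]; simp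
  · apply hAA a ha
    rw [← lie_skew]
    apply A.neg_mem
    apply hBC z hz
    rw [← lie_skew]
    exact C.neg_mem (hAB u hu b hb)

theorem KGen_step {R L : Type} [CommRing R] [LieRing L] [LieAlgebra R L]
    (A B C : Submodule R L) (a : L) (ha : a ∈ A)
    (hAA : ∀ x ∈ A, ∀ y ∈ A, ⁅x, y⁆ = 0) (hBB : ∀ x ∈ B, ∀ y ∈ B, ⁅x, y⁆ = 0)
    (hCC : ∀ x ∈ C, ∀ y ∈ C, ⁅x, y⁆ = 0)
    (hAB : ∀ x ∈ A, ∀ y ∈ B, ⁅x, y⁆ ∈ C) (hBC : ∀ x ∈ B, ∀ y ∈ C, ⁅x, y⁆ ∈ A)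
    (s : L) (hs : s ∈ KGen A B a) (x : L) (hx : x ∈ A ∨ x ∈ B ∨ x ∈ C) :
    ⁅s, x⁆ = 0 ∨ ⁅s, x⁆ ∈ KGen A B a ∪ KGen A C a := by
  have hk := KGen_kill A B C a ha hAA hAB hBC
  obtain ⟨b, hb, u, hu, hab, h⟩ := hs
  have hw : ⁅b, u⁆ ∈ C := by
    rw [← lie_skew]; exact C.neg_mem (hAB u hu b hb)
  have hwa : ⁅a, ⁅b, u⁆⁆ = 0 := hk _ ⟨b, hb, u, hu, hab, Or.inl rfl⟩
  obtain rfl | ⟨z, hz, rfl⟩ := h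
  · rcases hx with hx | hx | hx
    · exact Or.inr (Or.inr ⟨_, hw, x, hx, hwa, Or.inl rfl⟩)
    · exact Or.inr (Or.inl ⟨b, hb, u, hu, hab, Or.inr ⟨x, hx, rfl⟩⟩)
    · exact Or.inl (hCC _ hw _ hx)
  · have hbz := hBB b hb z hz
    rcases hx with hx | hx | hx
    · refine Or.inl (hAA _ ?_ _ hx)
      rw [← lie_skew]
      exact A.neg_mem (hBC z hz _ hw)
    · refine Or.inr (Or.inl ⟨b, hb, ⁅⁅u, z⁆, x⁆, ?_, hab, Or.inl ?_⟩)
      · rw [← lie_skew]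
        exact A.neg_mem (hBC x hx _ (hAB u hu z hz))
      · have hbx := hBB b hb x hx
        rw [lie_lie b u z, hbz, lie_zero, sub_zero, lie_lie b, hbx, lie_zero, sub_zero]
    · refine Or.inr (Or.inr ⟨_, hw, ⁅z, x⁆, hBC z hz x hx, hwa, Or.inl ?_⟩)
      rw [lie_lie ⁅b, u⁆ z x, hCC _ hw _ hx, lie_zero, sub_zero]

theorem core {R L : Type} [CommRing R] [LieRing L] [LieAlgebra R L]
    (A B C : Submodule R L) (a b : L) (ha : a ∈ A) (hb : b ∈ B) (hab : ⁅a, b⁆ = 0)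
    (hAA : ∀ x ∈ A, ∀ y ∈ A, ⁅x, y⁆ = 0) (hBB : ∀ x ∈ B, ∀ y ∈ B, ⁅x, y⁆ = 0)
    (hCC : ∀ x ∈ C, ∀ y ∈ C, ⁅x, y⁆ = 0)
    (hAB : ∀ x ∈ A, ∀ y ∈ B, ⁅x, y⁆ ∈ C) (hBC : ∀ x ∈ B, ∀ y ∈ C, ⁅x, y⁆ ∈ A)
    (hAC : ∀ x ∈ A, ∀ y ∈ C, ⁅x, y⁆ ∈ B)
    (hdec : ∀ x : L, ∃ p ∈ A, ∃ q ∈ B, ∃ r ∈ C, x = p + q + r) :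
    ∀ x ∈ LieSubmodule.lieSpan R L {z : L | ∃ u : L, u ∈ A ∧ z = ⁅b, u⁆}, ⁅a, x⁆ = 0 := by
  have hCB : ∀ x ∈ C, ∀ y ∈ B, ⁅x, y⁆ ∈ A := fun x hx y hy => by
    rw [← lie_skew]; exact A.neg_mem (hBC y hy x hx)
  set S := KGen A B a ∪ KGen A C a with hS
  have step : ∀ s ∈ S, ∀ x, (x ∈ A ∨ x ∈ B ∨ x ∈ C) → ⁅x, s⁆ ∈ Submodule.span R S := by
    intro s hs x hx
    rw [← lie_skew]
    apply Submodule.neg_mem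
    have : ⁅s, x⁆ = 0 ∨ ⁅s, x⁆ ∈ S := by
      rcases hs with hs | hs
      · exact KGen_step A B C a ha hAA hBB hCC hAB hBC s hs x hx
      · rw [hS, Set.union_comm]
        exact KGen_step A C B a ha hAA hCC hBB hAC hCB s hs x (by tauto)
    rcases this with h | h
    · rw [h]; exact Submodule.zero_mem _
    · exact Submodule.subset_span h
  let N : LieSubmodule R L L :=
    { Submodule.span R S with
      lie_mem := by
        intro x m hm
        change m ∈ Submodule.span R S at hm
        change ⁅x, m⁆ ∈ Submodule.span R S
        induction hm using Submodule.span_induction with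
        | mem s hs =>
          obtain ⟨p, hp, q, hq, r, hr, rfl⟩ := hdec x
          rw [add_lie, add_lie]
          exact add_mem (add_mem (step s hs p (by tauto)) (step s hs q (by tauto)))
            (step s hs r (by tauto))
        | zero => rw [lie_zero]; exact Submodule.zero_mem _
        | add y z _ _ h1 h2 => rw [lie_add]; exact add_mem h1 h2
        | smul t y _ h => rw [lie_smul]; exact Submodule.smul_mem _ _ h }
  intro x hx
  have hle : LieSubmodule.lieSpan R L {z : L | ∃ u : L, u ∈ A ∧ z = ⁅b, u⁆} ≤ N := by
    rw [LieSubmodule.lieSpan_le]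
    rintro _ ⟨u, hu, rfl⟩
    exact Submodule.subset_span (Or.inl ⟨b, hb, u, hu, hab, Or.inl rfl⟩)
  have hxN : x ∈ Submodule.span R S := hle hx
  clear hx
  induction hxN using Submodule.span_induction with
  | mem s hs =>
    rcases hs with hs | hs
    · exact KGen_kill A B C a ha hAA hAB hBC s hs
    · exact KGen_kill A C B a ha hAA hAC hCB s hs
  | zero => simp
  | add y z _ _ h1 h2 => rw [lie_add, h1, h2, add_zero]
  | smul t y _ h => rw [lie_smul, h, smul_zero]

/-- The fixed submodule. -/
def fixS {R L : Type} [CommRing R] [LieRing L] [LieAlgebra R L] (p : L ≃ₗ⁅R⁆ L) :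
    Submodule R L where
  carrier := {x | p x = x}
  add_mem' := by intro x y hx hy; simp only [Set.mem_setOf_eq] at *; rw [map_add, hx, hy]
  zero_mem' := by simp
  smul_mem' := by intro c x hx; simp only [Set.mem_setOf_eq] at *; rw [map_smul, hx]

theorem core2 {R L : Type} [CommRing R] [LieRing L] [LieAlgebra R L]
    (h2 : IsUnit (2 : R)) (p q r : L ≃ₗ⁅R⁆ L)
    (hp : ∀ x, p (p x) = x) (hq : ∀ x, q (q x) = x)
    (hpq : ∀ x, p (q x) = q (p x)) (hr : ∀ x, r x = p (q x))
    (hf : ∀ x, p x = x → q x = x → x = 0)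
    (a b : L) (ha : p a = a) (hb : q b = b) (hab : ⁅a, b⁆ = 0) :
    ∀ x ∈ LieSubmodule.lieSpan R L {z : L | ∃ u : L, p u = u ∧ z = ⁅b, u⁆}, ⁅a, x⁆ = 0 := by
  have pq : ∀ x, p x = x → q x = -x := fun x hx => by
    rw [eq_neg_iff_add_eq_zero]
    apply hf <;> simp [hpq, hx, hq, add_comm]
  have qp : ∀ x, q x = x → p x = -x := fun x hx => by
    rw [eq_neg_iff_add_eq_zero]
    apply hf <;> simp [← hpq, hx, hp, add_comm]
  have rp : ∀ x, r x = x → p x = -x := fun x hx => by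
    have h1 : p x = q x := by conv_lhs => rw [← hx, hr, hp]
    rw [eq_neg_iff_add_eq_zero]
    apply hf
    · simp [hp, add_comm]
    · rw [h1]; simp [hq, add_comm]
  have rq : ∀ x, r x = x → q x = -x := fun x hx => by
    have h1 : p x = q x := by conv_lhs => rw [← hx, hr, hp]
    rw [← h1, rp x hx]
  have hpm : ∀ x y, p ⁅x, y⁆ = ⁅p x, p y⁆ := fun x y => LieEquiv.map_lie p x y
  have hqm : ∀ x y, q ⁅x, y⁆ = ⁅q x, q y⁆ := fun x y => LieEquiv.map_lie q x y
  refine core (fixS p) (fixS q) (fixS r) a b ha hb hab ?_ ?_ ?_ ?_ ?_ ?_ ?_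
  · intro x hx y hy
    change p x = x at hx; change p y = y at hy
    apply hf
    · rw [hpm, hx, hy]
    · rw [hqm, pq x hx, pq y hy]; simp
  · intro x hx y hy
    change q x = x at hx; change q y = y at hy
    apply hf
    · rw [hpm, qp x hx, qp y hy]; simp
    · rw [hqm, hx, hy]
  · intro x hx y hy
    change r x = x at hx; change r y = y at hy
    apply hf
    · rw [hpm, rp x hx, rp y hy]; simp
    · rw [hqm, rq x hx, rq y hy]; simp
  · intro x hx y hy
    change p x = x at hx; change q y = y at hy
    change r _ = _
    rw [hr, hqm, hpm, pq x hx, hy, map_neg, hx, qp y hy]; simp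
  · intro x hx y hy
    change q x = x at hx; change r y = y at hy
    change p _ = _
    rw [hpm, qp x hx, rp y hy]; simp
  · intro x hx y hy
    change p x = x at hx; change r y = y at hy
    change q _ = _
    rw [hqm, pq x hx, rq y hy]; simp
  · intro x
    obtain ⟨t, ht⟩ := h2.exists_left_inv
    have hz : x + p x + q x + r x = 0 := by
      apply hf
      · simp only [map_add, hr, hp]; abel
      · simp only [map_add, hr, hq, ← hpq]; abel
    refine ⟨t • (x + p x), Submodule.smul_mem _ _ ?_, t • (x + q x),
      Submodule.smul_mem _ _ ?_, t • (x + r x), Submodule.smul_mem _ _ ?_, ?_⟩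
    · change p _ = _
      simp [hp, add_comm]
    · change q _ = _
      simp [hq, add_comm]
    · change r _ = _
      simp [hr, hp, hq, ← hpq, add_comm]
    · have h3 : x + p x + (x + q x) + (x + r x) = (2 : R) • x := by
        rw [two_smul, ← add_zero (x + x), ← hz]; abel
      rw [← smul_add, ← smul_add, h3, smul_smul, ht, one_smul]

/-- **Lemma 2.1.**  Let the Klein four-group `V = {1, v₁, v₂, v₃}` (here encoded
by the automorphisms `g 0 = v₁`, `g 1 = v₂`, `g 2 = v₃ = v₁v₂`) act by
automorphisms on a Lie algebra `L` over a commutative ring in which `2` is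
invertible, with `C_L(V) = 0`.  Suppose `⁅a, b⁆ = 0` with `a ∈ Lᵢ`, `b ∈ Lⱼ`,
`i ≠ j`.  Then the Lie ideal of `L` generated by `⁅b, Lᵢ⁆` is contained in
`C_L(a)`. -/
theorem lie_ideal_le_centralizer_of_kleinFour_action
    (R : Type) [CommRing R] (L : Type) [LieRing L] [LieAlgebra R L]
    (h2 : IsUnit (2 : R))
    (g : Fin 3 → (L ≃ₗ⁅R⁆ L))
    (hinv : ∀ i x, g i (g i x) = x)
    (hcomm : ∀ x, g 0 (g 1 x) = g 1 (g 0 x))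
    (hg2 : ∀ x, g 2 x = g 0 (g 1 x))
    (hfpf : ∀ x : L, g 0 x = x → g 1 x = x → x = 0)
    (i j : Fin 3) (hij : i ≠ j)
    (a b : L) (ha : g i a = a) (hb : g j b = b) (hab : ⁅a, b⁆ = 0) :
    ∀ x ∈ LieSubmodule.lieSpan R L {z : L | ∃ u : L, g i u = u ∧ z = ⁅b, u⁆},
      ⁅a, x⁆ = 0 := by
  have key : ∃ k : Fin 3, (∀ x, g i (g j x) = g j (g i x)) ∧ (∀ x, g k x = g i (g j x)) ∧
      (∀ x : L, g i x = x → g j x = x → x = 0) := by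
    have h20 : ∀ x, g 2 (g 0 x) = g 1 x := fun x => by rw [hg2, ← hcomm, hinv]
    have h02 : ∀ x, g 0 (g 2 x) = g 1 x := fun x => by rw [hg2, hinv]
    have h21 : ∀ x, g 2 (g 1 x) = g 0 x := fun x => by rw [hg2, hinv]
    have h12 : ∀ x, g 1 (g 2 x) = g 0 x := fun x => by rw [hg2, hcomm, hinv]
    have f02 : ∀ x : L, g 0 x = x → g 2 x = x → x = 0 := fun x h0 h => by
      refine hfpf x h0 ?_
      rw [← h20, h0, h]
    have f12 : ∀ x : L, g 1 x = x → g 2 x = x → x = 0 := fun x h0 h => by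
      refine hfpf x ?_ h0
      rw [← h21, h0, h]
    have cases3 : ∀ n : Fin 3, n = 0 ∨ n = 1 ∨ n = 2 := by decide
    rcases cases3 i with rfl | rfl | rfl <;> rcases cases3 j with rfl | rfl | rfl
    · exact absurd rfl hij
    · exact ⟨2, hcomm, hg2, hfpf⟩
    · exact ⟨1, fun x => by rw [h02, h20], fun x => (h02 x).symm, f02⟩
    · exact ⟨2, fun x => (hcomm x).symm, fun x => by rw [hg2, hcomm], fun x h h' => hfpf x h' h⟩
    · exact absurd rfl hij
    · exact ⟨0, fun x => by rw [h12, h21], fun x => (h12 x).symm, f12⟩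
    · exact ⟨1, fun x => by rw [h02, h20], fun x => (h20 x).symm, fun x h h' => f02 x h' h⟩
    · exact ⟨0, fun x => by rw [h12, h21], fun x => (h21 x).symm, fun x h h' => f12 x h' h⟩
    · exact absurd rfl hij
  obtain ⟨k, hc, hk, hf⟩ := key
  exact core2 h2 (g i) (g j) (g k) (hinv i) (hinv j) hc hk hf a b ha hb hab
end

section
/- Let V act on the Lie algebra L as in the context with C_L(V) = 0. Let a ∈ L₁ ∪ L₂ ∪ L₃ and suppose that a is ad-nilpotent of index at most m. Then the Lie ideal of L generated by a is nilpotent of class at most 2m − 1. -/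
namespace KleinFourLie

variable {R : Type} [CommRing R] {L : Type} [LieRing L] [LieAlgebra R L]

structure Gr (L1 L2 L3 : Submodule R L) : Prop where
  c1 : ∀ x ∈ L1, ∀ y ∈ L1, ⁅x, y⁆ = 0
  c2 : ∀ x ∈ L2, ∀ y ∈ L2, ⁅x, y⁆ = 0
  c3 : ∀ x ∈ L3, ∀ y ∈ L3, ⁅x, y⁆ = 0
  p12 : ∀ x ∈ L1, ∀ y ∈ L2, ⁅x, y⁆ ∈ L3
  p13 : ∀ x ∈ L1, ∀ y ∈ L3, ⁅x, y⁆ ∈ L2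
  p23 : ∀ x ∈ L2, ∀ y ∈ L3, ⁅x, y⁆ ∈ L1
  dec : ∀ x : L, ∃ x1 ∈ L1, ∃ x2 ∈ L2, ∃ x3 ∈ L3, x = x1 + x2 + x3

lemma flip_mem {S : Submodule R L} {x y : L} (h : ⁅x, y⁆ ∈ S) : ⁅y, x⁆ ∈ S := by
  rw [← lie_skew]; exact S.neg_mem h

lemma flip_memI {S : LieIdeal R L} {x y : L} (h : ⁅x, y⁆ ∈ S) : ⁅y, x⁆ ∈ S := by
  rw [← lie_skew]; exact neg_mem h

lemma Gr.swap {L1 L2 L3 : Submodule R L} (h : Gr L1 L2 L3) : Gr L1 L3 L2 where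
  c1 := h.c1
  c2 := h.c3
  c3 := h.c2
  p12 := h.p13
  p13 := h.p12
  p23 := fun x hx y hy => flip_mem (h.p23 y hy x hx)
  dec := fun x => by
    obtain ⟨x1, h1, x2, h2, x3, h3, e⟩ := h.dec x
    exact ⟨x1, h1, x3, h3, x2, h2, by rw [e]; abel⟩

/-- The elements of `L1` behaving like even products `[a, L2, …, L2]`. -/
def S (L1 L2 L3 : Submodule R L) (a w : L) : Prop :=
  w ∈ L1 ∧ (∀ y ∈ L3, ∃ y' : L, ⁅y, w⁆ = ⁅y', a⁆) ∧
    ∀ I : LieIdeal R L, ∀ c ∈ L2, ⁅c, a⁆ ∈ I → ⁅c, w⁆ ∈ I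

lemma S_self {L1 L2 L3 : Submodule R L} {a : L} (ha : a ∈ L1) : S L1 L2 L3 a a :=
  ⟨ha, fun y _ => ⟨y, rfl⟩, fun _ _ _ h => h⟩

lemma S_step {L1 L2 L3 : Submodule R L} (h : Gr L1 L2 L3) {a w x x' : L}
    (hw : S L1 L2 L3 a w) (hx : x ∈ L2) (hx' : x' ∈ L2) : S L1 L2 L3 a ⁅⁅w, x⁆, x'⁆ := by
  obtain ⟨h1, h3, h2⟩ := hw
  have hwx := h.p12 w h1 x hx
  refine ⟨flip_mem (h.p23 x' hx' _ hwx), ?_, ?_⟩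
  · intro y hy
    have hu := h.p23 x' hx' y hy
    have hxu := flip_mem (h.p12 _ hu x hx)
    obtain ⟨y', e⟩ := h3 _ hxu
    refine ⟨y', ?_⟩
    rw [← e]
    have e1 : ⁅y, ⁅w, x⁆⁆ = 0 := h.c3 _ hy _ hwx
    have e2 : ⁅w, ⁅x', y⁆⁆ = 0 := h.c1 _ h1 _ hu
    rw [leibniz_lie y ⁅w, x⁆ x', e1, zero_lie, zero_add, ← lie_skew y x', lie_neg, lie_lie w x,
      e2, lie_zero, sub_zero, ← lie_skew w, neg_neg]
  · intro I c hc hca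
    have e1 : ⁅c, x⁆ = 0 := h.c2 _ hc _ hx
    have e2 : ⁅c, x'⁆ = 0 := h.c2 _ hc _ hx'
    rw [leibniz_lie c _ x', e2, lie_zero, add_zero, leibniz_lie c w x, e1, lie_zero, add_zero]
    exact flip_memI (lie_mem_right R L I _ _ (flip_memI (lie_mem_right R L I _ _ (h2 I c hc hca))))

def T (L1 L2 L3 : Submodule R L) (a : L) : Set L :=
  {n | S L1 L2 L3 a n ∨ S L1 L3 L2 a n ∨ (∃ w x : L, S L1 L2 L3 a w ∧ x ∈ L2 ∧ n = ⁅w, x⁆) ∨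
    (∃ w x : L, S L1 L3 L2 a w ∧ x ∈ L3 ∧ n = ⁅w, x⁆)}

lemma T_swap {L1 L2 L3 : Submodule R L} {a : L} : T L1 L3 L2 a = T L1 L2 L3 a := by
  ext n; simp only [T, Set.mem_ofPred_eq]
  constructor <;> rintro (h | h | h | h) <;> simp only [h, true_or, or_true]

/-- `[a, L] ⊆ span T`. -/
lemma a_mem {L1 L2 L3 : Submodule R L} (h : Gr L1 L2 L3) {a : L} (ha : a ∈ L1) (y : L) :
    ⁅y, a⁆ ∈ Submodule.span R (T L1 L2 L3 a) := by
  obtain ⟨x1, h1, x2, h2, x3, h3, e⟩ := h.dec y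
  rw [e, add_lie, add_lie, h.c1 _ h1 _ ha, zero_add]
  refine add_mem (flip_mem ?_) (flip_mem ?_)
  · exact Submodule.subset_span (Or.inr (Or.inr (Or.inl ⟨a, x2, S_self ha, h2, rfl⟩)))
  · exact Submodule.subset_span (Or.inr (Or.inr (Or.inr ⟨a, x3, S_self ha, h3, rfl⟩)))

lemma step1 {L1 L2 L3 : Submodule R L} (h : Gr L1 L2 L3) {a : L} (ha : a ∈ L1) {n : L}
    (hn : S L1 L2 L3 a n) (y : L) : ⁅y, n⁆ ∈ Submodule.span R (T L1 L2 L3 a) := by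
  obtain ⟨x1, h1, x2, h2, x3, h3, e⟩ := h.dec y
  rw [e, add_lie, add_lie, h.c1 _ h1 _ hn.1, zero_add]
  refine add_mem (flip_mem ?_) ?_
  · exact Submodule.subset_span (Or.inr (Or.inr (Or.inl ⟨n, x2, hn, h2, rfl⟩)))
  · obtain ⟨y', e'⟩ := hn.2.1 _ h3
    rw [e']; exact a_mem h ha y'

lemma step2 {L1 L2 L3 : Submodule R L} (h : Gr L1 L2 L3) {a : L} (ha : a ∈ L1) {w x : L}
    (hw : S L1 L2 L3 a w) (hx : x ∈ L2) (y : L) :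
    ⁅y, ⁅w, x⁆⁆ ∈ Submodule.span R (T L1 L2 L3 a) := by
  obtain ⟨x1, h1, x2, h2, x3, h3, e⟩ := h.dec y
  rw [e, add_lie, add_lie, h.c3 _ h3 _ (h.p12 _ hw.1 _ hx), add_zero]
  refine add_mem ?_ (flip_mem ?_)
  · rw [leibniz_lie, h.c1 _ h1 _ hw.1, zero_lie, zero_add]
    exact flip_mem (step1 h ha hw _)
  · exact Submodule.subset_span (Or.inl (S_step h hw hx h2))

lemma T_lie {L1 L2 L3 : Submodule R L} (h : Gr L1 L2 L3) {a : L} (ha : a ∈ L1) (y n : L)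
    (hn : n ∈ Submodule.span R (T L1 L2 L3 a)) : ⁅y, n⁆ ∈ Submodule.span R (T L1 L2 L3 a) := by
  induction hn using Submodule.span_induction with
  | mem n hn =>
    rcases hn with hn | hn | ⟨w, x, hw, hx, rfl⟩ | ⟨w, x, hw, hx, rfl⟩
    · exact step1 h ha hn y
    · rw [← T_swap]; exact step1 h.swap ha hn y
    · exact step2 h ha hw hx y
    · rw [← T_swap]; exact step2 h.swap ha hw hx y
  | zero => simp
  | add n n' _ _ h1 h2 => rw [lie_add]; exact add_mem h1 h2
  | smul r n _ h1 => rw [lie_smul]; exact Submodule.smul_mem _ _ h1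

lemma N_le {L1 L2 L3 : Submodule R L} (h : Gr L1 L2 L3) {a : L} (ha : a ∈ L1) {n : L}
    (hn : n ∈ LieSubmodule.lieSpan R L {a}) : n ∈ Submodule.span R (T L1 L2 L3 a) := by
  let M : LieIdeal R L := { Submodule.span R (T L1 L2 L3 a) with
    lie_mem := fun {y n} hn => T_lie h ha y n hn }
  have : LieSubmodule.lieSpan R L {a} ≤ M := by
    rw [LieSubmodule.lieSpan_le, Set.singleton_subset_iff]
    exact Submodule.subset_span (Or.inl (S_self ha))
  exact this hn

/-- Elements centralising `N` modulo `I`. -/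
def cent (N I : LieIdeal R L) : LieIdeal R L where
  carrier := {c | ∀ n ∈ N, ⁅c, n⁆ ∈ I}
  zero_mem' := fun n _ => by simp
  add_mem' := fun {x y} hx hy n hn => by rw [add_lie]; exact add_mem (hx n hn) (hy n hn)
  smul_mem' := fun r x hx n hn => by
    rw [smul_lie]; exact I.toSubmodule.smul_mem r (hx n hn)
  lie_mem := fun {y c} hc n hn => by
    change ⁅⁅y, c⁆, n⁆ ∈ I
    rw [lie_lie]
    exact sub_mem (lie_mem_right R L I _ _ (hc n hn)) (hc _ (lie_mem_right R L N _ _ hn))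

lemma mem_cent {N I : LieIdeal R L} {c : L} : c ∈ cent N I ↔ ∀ n ∈ N, ⁅c, n⁆ ∈ I := Iff.rfl

lemma le_cent (N I : LieIdeal R L) : I ≤ cent N I := fun c hc n _ => lie_mem_left R L I c n hc

lemma keyK {L1 L2 L3 : Submodule R L} (h : Gr L1 L2 L3) {a : L} (ha : a ∈ L1)
    (I D : LieIdeal R L) (hID : I ≤ D) {c : L} (hc : c ∈ L2) (hca : ⁅c, a⁆ ∈ I)
    (hS : ∀ w, S L1 L3 L2 a w → ⁅c, w⁆ ∈ D) :
    c ∈ cent (LieSubmodule.lieSpan R L {a}) D := by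
  intro n hn
  replace hn := N_le h ha hn
  induction hn using Submodule.span_induction with
  | mem n hn =>
    rcases hn with hn | hn | ⟨w, x, hw, hx, rfl⟩ | ⟨w, x, hw, hx, rfl⟩
    · exact hID (hn.2.2 I c hc hca)
    · exact hS n hn
    · rw [leibniz_lie, h.c2 _ hc _ hx, lie_zero, add_zero]
      exact lie_mem_left R L D _ _ (hID (hw.2.2 I c hc hca))
    · rw [h.c2 _ hc _ (h.p13 _ hw.1 _ hx)]; exact zero_mem _
  | zero => simp
  | add n n' _ _ h1 h2 => rw [lie_add]; exact add_mem h1 h2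
  | smul r n _ h1 => rw [lie_smul]; exact D.toSubmodule.smul_mem _ h1

lemma key2 {L1 L2 L3 : Submodule R L} (h : Gr L1 L2 L3) {a : L} (ha : a ∈ L1)
    (I : LieIdeal R L) {c : L} (hc : c ∈ L2) (hca : ⁅c, a⁆ ∈ I)
    (hS : (∀ w, S L1 L3 L2 a w → ⁅c, w⁆ ∈ I) ∨ (∀ w, S L1 L2 L3 a w → ⁅c, w⁆ ∈ I)) :
    c ∈ cent (LieSubmodule.lieSpan R L {a}) (cent (LieSubmodule.lieSpan R L {a}) I) := by
  have sw : ∀ w ∈ L1, ∀ v ∈ L1, ⁅c, v⁆ ∈ I → ⁅⁅c, w⁆, v⁆ ∈ I := by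
    intro w hw v hv hcv
    rw [lie_lie, h.c1 w hw v hv, lie_zero, zero_sub]
    exact neg_mem (lie_mem_right R L I _ _ hcv)
  rcases hS with hS | hS
  · exact le_cent _ _ (keyK h ha I I le_rfl hc hca hS)
  · refine keyK h ha I _ (le_cent _ _) hc hca fun w hw => ?_
    refine keyK h.swap ha I I le_rfl (flip_mem (h.p12 _ hw.1 _ hc)) (sw _ hw.1 _ ha hca) ?_
    intro v hv
    exact sw _ hw.1 _ hv.1 (hS v hv)

lemma iter_zero (a : L) (j : ℕ) : (fun u => ⁅u, a⁆)^[j] (0 : L) = 0 := by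
  induction j with
  | zero => rfl
  | succ j ih => rw [Function.iterate_succ_apply', ih, zero_lie]

lemma iter_add (a x y : L) (j : ℕ) : (fun u => ⁅u, a⁆)^[j] (x + y) =
    (fun u => ⁅u, a⁆)^[j] x + (fun u => ⁅u, a⁆)^[j] y := by
  induction j with
  | zero => rfl
  | succ j ih => simp only [Function.iterate_succ_apply', ih, add_lie]

lemma iter_lie (a w y : L) (hw : ⁅w, a⁆ = 0) (j : ℕ) : ⁅(fun u => ⁅u, a⁆)^[j] y, w⁆ =
    (fun u => ⁅u, a⁆)^[j] ⁅y, w⁆ := by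
  induction j with
  | zero => rfl
  | succ j ih =>
    have e : ⁅a, w⁆ = 0 := by rw [← lie_skew, hw, neg_zero]
    simp only [Function.iterate_succ_apply', ← ih]
    rw [lie_lie _ a w, e, lie_zero, zero_sub, lie_skew]

lemma iter_mem {L1 L2 L3 : Submodule R L} (h : Gr L1 L2 L3) {a : L} (ha : a ∈ L1) {y : L}
    (hy : y ∈ L2) (j : ℕ) :
    (fun u => ⁅u, a⁆)^[j] y ∈ L2 ∨ (fun u => ⁅u, a⁆)^[j] y ∈ L3 := by
  induction j with
  | zero => exact Or.inl hy
  | succ j ih =>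
    rw [Function.iterate_succ_apply']
    rcases ih with ih | ih
    · exact Or.inr (flip_mem (h.p12 _ ha _ ih))
    · exact Or.inl (flip_mem (h.p13 _ ha _ ih))

def U (R : Type) [CommRing R] {L : Type} [LieRing L] [LieAlgebra R L] (a : L) (j : ℕ) :
    LieIdeal R L :=
  LieSubmodule.lieSpan R L (Set.range (fun u => ⁅u, a⁆)^[j])

lemma mem_U (a y : L) (j : ℕ) : (fun u => ⁅u, a⁆)^[j] y ∈ U R a j :=
  LieSubmodule.subset_lieSpan ⟨y, rfl⟩

lemma homog {L1 L2 L3 : Submodule R L} (h : Gr L1 L2 L3) {a : L} (ha : a ∈ L1) {y : L}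
    (hy : y ∈ L2) (j : ℕ) : (fun u => ⁅u, a⁆)^[j] y ∈
      cent (LieSubmodule.lieSpan R L {a}) (cent (LieSubmodule.lieSpan R L {a}) (U R a (j + 1))) := by
  have hca : ⁅(fun u => ⁅u, a⁆)^[j] y, a⁆ ∈ U R a (j + 1) := by
    have := mem_U (R := R) a y (j + 1)
    rwa [Function.iterate_succ_apply'] at this
  have hS : ∀ w, S L1 L3 L2 a w → ⁅(fun u => ⁅u, a⁆)^[j] y, w⁆ ∈ U R a (j + 1) := by
    intro w hw
    rw [iter_lie a w y (h.c1 _ hw.1 _ ha)]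
    obtain ⟨y', e⟩ := hw.2.1 y hy
    rw [e]
    exact mem_U a y' (j + 1)
  rcases iter_mem h ha hy j with hc | hc
  · exact key2 h ha _ hc hca (Or.inl hS)
  · exact key2 h.swap ha _ hc hca (Or.inr hS)

lemma U_le {L1 L2 L3 : Submodule R L} (h : Gr L1 L2 L3) {a : L} (ha : a ∈ L1) (j : ℕ) :
    U R a (j + 1) ≤ cent (LieSubmodule.lieSpan R L {a})
      (cent (LieSubmodule.lieSpan R L {a}) (U R a (j + 2))) := by
  rw [U, LieSubmodule.lieSpan_le]
  rintro _ ⟨y, rfl⟩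
  obtain ⟨x1, h1, x2, h2, x3, h3, e⟩ := h.dec y
  rw [e, iter_add, iter_add]
  refine add_mem (add_mem ?_ (homog h ha h2 _)) (homog h.swap ha h3 _)
  rw [Function.iterate_succ_apply]
  simp only [h.c1 _ h1 _ ha, iter_zero]
  exact zero_mem _

lemma N_cent (a : L) : LieSubmodule.lieSpan R L {a} ≤
    cent (LieSubmodule.lieSpan R L {a}) (U R a 1) := by
  have key : ∀ y, ⁅y, a⁆ ∈ U R a 1 := fun y => mem_U a y 1
  have h1 : LieSubmodule.lieSpan R L {a} ≤ cent ⊤ (U R a 1) := by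
    rw [LieSubmodule.lieSpan_le, Set.singleton_subset_iff]
    exact fun n _ => flip_memI (key n)
  exact fun c hc n _ => h1 hc n trivial

lemma lcs_step (N P : LieIdeal R L) (k : ℕ)
    (hk : ∀ x ∈ LieModule.lowerCentralSeries R N N k, (x : L) ∈ cent N P) :
    ∀ x ∈ LieModule.lowerCentralSeries R N N (k + 1), (x : L) ∈ P := by
  have : LieModule.lowerCentralSeries R N N (k + 1) ≤ LieIdeal.comap N.incl P := by
    rw [LieModule.lowerCentralSeries_succ, LieSubmodule.lie_le_iff]
    intro x _ y hy
    rw [LieIdeal.mem_comap]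
    exact flip_memI (hk y hy x x.2)
  intro x hx
  exact LieIdeal.mem_comap.1 (this hx)

lemma core {L1 L2 L3 : Submodule R L} (h : Gr L1 L2 L3) {a : L} (ha : a ∈ L1)
    (m : ℕ) (hm : 0 < m) (had : ∀ x : L, (fun u => ⁅u, a⁆)^[m] x = 0) :
    LieModule.lowerCentralSeries R (LieSubmodule.lieSpan R L {a})
      (LieSubmodule.lieSpan R L {a}) (2 * m - 1) = ⊥ := by
  have main : ∀ j, ∀ x ∈ LieModule.lowerCentralSeries R (LieSubmodule.lieSpan R L {a})
      (LieSubmodule.lieSpan R L {a}) (2 * j + 1), (x : L) ∈ U R a (j + 1) := by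
    intro j
    induction j with
    | zero => exact lcs_step _ _ 0 fun x _ => N_cent a x.2
    | succ j ih =>
      exact lcs_step _ _ (2 * j + 2) (lcs_step _ _ (2 * j + 1) fun x hx => U_le h ha j (ih x hx))
  obtain ⟨j, rfl⟩ : ∃ j, m = j + 1 := ⟨m - 1, by omega⟩
  have hU : U R a (j + 1) = ⊥ := by
    rw [U, LieSubmodule.lieSpan_eq_bot_iff]
    rintro _ ⟨y, rfl⟩
    exact had y
  rw [show 2 * (j + 1) - 1 = 2 * j + 1 by omega, LieSubmodule.eq_bot_iff]
  intro x hx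
  have := main j x hx
  rw [hU, LieSubmodule.mem_bot] at this
  exact Subtype.ext this

/-- Fixed points of an automorphism. -/
def fixed (g : L ≃ₗ⁅R⁆ L) : Submodule R L where
  carrier := {x | g x = x}
  zero_mem' := map_zero g
  add_mem' := fun {x y} hx hy => by
    simp only [Set.mem_ofPred_eq] at *; rw [map_add, hx, hy]
  smul_mem' := fun r x hx => by
    simp only [Set.mem_ofPred_eq] at *; rw [map_smul, hx]

lemma gr_of (h2 : IsUnit (2 : R)) (s t u : L ≃ₗ⁅R⁆ L)
    (hs : ∀ x, s (s x) = x) (ht : ∀ x, t (t x) = x) (hu : ∀ x, u (u x) = x)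
    (hst : ∀ x, s (t x) = u x) (hts : ∀ x, t (s x) = u x)
    (hsum : ∀ x, x + s x + t x + u x = 0) : Gr (fixed s) (fixed t) (fixed u) := by
  obtain ⟨v, hv⟩ := h2.exists_right_inv
  have half : ∀ x : L, v • (x + x) = x := fun x => by
    rw [← two_smul R x, smul_smul, mul_comm, hv, one_smul]
  have can : ∀ x : L, x + x = 0 → x = 0 := fun x hx => by rw [← half x, hx, smul_zero]
  have hsu : ∀ x, s (u x) = t x := fun x => by rw [← hst, hs]
  have htu : ∀ x, t (u x) = s x := fun x => by rw [← hts, ht]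
  have neg : ∀ x y z : L, x + y + z + z = 0 → y = x → z = -x := fun x y z h e => by
    subst e
    have := can (y + z) (by rw [← h]; abel)
    exact eq_neg_of_add_eq_zero_right this
  have ks1 : ∀ x, s x = x → t x = -x := fun x hx => by
    have e : u x = t x := by rw [← hts, hx]
    have := hsum x
    rw [e] at this
    exact neg _ _ _ this hx
  have ks2 : ∀ x, s x = x → u x = -x := fun x hx => by rw [← hts, hx, ks1 x hx]
  have kt1 : ∀ x, t x = x → s x = -x := fun x hx => by
    have e : u x = s x := by rw [← hst, hx]
    have := hsum x
    rw [e] at this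
    exact neg x (t x) (s x) (by rw [← this]; abel) hx
  have kt2 : ∀ x, t x = x → u x = -x := fun x hx => by rw [← hst, hx, kt1 x hx]
  have ku1 : ∀ x, u x = x → s x = -x := fun x hx => by
    have e : t x = s x := by rw [← hsu, hx]
    have := hsum x
    rw [e] at this
    exact neg x (u x) (s x) (by rw [← this]; abel) hx
  have ku2 : ∀ x, u x = x → t x = -x := fun x hx => by
    rw [← hsu, hx, ku1 x hx]
  have z4 : ∀ x, s x = x → t x = x → x = 0 := fun x h1 h2 =>
    can x (by nth_rewrite 1 [← h2]; rw [ks1 x h1]; abel)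
  have z4' : ∀ x, s x = x → u x = x → x = 0 := fun x h1 h2 =>
    can x (by nth_rewrite 1 [← h2]; rw [ks2 x h1]; abel)
  refine ⟨?_, ?_, ?_, ?_, ?_, ?_, ?_⟩
  · intro x (hx : s x = x) y (hy : s y = y)
    apply z4
    · rw [LieEquiv.map_lie, hx, hy]
    · rw [LieEquiv.map_lie, ks1 x hx, ks1 y hy, neg_lie, lie_neg, neg_neg]
  · intro x (hx : t x = x) y (hy : t y = y)
    apply z4
    · rw [LieEquiv.map_lie, kt1 x hx, kt1 y hy, neg_lie, lie_neg, neg_neg]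
    · rw [LieEquiv.map_lie, hx, hy]
  · intro x (hx : u x = x) y (hy : u y = y)
    apply z4'
    · rw [LieEquiv.map_lie, ku1 x hx, ku1 y hy, neg_lie, lie_neg, neg_neg]
    · rw [LieEquiv.map_lie, hx, hy]
  · intro x (hx : s x = x) y (hy : t y = y)
    change u _ = _
    rw [LieEquiv.map_lie, ks2 x hx, kt2 y hy, neg_lie, lie_neg, neg_neg]
  · intro x (hx : s x = x) y (hy : u y = y)
    change t _ = _
    rw [LieEquiv.map_lie, ks1 x hx, ku2 y hy, neg_lie, lie_neg, neg_neg]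
  · intro x (hx : t x = x) y (hy : u y = y)
    change s _ = _
    rw [LieEquiv.map_lie, kt1 x hx, ku1 y hy, neg_lie, lie_neg, neg_neg]
  · intro x
    refine ⟨v • (x + s x), ?_, v • (x + t x), ?_, v • (x + u x), ?_, ?_⟩
    · change s _ = _
      rw [map_smul, map_add, hs, add_comm]
    · change t _ = _
      rw [map_smul, map_add, ht, add_comm]
    · change u _ = _
      rw [map_smul, map_add, hu, add_comm]
    · rw [← smul_add, ← smul_add]
      have : x + s x + (x + t x) + (x + u x) = x + x := by
        have h0 := hsum x
        calc _ = x + x + (x + s x + t x + u x) := by abel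
          _ = x + x := by rw [h0, add_zero]
      rw [this, half]

end KleinFourLie

open KleinFourLie

/-- **Lemma 2.2.**  Let the Klein four-group `V = {1, v₁, v₂, v₃}` (here encoded
by the automorphisms `g 0 = v₁`, `g 1 = v₂`, `g 2 = v₃ = v₁v₂`) act by
automorphisms on a Lie algebra `L` over a commutative ring in which `2` is
invertible, with `C_L(V) = 0`.  If `a ∈ L₁ ∪ L₂ ∪ L₃` is ad-nilpotent of index at
most `m`, then the Lie ideal of `L` generated by `a` is nilpotent of class at
most `2m − 1`. -/
theorem lie_ideal_nilpotent_of_adNilpotent_of_kleinFour_action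
    (R : Type) [CommRing R] (L : Type) [LieRing L] [LieAlgebra R L]
    (h2 : IsUnit (2 : R))
    (g : Fin 3 → (L ≃ₗ⁅R⁆ L))
    (hinv : ∀ i x, g i (g i x) = x)
    (hcomm : ∀ x, g 0 (g 1 x) = g 1 (g 0 x))
    (hg2 : ∀ x, g 2 x = g 0 (g 1 x))
    (hfpf : ∀ x : L, g 0 x = x → g 1 x = x → x = 0)
    (a : L) (ha : ∃ i : Fin 3, g i a = a)
    (m : ℕ) (hm : 0 < m)
    (had : ∀ x : L, (fun u => ⁅u, a⁆)^[m] x = 0) :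
    LieModule.lowerCentralSeries R (LieSubmodule.lieSpan R L {a})
      (LieSubmodule.lieSpan R L {a}) (2 * m - 1) = ⊥ := by
  have h01 : ∀ x, g 0 (g 1 x) = g 2 x := fun x => (hg2 x).symm
  have h10 : ∀ x, g 1 (g 0 x) = g 2 x := fun x => by rw [← hcomm, hg2]
  have h02 : ∀ x, g 0 (g 2 x) = g 1 x := fun x => by rw [hg2, hinv]
  have h12 : ∀ x, g 1 (g 2 x) = g 0 x := fun x => by rw [← h10, hinv]
  have h20 : ∀ x, g 2 (g 0 x) = g 1 x := fun x => by rw [hg2, h10, h02]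
  have h21 : ∀ x, g 2 (g 1 x) = g 0 x := fun x => by rw [hg2, hinv]
  have hsum : ∀ x, x + g 0 x + g 1 x + g 2 x = 0 := by
    intro x
    apply hfpf
    · simp only [map_add, hinv, h01, h02]; abel
    · simp only [map_add, hinv, h10, h12]; abel
  obtain ⟨i, hi⟩ := ha
  fin_cases i
  · exact core (gr_of h2 (g 0) (g 1) (g 2) (hinv 0) (hinv 1) (hinv 2) h01 h10 hsum) hi m hm had
  · exact core (gr_of h2 (g 1) (g 0) (g 2) (hinv 1) (hinv 0) (hinv 2) h10 h01
      (fun x => by rw [← hsum x]; abel)) hi m hm had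
  · exact core (gr_of h2 (g 2) (g 0) (g 1) (hinv 2) (hinv 0) (hinv 1) h20 h02
      (fun x => by rw [← hsum x]; abel)) hi m hm had
end

section
/- Let V act on the Lie algebra L as in the context with C_L(V) = 0. Then L decomposes as the internal direct sum of modules L = L₁ ⊕ L₂ ⊕ L₃; each L_i is an abelian Lie subalgebra of L; the inclusions [L₁, L₂] ⊆ L₃, [L₂, L₃] ⊆ L₁ and [L₃, L₁] ⊆ L₂ hold; and for i ≠ j the automorphism v_j sends every element x ∈ L_i to −x. -/
/-- **Decomposition under a fixed-point-free Klein four-group of automorphisms.**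
Let the Klein four-group `V = {1, v₁, v₂, v₃}` (here encoded by the automorphisms
`g 0 = v₁`, `g 1 = v₂`, `g 2 = v₃ = v₁v₂`) act by automorphisms on a Lie algebra
`L` over a commutative ring in which `2` is invertible, with `C_L(V) = 0`, and set
`Lᵢ = C_L(vᵢ)`.  Then `L = L₁ ⊕ L₂ ⊕ L₃` (every element is uniquely a sum
`x₁ + x₂ + x₃` with `xᵢ ∈ Lᵢ`); each `Lᵢ` is an abelian subalgebra;
`⁅L₁, L₂⁆ ⊆ L₃`, `⁅L₂, L₃⁆ ⊆ L₁`, `⁅L₃, L₁⁆ ⊆ L₂`; and for `i ≠ j` the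
automorphism `vⱼ` sends every `x ∈ Lᵢ` to `−x`. -/
theorem lie_decomposition_of_kleinFour_action
    (R : Type) [CommRing R] (L : Type) [LieRing L] [LieAlgebra R L]
    (h2 : IsUnit (2 : R))
    (g : Fin 3 → (L ≃ₗ⁅R⁆ L))
    (hinv : ∀ i x, g i (g i x) = x)
    (hcomm : ∀ x, g 0 (g 1 x) = g 1 (g 0 x))
    (hg2 : ∀ x, g 2 x = g 0 (g 1 x))
    (hfpf : ∀ x : L, g 0 x = x → g 1 x = x → x = 0) :
    (∀ x : L, ∃! p : L × L × L,
        g 0 p.1 = p.1 ∧ g 1 p.2.1 = p.2.1 ∧ g 2 p.2.2 = p.2.2 ∧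
        x = p.1 + p.2.1 + p.2.2) ∧
    (∀ i : Fin 3, ∀ x y : L, g i x = x → g i y = y → ⁅x, y⁆ = 0) ∧
    (∀ x y : L, g 0 x = x → g 1 y = y → g 2 ⁅x, y⁆ = ⁅x, y⁆) ∧
    (∀ x y : L, g 1 x = x → g 2 y = y → g 0 ⁅x, y⁆ = ⁅x, y⁆) ∧
    (∀ x y : L, g 2 x = x → g 0 y = y → g 1 ⁅x, y⁆ = ⁅x, y⁆) ∧
    (∀ i j : Fin 3, i ≠ j → ∀ x : L, g i x = x → g j x = -x) := by
  have hneg : ∀ i j : Fin 3, i ≠ j → ∀ x : L, g i x = x → g j x = -x := by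
    have e01 : ∀ x, g 0 x = x → g 1 x = -x := by
      intro x hx
      have h := hfpf (x + g 1 x) (by rw [map_add, hcomm, hx])
        (by rw [map_add, hinv, add_comm])
      exact (neg_eq_of_add_eq_zero_right h).symm
    have e10 : ∀ x, g 1 x = x → g 0 x = -x := by
      intro x hx
      have h := hfpf (x + g 0 x) (by rw [map_add, hinv, add_comm])
        (by rw [map_add, ← hcomm, hx])
      exact (neg_eq_of_add_eq_zero_right h).symm
    have e02 : ∀ x, g 0 x = x → g 2 x = -x := by
      intro x hx
      rw [hg2, e01 x hx, map_neg, hx]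
    have e12 : ∀ x, g 1 x = x → g 2 x = -x := by
      intro x hx
      rw [hg2, hx, e10 x hx]
    have e2 : ∀ x, g 2 x = x → g 0 x = g 1 x := by
      intro x hx
      have h := hg2 x
      rw [hx] at h
      have h' := congrArg (g 0) h
      rwa [hinv] at h'
    have e20 : ∀ x, g 2 x = x → g 0 x = -x := by
      intro x hx
      have h := hfpf (x + g 0 x) (by rw [map_add, hinv, add_comm])
        (by rw [map_add, ← hcomm, ← e2 x hx, hinv, add_comm])
      exact (neg_eq_of_add_eq_zero_right h).symm
    have e21 : ∀ x, g 2 x = x → g 1 x = -x := by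
      intro x hx
      rw [← e2 x hx, e20 x hx]
    intro i j hij
    fin_cases i <;> fin_cases j <;> first | exact absurd rfl hij | assumption
  have n01 := hneg 0 1 (by decide)
  have n02 := hneg 0 2 (by decide)
  have n10 := hneg 1 0 (by decide)
  have n12 := hneg 1 2 (by decide)
  have n20 := hneg 2 0 (by decide)
  have n21 := hneg 2 1 (by decide)
  obtain ⟨c, hc⟩ := h2.exists_left_inv
  have half : ∀ x : L, c • (x + x) = x := by
    intro x
    rw [← two_smul R x, smul_smul, hc, one_smul]
  refine ⟨?_, ?_, ?_, ?_, ?_, hneg⟩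
  · intro x
    have N : x + g 0 x + g 1 x + g 0 (g 1 x) = 0 := by
      apply hfpf
      · simp only [map_add, hinv]
        abel
      · simp only [map_add, hinv, hcomm]
        abel
    refine ⟨(c • (x + g 0 x), c • (x + g 1 x), c • (x + g 2 x)), ⟨?_, ?_, ?_, ?_⟩, ?_⟩
    · simp only [map_smul, map_add, hinv, add_comm]
    · simp only [map_smul, map_add, hinv, add_comm]
    · simp only [map_smul, map_add, hinv, add_comm]
    · simp only [← smul_add]
      have : x + g 0 x + (x + g 1 x) + (x + g 2 x) = x + x := by
        rw [hg2]
        calc _ = (x + x) + (x + g 0 x + g 1 x + g 0 (g 1 x)) := by abel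
          _ = _ := by rw [N, add_zero]
      rw [this, half]
    · rintro ⟨p, q, r⟩ ⟨hp, hq, hr, hx⟩
      simp only at hp hq hr hx
      refine Prod.ext ?_ (Prod.ext ?_ ?_)
      · have : x + g 0 x = p + p := by
          rw [hx, map_add, map_add, hp, n10 q hq, n20 r hr]; abel
        simp only [this, half]
      · have : x + g 1 x = q + q := by
          rw [hx, map_add, map_add, hq, n01 p hp, n21 r hr]; abel
        simp only [this, half]
      · have : x + g 2 x = r + r := by
          rw [hx, map_add, map_add, hr, n02 p hp, n12 q hq]; abel
        simp only [this, half]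
  · intro i x y hx hy
    obtain ⟨j, hij⟩ : ∃ j : Fin 3, i ≠ j := by
      fin_cases i
      · exact ⟨1, by decide⟩
      · exact ⟨0, by decide⟩
      · exact ⟨0, by decide⟩
    have h1 : g i ⁅x, y⁆ = ⁅x, y⁆ := by rw [LieEquiv.map_lie, hx, hy]
    have h3 := hneg i j hij _ h1
    rw [LieEquiv.map_lie, hneg i j hij x hx, hneg i j hij y hy, neg_lie, lie_neg, neg_neg] at h3
    have h4 : ⁅x, y⁆ + ⁅x, y⁆ = 0 := by
      nth_rewrite 1 [h3]
      exact neg_add_cancel _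
    rw [← half ⁅x, y⁆, h4, smul_zero]
  · intro x y hx hy
    rw [LieEquiv.map_lie, n02 x hx, n12 y hy, neg_lie, lie_neg, neg_neg]
  · intro x y hx hy
    rw [LieEquiv.map_lie, n10 x hx, n20 y hy, neg_lie, lie_neg, neg_neg]
  · intro x y hx hy
    rw [LieEquiv.map_lie, n21 x hx, n01 y hy, neg_lie, lie_neg, neg_neg]
end

section
/- Let V act on the finite group G as in the context with C_G(V) = 1. Then each G_i is abelian; for i ≠ j (i, j ∈ {1,2,3}) the automorphism v_j acts on G_i by the rule x^{v_j} = x⁻¹ for each x ∈ G_i; and every subgroup of G generated by a subset of G₁ ∪ G₂ ∪ G₃ is V-invariant. -/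
/-- If `b` is an involutory automorphism commuting with `a`, and only `1` is fixed by both,
then `b` inverts the fixed points of `a`. -/
theorem inverts_aux {G : Type} [Group G] [Finite G] (a b : MulAut G)
    (hab : ∀ x, a (b x) = b (a x)) (hb : ∀ x, b (b x) = x)
    (hf : ∀ x, a x = x → b x = x → x = 1) (x : G) (hx : a x = x) : b x = x⁻¹ := by
  let H : Subgroup G :=
    { carrier := {x | a x = x}
      mul_mem' := by
        intro x y hx hy
        simp only [Set.mem_ofPred_eq] at *
        rw [map_mul, hx, hy]
      one_mem' := by simp
      inv_mem' := by
        intro x hx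
        simp only [Set.mem_ofPred_eq] at *
        rw [map_inv, hx] }
  have hH : ∀ y : H, b y ∈ H := by
    intro y
    have h2 : a y = y := y.2
    change a (b y) = b y
    rw [hab, h2]
  let f : H →* H := (b.toMonoidHom.comp H.subtype).codRestrict H hH
  have hfp : MonoidHom.FixedPointFree f := by
    intro g hg
    exact Subtype.ext (hf g g.2 (congrArg Subtype.val hg))
  have h2 : Function.Involutive f := fun g => Subtype.ext (hb g)
  exact congrArg Subtype.val (congrFun (hfp.coe_eq_inv_of_involutive h2) ⟨x, hx⟩)

/-- **Lemma 4.1.**  Let the Klein four-group `V = {1, v₁, v₂, v₃}` (here `w 0 = v₁`,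
`w 1 = v₂`, `w 2 = v₃ = v₁v₂`) act by automorphisms on a finite group `G` with
`C_G(V) = 1`, and set `Gᵢ = C_G(vᵢ)`.  Then each `Gᵢ` is abelian; for `i ≠ j` the
automorphism `vⱼ` inverts every element of `Gᵢ`; and every subgroup generated by a
subset of `G₁ ∪ G₂ ∪ G₃` is `V`-invariant. -/
theorem centralizers_abelian_inverted_of_kleinFour_action
    (V : Type) [Group V] (w : Fin 3 → V)
    (hV4 : Nat.card V = 4)
    (hinv : ∀ i, w i * w i = 1) (hne1 : ∀ i, w i ≠ 1)
    (hw01 : w 0 * w 1 = w 1 * w 0) (hw2 : w 2 = w 0 * w 1)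
    (G : Type) [Group G] [Finite G] (φ : V →* MulAut G)
    (hfpf : ∀ x : G, (∀ v : V, φ v x = x) → x = 1) :
    (∀ i : Fin 3, ∀ x y : G, φ (w i) x = x → φ (w i) y = y → x * y = y * x) ∧
    (∀ i j : Fin 3, i ≠ j → ∀ x : G, φ (w i) x = x → φ (w j) x = x⁻¹) ∧
    (∀ T : Set G,
      T ⊆ {x | φ (w 0) x = x} ∪ {x | φ (w 1) x = x} ∪ {x | φ (w 2) x = x} →
      ∀ v : V, ∀ x ∈ Subgroup.closure T, φ v x ∈ Subgroup.closure T) := by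
  have hcomm : ∀ i j, w i * w j = w j * w i := by
    have h02 : w 0 * w 2 = w 2 * w 0 := by rw [hw2, mul_assoc, ← hw01]
    have h12 : w 1 * w 2 = w 2 * w 1 := by rw [hw2, ← mul_assoc, ← hw01]
    intro i j
    fin_cases i <;> fin_cases j <;> first | rfl | assumption | (symm; assumption)
  have hinj : ∀ i j, w i = w j → i = j := by
    have h01 : w 0 ≠ w 1 := fun h => hne1 2 (by rw [hw2, h, hinv])
    have h02 : w 0 ≠ w 2 := fun h => hne1 1 (by rw [hw2] at h; exact left_eq_mul.mp h)
    have h12 : w 1 ≠ w 2 := fun h => hne1 0 (by rw [hw2] at h; exact right_eq_mul.mp h)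
    intro i j h
    fin_cases i <;> fin_cases j <;>
      first | rfl | exact absurd h (by assumption) | exact absurd h.symm (by assumption)
  have hall : ∀ v : V, v = 1 ∨ ∃ i, v = w i := by
    have : Finite V := Nat.finite_of_card_ne_zero (by omega)
    let f : Option (Fin 3) → V := fun o => o.elim 1 w
    have hfi : Function.Injective f := by
      rintro (_ | i) (_ | j) h
      · rfl
      · exact absurd h.symm (hne1 j)
      · exact absurd h (hne1 i)
      · rw [hinj i j h]
    have hbij := (Nat.bijective_iff_injective_and_card f).mpr ⟨hfi, by simp [hV4]⟩
    intro v
    obtain ⟨o, rfl⟩ := hbij.2 v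
    rcases o with _ | i
    · exact Or.inl rfl
    · exact Or.inr ⟨i, rfl⟩
  have hmul : ∀ u v x, φ (u * v) x = φ u (φ v x) := fun u v x => by rw [map_mul]; rfl
  have h2 : ∀ i j : Fin 3, i ≠ j → ∀ x : G, φ (w i) x = x → φ (w j) x = x⁻¹ := by
    intro i j hij x hx
    refine inverts_aux (φ (w i)) (φ (w j)) ?_ ?_ ?_ x hx
    · intro x
      rw [← hmul, hcomm, hmul]
    · intro x
      rw [← hmul, hinv, map_one]; rfl
    · intro y hi hj
      have h01 : φ (w 0 * w 1) y = φ (w 2) y := by rw [hw2]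
      have h10 : φ (w 1 * w 2) y = φ (w 0) y := by
        rw [hw2, hw01, ← mul_assoc, hinv, one_mul]
      have h02 : φ (w 0 * w 2) y = φ (w 1) y := by
        rw [hw2, ← mul_assoc, hinv, one_mul]
      rw [hmul] at h01 h10 h02
      have hk : ∀ k, φ (w k) y = y := by
        have key : φ (w 0) y = y ∧ φ (w 1) y = y ∧ φ (w 2) y = y := by
          have a : φ (w 0) y = y → φ (w 1) y = y → φ (w 2) y = y :=
            fun p q => by rw [← h01, q, p]
          have b : φ (w 1) y = y → φ (w 2) y = y → φ (w 0) y = y :=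
            fun p q => by rw [← h10, q, p]
          have c : φ (w 0) y = y → φ (w 2) y = y → φ (w 1) y = y :=
            fun p q => by rw [← h02, q, p]
          fin_cases i <;> fin_cases j <;> first
            | exact absurd rfl hij
            | exact ⟨hi, hj, a hi hj⟩
            | exact ⟨hj, hi, a hj hi⟩
            | exact ⟨b hi hj, hi, hj⟩
            | exact ⟨b hj hi, hj, hi⟩
            | exact ⟨hi, c hi hj, hj⟩
            | exact ⟨hj, c hj hi, hi⟩
        intro k
        fin_cases k
        exacts [key.1, key.2.1, key.2.2]
      apply hfpf
      intro v
      rcases hall v with rfl | ⟨k, rfl⟩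
      · rw [map_one]; rfl
      · exact hk k
  refine ⟨?_, h2, ?_⟩
  · intro i x y hx hy
    obtain ⟨j, hj⟩ : ∃ j, i ≠ j := ⟨i + 1, by fin_cases i <;> decide⟩
    have h := h2 i j hj (x * y) (by rw [map_mul, hx, hy])
    rw [map_mul, h2 i j hj x hx, h2 i j hj y hy, ← mul_inv_rev] at h
    exact (inv_injective h).symm
  · intro T hT v x hx
    have hle : Subgroup.closure T ≤ (Subgroup.closure T).comap (φ v).toMonoidHom := by
      rw [Subgroup.closure_le]
      intro t ht
      change φ v t ∈ Subgroup.closure T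
      have htm := Subgroup.subset_closure ht
      rcases hall v with rfl | ⟨k, rfl⟩
      · rw [map_one]; exact htm
      · obtain ⟨i, hi⟩ : ∃ i, φ (w i) t = t := by
          rcases hT ht with (h | h) | h
          exacts [⟨_, h⟩, ⟨_, h⟩, ⟨_, h⟩]
        by_cases hik : i = k
        · subst hik; rw [hi]; exact htm
        · rw [h2 i k hik t hi]; exact inv_mem htm
    exact hle hx
end

section
/- Let V act on the finite group G as in the context with C_G(V) = 1, and let {i, j, k} = {1, 2, 3}. Let x be an element of G such that x^{v_i} = x⁻¹, and suppose x ∈ S, where S is a V-invariant subgroup of G. Then there exists a unique pair of elements y ∈ G_j ∩ S and t ∈ G_k ∩ S such that x = y·t·y. -/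
theorem aux_root {G : Type} [Group G] {m : ℕ} (hm : ∀ g : G, g ^ (2 * m + 1) = 1) (g : G) :
    g ^ (m + 1) * g ^ (m + 1) = g := by
  rw [← pow_add, show m + 1 + (m + 1) = (2 * m + 1) + 1 by ring, pow_succ, hm, one_mul]

theorem aux_inj {G : Type} [Group G] {m : ℕ} (hm : ∀ g : G, g ^ (2 * m + 1) = 1) (g h : G)
    (e : g * g = h * h) : g = h := by
  rw [← aux_root hm g, ← aux_root hm h, ← pow_add, ← pow_add, ← two_mul, pow_mul, pow_mul,
    pow_two, pow_two, e]

theorem aux_invert {G : Type} [Group G] {m : ℕ} (hm : ∀ g : G, g ^ (2 * m + 1) = 1)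
    (a b : MulAut G) (ha : ∀ g, a (a g) = g) (hab : ∀ g, a (b g) = b (a g))
    (hf : ∀ g, a g = g → b g = g → g = 1) (y : G) (hy : b y = y) : a y = y⁻¹ := by
  set s := (y⁻¹ * a y) ^ (m + 1) with hs
  have h2 : s * s = y⁻¹ * a y := aux_root hm _
  have hsa : a s = s⁻¹ := by
    rw [hs, map_pow, ← inv_pow]
    congr 1
    simp [ha]
  have hsb : b s = s := by
    rw [hs, map_pow]
    congr 1
    simp [← hab, hy]
  have hq : y * s = 1 := by
    apply hf
    · rw [map_mul, hsa]
      have : a y = y * (s * s) := by rw [h2]; group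
      rw [this]; group
    · rw [map_mul, hy, hsb]
  have hs' : s = y⁻¹ := (inv_eq_of_mul_eq_one_right hq).symm
  have : a y = y * (s * s) := by rw [h2]; group
  rw [this, hs']; group

theorem aux_core {G : Type} [Group G] {m : ℕ} (hm : ∀ g : G, g ^ (2 * m + 1) = 1)
    (a b c : MulAut G) (ha : ∀ g, a (a g) = g) (hb : ∀ g, b (b g) = g)
    (hab : ∀ g, a (b g) = b (a g)) (hc : ∀ g, c g = a (b g))
    (hf : ∀ g, a g = g → b g = g → g = 1)
    (S : Subgroup G) (hS : ∀ s ∈ S, b s ∈ S)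
    (x : G) (hxS : x ∈ S) (hx : a x = x⁻¹) :
    ∃! p : G × G,
      (p.1 ∈ S ∧ b p.1 = p.1) ∧ (p.2 ∈ S ∧ c p.2 = p.2) ∧
      x = p.1 * p.2 * p.1 := by
  set u := (b x * x⁻¹) ^ (m + 1) with hu
  have hu2 : u * u = b x * x⁻¹ := aux_root hm _
  have huS : u ∈ S := S.pow_mem (S.mul_mem (hS _ hxS) (S.inv_mem hxS)) _
  set z := u * x with hz
  have hzS : z ∈ S := S.mul_mem huS hxS
  have key : ∀ z' : G, z' * x⁻¹ * z' = b x → z' = z := by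
    intro z' h
    have : z' * x⁻¹ = u := by
      apply aux_inj hm
      rw [hu2, ← h]; group
    rw [hz, ← this]; group
  have hzz : z * x⁻¹ * z = b x := by
    rw [hz]
    have : u * x * x⁻¹ * (u * x) = u * u * x := by group
    rw [this, hu2]; group
  have hzb : b z = z := by
    apply key
    have h1 : b z * (b x)⁻¹ * b z = x := by
      rw [← map_inv, ← map_mul, ← map_mul, hzz, hb]
    have h2 : x⁻¹ = (b z)⁻¹ * b x * (b z)⁻¹ := by
      have h3 := congrArg (fun g => g⁻¹) h1
      rw [← h3]; simp [mul_assoc]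
    rw [h2]; group
  set y := z ^ (m + 1) with hy
  have hyy : y * y = z := aux_root hm _
  have hyS : y ∈ S := S.pow_mem hzS _
  have hyb : b y = y := by rw [hy, map_pow, hzb]
  have hya : a y = y⁻¹ := aux_invert hm a b ha hab hf y hyb
  refine ⟨(y, y⁻¹ * x * y⁻¹), ⟨⟨hyS, hyb⟩,
    ⟨S.mul_mem (S.mul_mem (S.inv_mem hyS) hxS) (S.inv_mem hyS), ?_⟩, by simp [mul_assoc]⟩, ?_⟩
  · have hbt : b (y⁻¹ * x * y⁻¹) = y * x⁻¹ * y := by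
      rw [map_mul, map_mul, map_inv, hyb, ← hzz, ← hyy]; group
    change c (y⁻¹ * x * y⁻¹) = y⁻¹ * x * y⁻¹
    rw [hc, hbt, map_mul, map_mul, map_inv, hya, hx, inv_inv]
  · rintro ⟨y', t⟩ ⟨⟨-, hyb'⟩, ⟨-, htc⟩, hxe⟩
    dsimp only at hyb' htc hxe
    have htb : b t = t⁻¹ := by
      apply aux_invert hm b c hb (fun g => by rw [hc, hc, hab, hab, hab]) _ t htc
      intro g h1 h2
      rw [hc, h1] at h2
      exact hf g h2 h1
    have h1 : y' * y' = z := by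
      apply key
      rw [hxe]
      simp only [map_mul, hyb', htb]
      group
    have h2 : y' = y := aux_inj hm _ _ (h1.trans hyy.symm)
    have h3 : t = y⁻¹ * x * y⁻¹ := by rw [← h2, hxe]; group
    rw [h2, h3]


/-- **Lemma 4.2.**  Let the Klein four-group `V = {1, v₁, v₂, v₃}` (here `w 0 = v₁`,
`w 1 = v₂`, `w 2 = v₃ = v₁v₂`) act by automorphisms on a finite group `G` with
`C_G(V) = 1`, and set `Gᵢ = C_G(vᵢ)`.  Let `{i, j, k} = {1, 2, 3}` and let `x ∈ S`
with `x^{vᵢ} = x⁻¹`, where `S` is a `V`-invariant subgroup of `G`.  Then there is a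
unique pair `(y, t)` with `y ∈ Gⱼ ∩ S`, `t ∈ G_k ∩ S` and `x = y·t·y`. -/
theorem unique_decomposition_of_inverted_element_of_kleinFour_action
    (V : Type) [Group V] (w : Fin 3 → V)
    (hV4 : Nat.card V = 4)
    (hinv : ∀ i, w i * w i = 1) (hne1 : ∀ i, w i ≠ 1)
    (hw01 : w 0 * w 1 = w 1 * w 0) (hw2 : w 2 = w 0 * w 1)
    (G : Type) [Group G] [Finite G] (φ : V →* MulAut G)
    (hfpf : ∀ x : G, (∀ v : V, φ v x = x) → x = 1)
    (i j k : Fin 3) (hij : i ≠ j) (hjk : j ≠ k) (hik : i ≠ k)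
    (S : Subgroup G) (hS : ∀ v : V, ∀ s ∈ S, φ v s ∈ S)
    (x : G) (hxS : x ∈ S) (hx : φ (w i) x = x⁻¹) :
    ∃! p : G × G,
      (p.1 ∈ S ∧ φ (w j) p.1 = p.1) ∧ (p.2 ∈ S ∧ φ (w k) p.2 = p.2) ∧
      x = p.1 * p.2 * p.1 := by
  have : Finite V := Nat.finite_of_card_ne_zero (by omega)
  have h01 : w 0 ≠ w 1 := fun h => hne1 2 (by rw [hw2, ← h, hinv])
  have h02 : w 0 ≠ w 2 := fun h => hne1 1 (by simpa [hw2] using h)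
  have h12 : w 1 ≠ w 2 := fun h => hne1 0 (by simpa [hw2] using h)
  have hall : ∀ v : V, v = 1 ∨ v = w 0 ∨ v = w 1 ∨ v = w 2 := by
    classical
    have := Fintype.ofFinite V
    have hc : ({1, w 0, w 1, w 2} : Finset V).card = Fintype.card V := by
      rw [← Nat.card_eq_fintype_card, hV4]
      simp [h01, h02, h12, (hne1 _).symm]
    have hu := Finset.eq_univ_of_card _ hc
    intro v
    have hv := Finset.mem_univ v
    rw [← hu] at hv
    simpa using hv
  have hcomm : ∀ p q : V, p * q = q * p := by
    have hsq : ∀ v : V, v * v = 1 := by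
      intro v
      rcases hall v with h | h | h | h <;> rw [h]
      · simp
      all_goals exact hinv _
    intro p q
    have h1 := hsq (p * q)
    rw [← inv_eq_iff_mul_eq_one, mul_inv_rev, inv_eq_of_mul_eq_one_right (hsq p),
      inv_eq_of_mul_eq_one_right (hsq q)] at h1
    exact h1.symm
  have hprod : ∀ i j k : Fin 3, i ≠ j → j ≠ k → i ≠ k → w k = w i * w j := by
    have e1 : w 0 * (w 0 * w 1) = w 1 := by rw [← mul_assoc, hinv, one_mul]
    have e2 : w 1 * (w 0 * w 1) = w 0 := by rw [hw01, ← mul_assoc, hinv, one_mul]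
    have e3 : w 0 * w 1 * w 0 = w 1 := by rw [hw01, mul_assoc, hinv, mul_one]
    have e4 : w 0 * w 1 * w 1 = w 0 := by rw [mul_assoc, hinv, mul_one]
    intro i j k
    fin_cases i <;> fin_cases j <;> fin_cases k <;> simp <;>
      first
      | exact hw2
      | (rw [hw2]; first | exact hw01 | exact e1.symm | exact e2.symm | exact e3.symm | exact e4.symm)
  have hk := hprod i j k hij hjk hik
  have hcov : ∀ v : V, v = 1 ∨ v = w i ∨ v = w j ∨ v = w k := by
    intro v
    have h3 : ∀ l : Fin 3, l = i ∨ l = j ∨ l = k := by omega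
    rcases hall v with h | h | h | h
    · exact Or.inl h
    · rcases h3 0 with e | e | e <;> rw [e] at h <;> simp [h]
    · rcases h3 1 with e | e | e <;> rw [e] at h <;> simp [h]
    · rcases h3 2 with e | e | e <;> rw [e] at h <;> simp [h]
  have hodd : Odd (Nat.card G) := by
    letI : MulAction V G := MulAction.compHom G φ
    have hp : IsPGroup 2 V := IsPGroup.of_card (n := 2) (by rw [hV4]; norm_num)
    haveI : Fact (Nat.Prime 2) := ⟨Nat.prime_two⟩
    have hmod := hp.card_modEq_card_fixedPoints G
    have hfix : MulAction.fixedPoints V G = {1} := by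
      ext g
      simp only [MulAction.mem_fixedPoints, Set.mem_singleton_iff]
      constructor
      · intro h
        exact hfpf g h
      · rintro rfl v
        exact map_one (φ v)
    rw [hfix] at hmod
    rw [Nat.odd_iff]
    simpa [Nat.ModEq] using hmod
  obtain ⟨m, hm⟩ := hodd
  refine aux_core (m := m) (fun g => by rw [← hm]; exact pow_card_eq_one')
    (φ (w i)) (φ (w j)) (φ (w k)) ?_ ?_ ?_ ?_ ?_ S (hS _) x hxS hx
  · intro g
    rw [← MulAut.mul_apply, ← map_mul, hinv, map_one, MulAut.one_apply]
  · intro g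
    rw [← MulAut.mul_apply, ← map_mul, hinv, map_one, MulAut.one_apply]
  · intro g
    rw [← MulAut.mul_apply, ← MulAut.mul_apply, ← map_mul, ← map_mul, hcomm]
  · intro g
    rw [← MulAut.mul_apply, ← map_mul, hk]
  · intro g h1 h2
    apply hfpf
    intro v
    rcases hcov v with h | h | h | h <;> rw [h]
    · simp
    · exact h1
    · exact h2
    · rw [hk, map_mul, MulAut.mul_apply, h2, h1]
end

section
/- Let V act on the finite group G as in the context with C_G(V) = 1. Then G = G₁G₂G₃, that is, every element of G can be written as a product g₁g₂g₃ with g_i ∈ G_i for i = 1, 2, 3. -/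
section KleinFourAux

variable {G : Type} [Group G]

/-- an automorphism `p` commuting with `q`, with no common nontrivial fixed points,
inverts the fixed points of `q`. -/
theorem kf_inverts (s : G → G) (hs : ∀ x, s x * s x = x)
    (hu : ∀ x y : G, x * x = y * y → x = y)
    (p q : MulAut G) (hp : ∀ x, p (p x) = x) (hc : ∀ x, p (q x) = q (p x))
    (hf : ∀ x, p x = x → q x = x → x = 1) (x : G) (hx : q x = x) : p x = x⁻¹ := by
  have hd := hs ((p x)⁻¹ * x)
  set d := s ((p x)⁻¹ * x) with hdd
  have hqd : q d = d := by
    apply hu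
    rw [← map_mul, hd, map_mul, map_inv, ← hc, hx]
  have hpd : p d = d⁻¹ := by
    apply hu
    rw [← map_mul, hd, map_mul, map_inv, hp, ← mul_inv_rev, hd]
    group
  have h1 : x * d⁻¹ = 1 := by
    apply hf
    · rw [map_mul, map_inv, hpd, inv_inv]
      have : p x = x * (d * d)⁻¹ := by rw [hd]; group
      rw [this]; group
    · rw [map_mul, map_inv, hqd, hx]
  have : x = d := by rwa [mul_inv_eq_one] at h1
  rw [this, hpd]

/-- the polar decomposition. -/
theorem kf_polar (s : G → G) (hs : ∀ x, s x * s x = x)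
    (hu : ∀ x y : G, x * x = y * y → x = y)
    (a : MulAut G) (ha : ∀ x, a (a x) = x) (x : G) :
    ∃ c d, a c = c ∧ a d = d⁻¹ ∧ x = c * d := by
  have hd := hs ((a x)⁻¹ * x)
  set d := s ((a x)⁻¹ * x) with hdd
  have hpd : a d = d⁻¹ := by
    apply hu
    rw [← map_mul, hd, map_mul, map_inv, ha, ← mul_inv_rev, hd]
    group
  refine ⟨x * d⁻¹, d, ?_, hpd, by group⟩
  rw [map_mul, map_inv, hpd, inv_inv]
  have : a x = x * (d * d)⁻¹ := by rw [hd]; group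
  rw [this]; group

/-- unique solvability of `m * y⁻¹ * m = z`. -/
theorem kf_mid_unique (s : G → G) (hs : ∀ x, s x * s x = x)
    (hu : ∀ x y : G, x * x = y * y → x = y) (y m n : G)
    (h : m * y⁻¹ * m = n * y⁻¹ * n) : m = n := by
  have hr := hs y
  set r := s y
  have : r⁻¹ * m * r⁻¹ = r⁻¹ * n * r⁻¹ := by
    apply hu
    have e : ∀ k : G, r⁻¹ * k * r⁻¹ * (r⁻¹ * k * r⁻¹) = r⁻¹ * (k * y⁻¹ * k) * r⁻¹ := by
      intro k; rw [← hr]; group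
    rw [e, e, h]
  exact mul_left_cancel (mul_right_cancel this)

theorem kf_mid_exists (s : G → G) (hs : ∀ x, s x * s x = x) (y z : G) :
    ∃ m, m * y⁻¹ * m = z := by
  have hr := hs y
  set r := s y
  have ht := hs (r⁻¹ * z * r⁻¹)
  set t := s (r⁻¹ * z * r⁻¹)
  refine ⟨r * t * r, ?_⟩
  have : r * t * r * y⁻¹ * (r * t * r) = r * (t * t) * r := by rw [← hr]; group
  rw [this, ht]; group

theorem kf_mid (s : G → G) (hs : ∀ x, s x * s x = x)
    (hu : ∀ x y : G, x * x = y * y → x = y)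
    (a b : MulAut G) (hb : ∀ x, b (b x) = x) (hc : ∀ x, a (b x) = b (a x))
    (y : G) (hy : a y = y⁻¹) :
    ∃ c e, b c = c ∧ a (b e) = e ∧ y = c * e * c := by
  obtain ⟨m, hm⟩ := kf_mid_exists s hs y (b y)
  have hbm : b m = m := by
    apply kf_mid_unique s hs hu y
    have h := congrArg b hm
    rw [map_mul, map_mul, map_inv, hb] at h
    rw [hm]
    have h2 : y⁻¹ = (b m)⁻¹ * b y * (b m)⁻¹ := by
      have h3 := congrArg (fun z => z⁻¹) h
      rw [← h3]; group
    rw [h2]; group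
  have ham : a m = m⁻¹ := by
    have : (a m)⁻¹ = m := by
      apply kf_mid_unique s hs hu y
      have h := congrArg a hm
      rw [map_mul, map_mul, map_inv, hc, hy, map_inv, inv_inv] at h
      rw [hm]
      have h2 : b y = ((b y)⁻¹)⁻¹ := by group
      rw [h2, ← h]; group
    rw [inv_eq_iff_eq_inv] at this
    exact this
  have hcm := hs m
  set c := s m
  have hbc : b c = c := by
    apply hu
    rw [← map_mul, hcm, hbm]
  have hac : a c = c⁻¹ := by
    apply hu
    rw [← map_mul, hcm, ham, ← hcm]; group
  refine ⟨c, c⁻¹ * y * c⁻¹, hbc, ?_, by group⟩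
  have h1 : b (c⁻¹ * y * c⁻¹) = (c⁻¹ * y * c⁻¹)⁻¹ := by
    rw [map_mul, map_mul, map_inv, hbc, ← hm, ← hcm]; group
  rw [h1, map_inv, map_mul, map_mul, map_inv, hac, hy]; group

/-- in a group with unique square roots no nontrivial element is conjugate to its inverse. -/
theorem kf_conj (hu : ∀ x y : G, x * x = y * y → x = y) (t k : G) (h : t * k * t = k) :
    t = 1 := by
  have h1 : t * k * t⁻¹ = k * (t⁻¹ * t⁻¹) := by
    calc t * k * t⁻¹ = (t * k * t) * (t⁻¹ * t⁻¹) := by group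
      _ = _ := by rw [h]
  have h2 : t * k = k * t⁻¹ := by rw [eq_mul_inv_iff_mul_eq]; exact h
  have h2' : t⁻¹ * k = k * t := by
    rw [inv_mul_eq_iff_eq_mul, ← mul_assoc]; exact h.symm
  have h3 : t * k * t⁻¹ = k := by
    apply hu
    calc t * k * t⁻¹ * (t * k * t⁻¹) = (t * k) * k * t⁻¹ := by group
      _ = k * (t⁻¹ * k) * t⁻¹ := by rw [h2]; group
      _ = k * k := by rw [h2']; group
  have h4 : t⁻¹ * t⁻¹ = 1 := by
    rw [h1] at h3; exact mul_eq_left.mp h3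
  have := hu t⁻¹ 1 (by rw [h4, mul_one])
  exact inv_eq_one.mp this

theorem kf_main [Finite G] (hodd : Odd (Nat.card G)) (a b : MulAut G)
    (ha : ∀ x, a (a x) = x) (hb : ∀ x, b (b x) = x) (hc : ∀ x, a (b x) = b (a x))
    (hf : ∀ x, a x = x → b x = x → x = 1) (x : G) :
    ∃ g₁ g₂ g₃ : G, a g₁ = g₁ ∧ b g₂ = g₂ ∧ a (b g₃) = g₃ ∧ x = g₁ * g₂ * g₃ := by
  obtain ⟨n, hn⟩ := hodd
  let s : G → G := fun x => x ^ (n + 1)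
  have hs : ∀ x, s x * s x = x := by
    intro x
    change x ^ (n + 1) * x ^ (n + 1) = x
    rw [← pow_add, show n + 1 + (n + 1) = Nat.card G + 1 by omega, pow_succ, pow_card_eq_one',
      one_mul]
  have hs' : ∀ x, s (x * x) = x := by
    intro x
    have := hs x
    change (x * x) ^ (n + 1) = x
    rw [(Commute.refl x).mul_pow]; exact this
  have hu : ∀ x y : G, x * x = y * y → x = y := by
    intro x y h
    rw [← hs' x, h, hs']
  have i1 : ∀ x, a x = x → b x = x⁻¹ :=
    fun x hx => kf_inverts s hs hu b a hb (fun x => (hc x).symm) (fun x h h' => hf x h' h) x hx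
  have i2 : ∀ x, b x = x → a x = x⁻¹ :=
    fun x hx => kf_inverts s hs hu a b ha hc hf x hx
  have i3 : ∀ x, a (b x) = x → a x = x⁻¹ := by
    intro x hx
    refine kf_inverts s hs hu a (a * b) ha (fun x => ?_) (fun x h h' => ?_) x hx
    · simp only [MulAut.mul_apply]; rw [hc x]
    · simp only [MulAut.mul_apply] at h'
      refine hf x h ?_
      rw [hc, h] at h'; exact h'
  have i3b : ∀ x, a (b x) = x → b x = x⁻¹ := by
    intro x hx
    rw [← i3 x hx]
    have := congrArg a hx
    rwa [ha] at this
  have comm2 : ∀ x y, b x = x → b y = y → x * y = y * x := by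
    intro x y hx hy
    have h := i2 (x * y) (by rw [map_mul, hx, hy])
    rw [map_mul, i2 x hx, i2 y hy, ← mul_inv_rev] at h
    exact (inv_injective h).symm
  let T := {x // a x = x} × {x // b x = x} × {x // a (b x) = x}
  let f : T → G := fun t => t.1.1 * t.2.1.1 * t.2.2.1
  let f' : T → G := fun t => t.1.1 * (t.2.1.1 * t.2.2.1 * t.2.1.1)
  have hf' : Function.Surjective f' := by
    intro x
    obtain ⟨g, y, hg, hy, rfl⟩ := kf_polar s hs hu a ha x
    obtain ⟨c, e, hc', he, rfl⟩ := kf_mid s hs hu a b hb hc y hy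
    exact ⟨⟨⟨g, hg⟩, ⟨c, hc'⟩, ⟨e, he⟩⟩, rfl⟩
  have hinj : Function.Injective f := by
    rintro ⟨⟨g1, hg1⟩, ⟨g2, hg2⟩, ⟨g3, hg3⟩⟩ ⟨⟨h1, hh1⟩, ⟨h2, hh2⟩, ⟨h3, hh3⟩⟩ h
    change g1 * g2 * g3 = h1 * h2 * h3 at h
    obtain ⟨k1, hk1⟩ : ∃ k, k = h1⁻¹ * g1 := ⟨_, rfl⟩
    obtain ⟨k3, hk3⟩ : ∃ k, k = h3 * g3⁻¹ := ⟨_, rfl⟩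
    have ak1 : a k1 = k1 := by rw [hk1, map_mul, map_inv, hh1, hg1]
    have abk3 : a (b k3) = k3 := by rw [hk3]; simp only [map_mul, map_inv, hh3, hg3]
    have e1 : k1 = h2 * k3 * g2⁻¹ := by
      have : g1 = h1 * h2 * h3 * g3⁻¹ * g2⁻¹ := by rw [← h]; group
      rw [hk1, hk3, this]; group
    have e2 : k1 = h2⁻¹ * k3⁻¹ * g2 := by
      have := congrArg a e1
      rw [ak1, map_mul, map_mul, map_inv, i2 _ hh2, i2 _ hg2, i3 _ abk3, inv_inv] at this
      exact this
    have e3 : k1 = g2 * k3 * h2⁻¹ := by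
      have := congrArg b e1
      rw [i1 _ ak1, map_mul, map_mul, map_inv, hh2, hg2, i3b _ abk3] at this
      rw [← inv_inv k1, this]; group
    have ht : g2⁻¹ * h2 = 1 := by
      apply kf_conj hu _ k3
      have hcm : g2⁻¹ * h2 = h2 * g2⁻¹ := comm2 _ _ (by rw [map_inv, hg2]) hh2
      calc g2⁻¹ * h2 * k3 * (g2⁻¹ * h2) = g2⁻¹ * (h2 * k3 * g2⁻¹) * h2 := by group
        _ = g2⁻¹ * (g2 * k3 * h2⁻¹) * h2 := by rw [← e1, e3]
        _ = k3 := by group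
    have hgh : g2 = h2 := inv_mul_eq_one.mp ht
    subst hgh
    have hk : k3 = 1 := by
      apply kf_conj hu _ (g2 * g2)
      have : g2 * k3 * g2⁻¹ = g2⁻¹ * k3⁻¹ * g2 := e1.symm.trans e2
      have h5 : k3 * g2⁻¹ = g2⁻¹ * (g2⁻¹ * k3⁻¹ * g2) := by rw [← this]; group
      have h6 : k3 = g2⁻¹ * g2⁻¹ * k3⁻¹ * g2 * g2 := by
        rw [← mul_inv_eq_iff_eq_mul, h5]; group
      calc k3 * (g2 * g2) * k3
          = k3 * (g2 * g2) * (g2⁻¹ * g2⁻¹ * k3⁻¹ * g2 * g2) := by rw [← h6]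
        _ = g2 * g2 := by group
    have hk' : k1 = 1 := by rw [e1, hk]; group
    have r1 : h1 = g1 := by rw [hk'] at hk1; exact inv_mul_eq_one.mp hk1.symm
    have r3 : h3 = g3 := by rw [hk] at hk3; exact mul_inv_eq_one.mp hk3.symm
    subst r1 r3
    rfl
  have hcard : Nat.card G ≤ Nat.card T := Nat.card_le_card_of_surjective f' hf'
  have hbij : Function.Bijective f := hinj.bijective_of_nat_card_le hcard
  obtain ⟨⟨g1, g2, g3⟩, h⟩ := hbij.2 x
  exact ⟨g1.1, g2.1, g3.1, g1.2, g2.2, g3.2, h.symm⟩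

end KleinFourAux

/-- **Lemma 4.3.**  Let the Klein four-group `V = {1, v₁, v₂, v₃}` (here `w 0 = v₁`,
`w 1 = v₂`, `w 2 = v₃ = v₁v₂`) act by automorphisms on a finite group `G` with
`C_G(V) = 1`, and set `Gᵢ = C_G(vᵢ)`.  Then `G = G₁G₂G₃`. -/
theorem eq_mul_of_centralizers_of_kleinFour_action
    (V : Type) [Group V] (w : Fin 3 → V)
    (hV4 : Nat.card V = 4)
    (hinv : ∀ i, w i * w i = 1) (hne1 : ∀ i, w i ≠ 1)
    (hw01 : w 0 * w 1 = w 1 * w 0) (hw2 : w 2 = w 0 * w 1)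
    (G : Type) [Group G] [Finite G] (φ : V →* MulAut G)
    (hfpf : ∀ x : G, (∀ v : V, φ v x = x) → x = 1) :
    ∀ x : G, ∃ g₁ g₂ g₃ : G,
      φ (w 0) g₁ = g₁ ∧ φ (w 1) g₂ = g₂ ∧ φ (w 2) g₃ = g₃ ∧ x = g₁ * g₂ * g₃ := by
  have hfin : Finite V := Nat.finite_of_card_ne_zero (by omega)
  have hne : w 0 ≠ w 1 := by
    intro h
    apply hne1 2
    rw [hw2, ← h]; exact hinv 0
  have hall : ∀ v : V, v = 1 ∨ v = w 0 ∨ v = w 1 ∨ v = w 2 := by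
    classical
    have := Fintype.ofFinite V
    have hcard : ({1, w 0, w 1, w 2} : Finset V).card = 4 := by
      have h02 : w 0 ≠ w 2 := by
        rw [hw2]; intro h; exact hne1 1 (mul_eq_left.mp h.symm)
      have h12 : w 1 ≠ w 2 := by
        rw [hw2]; intro h; exact hne1 0 (mul_eq_right.mp h.symm)
      have h0 := (hne1 0).symm
      have h1 := (hne1 1).symm
      have h2 := (hne1 2).symm
      rw [Finset.card_insert_of_notMem (by simp [h0, h1, h2]),
        Finset.card_insert_of_notMem (by simp [hne, h02]),
        Finset.card_insert_of_notMem (by simp [h12]), Finset.card_singleton]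
    have huniv : ({1, w 0, w 1, w 2} : Finset V) = Finset.univ := by
      apply Finset.eq_univ_of_card
      rw [hcard, ← hV4, Nat.card_eq_fintype_card]
    intro v
    have hv := Finset.mem_univ v
    rw [← huniv] at hv
    simpa using hv
  have hodd : Odd (Nat.card G) := by
    letI : MulAction V G := MulAction.compHom G φ
    have hp : IsPGroup 2 V := IsPGroup.of_card (n := 2) (by rw [hV4]; norm_num)
    have h := hp.card_modEq_card_fixedPoints G
    have h1 : Nat.card (MulAction.fixedPoints V G) = 1 := by
      rw [Nat.card_eq_one_iff_unique]
      refine ⟨⟨fun x y => ?_⟩, ⟨⟨1, fun v => map_one (φ v)⟩⟩⟩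
      apply Subtype.ext
      rw [hfpf x.1 (fun v => x.2 v), hfpf y.1 (fun v => y.2 v)]
    rw [h1] at h
    exact Nat.odd_iff.mpr h
  have hsq : ∀ i x, φ (w i) (φ (w i) x) = x := by
    intro i x
    rw [← MulAut.mul_apply, ← map_mul, hinv, map_one, MulAut.one_apply]
  have hm2 : ∀ x, φ (w 2) x = φ (w 0) (φ (w 1) x) := by
    intro x
    rw [hw2, map_mul, MulAut.mul_apply]
  intro x
  obtain ⟨g1, g2, g3, h1, h2, h3, h⟩ := kf_main hodd (φ (w 0)) (φ (w 1)) (hsq 0) (hsq 1)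
    (fun x => by rw [← MulAut.mul_apply, ← map_mul, hw01, map_mul, MulAut.mul_apply])
    (fun x ha hb => hfpf x (fun v => by
      rcases hall v with rfl | rfl | rfl | rfl
      · rw [map_one, MulAut.one_apply]
      · exact ha
      · exact hb
      · rw [hm2, hb, ha])) x
  exact ⟨g1, g2, g3, h1, h2, by rw [hm2]; exact h3, h⟩
end

section
/- Let V act on the finite group G as in the context with C_G(V) = 1. Then G′ = ⟨G₁ ∪ G₂⟩ ∩ ⟨G₂ ∪ G₃⟩ ∩ ⟨G₃ ∪ G₁⟩, where G′ is the derived subgroup of G and ⟨G_i ∪ G_j⟩ is the subgroup generated by G_i and G_j. In particular, each subgroup ⟨G_i ∪ G_j⟩ (i ≠ j) is normal in G and contains G′. -/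
/-- The subgroup of fixed points of an automorphism of a group. -/
def fixedSubgroup {G : Type} [Group G] (σ : MulAut G) : Subgroup G where
  carrier := {x | σ x = x}
  one_mem' := map_one σ
  mul_mem' := fun {a b} ha hb => by
    simp only [Set.mem_setOf_eq] at *
    rw [map_mul, ha, hb]
  inv_mem' := fun {a} ha => by
    simp only [Set.mem_setOf_eq] at *
    rw [map_inv, ha]

theorem mem_fixedSubgroup_iff' {G : Type} [Group G] (σ : MulAut G) (x : G) :
    x ∈ fixedSubgroup σ ↔ σ x = x := Iff.rfl

/-- An automorphism `b` inverts the fixed points of `a`. -/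
theorem inverted_of_fixed {G : Type} [Group G] (r : G → G) (hr : ∀ x, r x * r x = x)
    (hinj : ∀ x y : G, x * x = y * y → x = y) (a b : MulAut G)
    (hb : ∀ x, b (b x) = x) (hab : ∀ x, a (b x) = b (a x))
    (hfix : ∀ x, a x = x → b x = x → x = 1) (x : G) (hx : a x = x) : b x = x⁻¹ := by
  have hσ : ∀ (σ : MulAut G) (x : G), σ (r x) = r (σ x) := by
    intro σ x
    apply hinj
    rw [← map_mul, hr, hr]
  have hrinv : ∀ x : G, r x⁻¹ = (r x)⁻¹ := by
    intro x
    apply hinj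
    rw [← mul_inv_rev, hr, hr]
  set y := r ((b x)⁻¹ * x) with hy
  have hyy : y * y = (b x)⁻¹ * x := hr _
  have hby : b y = y⁻¹ := by
    rw [hy, hσ, ← hrinv]
    simp [hb]
  have hay : a y = y := by
    rw [hy, hσ]
    simp [hab, hx]
  have hu : x * y⁻¹ = 1 := by
    apply hfix
    · simp [hx, hay]
    · rw [map_mul, map_inv, hby, inv_inv]
      apply mul_right_cancel (b := y)
      rw [mul_assoc, hyy]
      group
  have hxy : x = y := mul_inv_eq_one.mp hu
  rw [hxy, hby]

/-- Main step: `⟨C(b), C(c)⟩` is normal and contains the derived subgroup. -/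
theorem sup_normal_and_commutator_le {G : Type} [Group G] (r : G → G)
    (hr : ∀ x, r x * r x = x)
    (hinj : ∀ x y : G, x * x = y * y → x = y) (a b c : MulAut G)
    (ha : ∀ x, a (a x) = x) (hb : ∀ x, b (b x) = x)
    (hab : ∀ x, a (b x) = c x) (hba : ∀ x, b (a x) = c x)
    (hfix : ∀ x, a x = x → b x = x → x = 1) :
    (fixedSubgroup b ⊔ fixedSubgroup c).Normal ∧
      commutator G ≤ fixedSubgroup b ⊔ fixedSubgroup c := by
  have hσ : ∀ (σ : MulAut G) (x : G), σ (r x) = r (σ x) := by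
    intro σ x
    apply hinj
    rw [← map_mul, hr, hr]
  have hrinv : ∀ x : G, r x⁻¹ = (r x)⁻¹ := by
    intro x
    apply hinj
    rw [← mul_inv_rev, hr, hr]
  have hcomm : ∀ x, a (b x) = b (a x) := fun x => by rw [hab, hba]
  have hinvA : ∀ x, a x = x → b x = x⁻¹ :=
    inverted_of_fixed r hr hinj a b hb hcomm hfix
  have hinvB : ∀ x, b x = x → a x = x⁻¹ :=
    inverted_of_fixed r hr hinj b a ha (fun x => (hcomm x).symm) (fun x h1 h2 => hfix x h2 h1)
  have hinvC : ∀ x, c x = x → a x = x⁻¹ := by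
    apply inverted_of_fixed r hr hinj c a ha
    · intro x
      rw [← hba, ← hba, ha, hcomm, ← hcomm, ← hcomm, ha]
    · intro x h1 h2
      apply hfix x h2
      rw [← hba, h2] at h1
      exact h1
  set N := fixedSubgroup b ⊔ fixedSubgroup c with hN
  -- every element inverted by `a` lies in `N`
  have hI : ∀ y, a y = y⁻¹ → y ∈ N := by
    intro y hy
    have huniq : ∀ m m' : G, m * y⁻¹ * m = m' * y⁻¹ * m' → m = m' := by
      intro m m' h
      have : m * y⁻¹ = m' * y⁻¹ := by
        apply hinj
        rw [← mul_assoc, ← mul_assoc, h]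
      exact mul_right_cancel this
    set m := r (b y * y⁻¹) * y with hm
    have hmeq : m * y⁻¹ * m = b y := by
      have : m * y⁻¹ * m = (r (b y * y⁻¹) * r (b y * y⁻¹)) * y := by
        rw [hm]; group
      rw [this, hr]; group
    have hbm : b m = m := by
      apply huniq
      rw [hmeq]
      have h := congrArg b hmeq
      rw [map_mul, map_mul, map_inv, hb] at h
      have h2 : b y = b m * y⁻¹ * b m := by
        have h3 : y⁻¹ = (b m * (b y)⁻¹ * b m)⁻¹ := by rw [h]
        rw [h3]; group
      exact h2.symm
    have ham : a m = m⁻¹ := hinvB m hbm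
    set n := r m with hn
    have hnn : n * n = m := hr m
    have hbn : b n = n := by rw [hn, hσ, hbm]
    have han : a n = n⁻¹ := hinvB n hbn
    set z := n⁻¹ * y * n⁻¹ with hz
    have hbz : b z = z⁻¹ := by
      rw [hz, map_mul, map_mul, map_inv, hbn, ← hmeq, ← hnn]; group
    have haz : a z = z⁻¹ := by
      rw [hz, map_mul, map_mul, map_inv, han, hy]; group
    have hcz : c z = z := by
      rw [← hab, hbz, map_inv, haz, inv_inv]
    have hyz : y = n * z * n := by rw [hz]; group
    have hnN : n ∈ N := (le_sup_left : fixedSubgroup b ≤ N) hbn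
    have hzN : z ∈ N := (le_sup_right : fixedSubgroup c ≤ N) hcz
    rw [hyz]
    exact N.mul_mem (N.mul_mem hnN hzN) hnN
  have hd : ∀ g, g⁻¹ * a g ∈ N := by
    intro g
    apply hI
    rw [map_mul, map_inv, ha]; group
  have hconj : ∀ y, a y = y⁻¹ → ∀ h : G, h * y * h⁻¹ ∈ N := by
    intro y hy h
    have hny : a (r y) = (r y)⁻¹ := by rw [hσ, hy, hrinv]
    have h1 := N.mul_mem (hd ((r y)⁻¹ * h⁻¹)) (N.inv_mem (hd h⁻¹))
    have h2 : ((r y)⁻¹ * h⁻¹)⁻¹ * a ((r y)⁻¹ * h⁻¹) * (h⁻¹⁻¹ * a h⁻¹)⁻¹ = h * y * h⁻¹ := by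
      rw [map_mul, map_inv, hny]
      conv_rhs => rw [← hr y]
      group
    rwa [h2] at h1
  have hNormal : N.Normal := by
    refine ⟨fun x hx h => ?_⟩
    have hle : N ≤ N.comap (MulAut.conj h).toMonoidHom := by
      rw [hN]
      refine sup_le ?_ ?_
      · intro x hx
        exact hconj x (hinvB x hx) h
      · intro x hx
        exact hconj x (hinvC x hx) h
    exact hle hx
  refine ⟨hNormal, ?_⟩
  -- `G = C(a) N`
  have hdecomp : ∀ g : G, ∃ u, a u = u ∧ (u : G ⧸ N) = g := by
    intro g
    set y := r ((a g)⁻¹ * g) with hy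
    have hyy : y * y = (a g)⁻¹ * g := hr _
    have hay : a y = y⁻¹ := by
      rw [hy, hσ, ← hrinv]
      simp [ha]
    refine ⟨g * y⁻¹, ?_, ?_⟩
    · rw [map_mul, map_inv, hay, inv_inv]
      apply mul_right_cancel (b := y)
      rw [mul_assoc, hyy]
      group
    · rw [QuotientGroup.eq]
      have : (g * y⁻¹)⁻¹ * g = y := by group
      rw [this]
      exact hI y hay
  rw [commutator_def, Subgroup.commutator_le]
  intro g _ h _
  obtain ⟨u, hu, hug⟩ := hdecomp g
  obtain ⟨v, hv, hvh⟩ := hdecomp h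
  have huv : u * v = v * u := by
    have h1 : b (u * v) = (u * v)⁻¹ := hinvA _ (by rw [map_mul, hu, hv])
    rw [map_mul, hinvA u hu, hinvA v hv, ← mul_inv_rev, inv_inj] at h1
    exact h1.symm
  rw [← QuotientGroup.eq_one_iff, commutatorElement_def]
  simp only [QuotientGroup.mk_mul, QuotientGroup.mk_inv]
  rw [← hug, ← hvh, ← QuotientGroup.mk_mul, huv]
  simp

/-- If `σ` inverts generators modulo the derived subgroup, it inverts everything. -/
theorem mul_map_mem_commutator {G : Type} [Group G] (σ : MulAut G) (H K : Subgroup G)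
    (hH : ∀ x ∈ H, σ x = x⁻¹) (hK : ∀ x ∈ K, σ x = x⁻¹) (x : G) (hx : x ∈ H ⊔ K) :
    Abelianization.of (σ x) = (Abelianization.of x)⁻¹ := by
  have hle : H ⊔ K ≤ MonoidHom.eqLocus ((Abelianization.of (G := G)).comp σ.toMonoidHom)
      ((Abelianization.of (G := G))⁻¹) := by
    refine sup_le ?_ ?_
    · intro x hx
      change Abelianization.of (σ x) = (Abelianization.of x)⁻¹
      rw [hH x hx, map_inv]
    · intro x hx
      change Abelianization.of (σ x) = (Abelianization.of x)⁻¹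
      rw [hK x hx, map_inv]
  exact hle hx

/-- **Lemma 4.4.**  Let the Klein four-group `V = {1, v₁, v₂, v₃}` (here `w 0 = v₁`,
`w 1 = v₂`, `w 2 = v₃ = v₁v₂`) act by automorphisms on a finite group `G` with
`C_G(V) = 1`, and set `Gᵢ = C_G(vᵢ)`.  Then
`G' = ⟨G₁, G₂⟩ ∩ ⟨G₂, G₃⟩ ∩ ⟨G₃, G₁⟩`; in particular each `⟨Gᵢ, Gⱼ⟩` (`i ≠ j`) is
normal in `G` and contains `G'`. -/
theorem derived_eq_inf_of_kleinFour_action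
    (V : Type) [Group V] (w : Fin 3 → V)
    (hV4 : Nat.card V = 4)
    (hinv : ∀ i, w i * w i = 1) (hne1 : ∀ i, w i ≠ 1)
    (hw01 : w 0 * w 1 = w 1 * w 0) (hw2 : w 2 = w 0 * w 1)
    (G : Type) [Group G] [Finite G] (φ : V →* MulAut G)
    (hfpf : ∀ x : G, (∀ v : V, φ v x = x) → x = 1) :
    commutator G =
        (fixedSubgroup (φ (w 0)) ⊔ fixedSubgroup (φ (w 1))) ⊓
        ((fixedSubgroup (φ (w 1)) ⊔ fixedSubgroup (φ (w 2))) ⊓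
         (fixedSubgroup (φ (w 2)) ⊔ fixedSubgroup (φ (w 0)))) ∧
      ∀ i j : Fin 3, i ≠ j →
        (fixedSubgroup (φ (w i)) ⊔ fixedSubgroup (φ (w j))).Normal ∧
        commutator G ≤ fixedSubgroup (φ (w i)) ⊔ fixedSubgroup (φ (w j)) := by
  have hodd : Nat.card G % 2 = 1 := by
    letI : MulAction V G := MulAction.compHom G φ
    haveI : Finite V := Nat.finite_of_card_ne_zero (by rw [hV4]; norm_num)
    have hp : IsPGroup 2 V := IsPGroup.of_card (n := 2) (by rw [hV4]; norm_num)
    haveI : Fact (Nat.Prime 2) := ⟨Nat.prime_two⟩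
    have h := hp.card_modEq_card_fixedPoints G
    have h1 : Nat.card (MulAction.fixedPoints V G) = 1 := by
      rw [Nat.card_eq_one_iff_unique]
      refine ⟨⟨?_⟩, ⟨⟨1, fun v => map_one (φ v)⟩⟩⟩
      rintro ⟨x, hx⟩ ⟨y, hy⟩
      have hx1 := hfpf x hx
      have hy1 := hfpf y hy
      subst hx1
      subst hy1
      rfl
    rw [h1] at h
    exact h
  have hroot : ∀ x : G, x ^ ((Nat.card G + 1) / 2) * x ^ ((Nat.card G + 1) / 2) = x := by
    intro x
    rw [← pow_add, show (Nat.card G + 1) / 2 + (Nat.card G + 1) / 2 = Nat.card G + 1 by omega,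
      pow_succ, pow_card_eq_one', one_mul]
  have hroot2 : ∀ x : G, (x * x) ^ ((Nat.card G + 1) / 2) = x := by
    intro x
    rw [(Commute.refl x).mul_pow, hroot]
  have hinj : ∀ x y : G, x * x = y * y → x = y := by
    intro x y h
    rw [← hroot2 x, h, hroot2]
  have hsq : ∀ i x, φ (w i) (φ (w i) x) = x := by
    intro i x
    rw [← MulAut.mul_apply, ← map_mul, hinv, map_one, MulAut.one_apply]
  have e01 : w 0 * w 1 = w 2 := hw2.symm
  have e10 : w 1 * w 0 = w 2 := by rw [← hw01, e01]
  have e12 : w 1 * w 2 = w 0 := by rw [← e10, ← mul_assoc, hinv, one_mul]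
  have e21 : w 2 * w 1 = w 0 := by rw [← e01, mul_assoc, hinv, mul_one]
  have e02 : w 0 * w 2 = w 1 := by rw [← e01, ← mul_assoc, hinv, one_mul]
  have e20 : w 2 * w 0 = w 1 := by rw [← e10, mul_assoc, hinv, mul_one]
  have hact : ∀ i j k, w i * w j = w k → ∀ x, φ (w i) (φ (w j) x) = φ (w k) x := by
    intro i j k h x
    rw [← h, map_mul, MulAut.mul_apply]
  -- the three involutions exhaust `V \ {1}`
  have hV : ∀ v : V, v = 1 ∨ v = w 0 ∨ v = w 1 ∨ v = w 2 := by
    classical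
    haveI : Finite V := Nat.finite_of_card_ne_zero (by rw [hV4]; norm_num)
    haveI : Fintype V := Fintype.ofFinite V
    have n01 : w 0 ≠ w 1 := fun h => hne1 2 (by rw [← e01, h, hinv])
    have n02 : w 0 ≠ w 2 := fun h => hne1 1 (by rw [← e02, ← h, hinv])
    have n12 : w 1 ≠ w 2 := fun h => hne1 0 (by rw [← e12, ← h, hinv])
    have hc : ({1, w 0, w 1, w 2} : Finset V).card = 4 := by
      rw [Finset.card_insert_of_notMem, Finset.card_insert_of_notMem,
        Finset.card_insert_of_notMem, Finset.card_singleton]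
      · simpa using n12
      · simp [n01, n02]
      · simp [(hne1 0).symm, (hne1 1).symm, (hne1 2).symm]
    have hu : ({1, w 0, w 1, w 2} : Finset V) = Finset.univ := by
      rw [← Finset.card_eq_iff_eq_univ, hc, ← Nat.card_eq_fintype_card, hV4]
    intro v
    have hv : v ∈ ({1, w 0, w 1, w 2} : Finset V) := by rw [hu]; exact Finset.mem_univ v
    simpa using hv
  have hfix3 : ∀ x, φ (w 0) x = x → φ (w 1) x = x → φ (w 2) x = x → x = 1 := by
    intro x h0 h1 h2
    apply hfpf
    intro v
    rcases hV v with h | h | h | h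
    · rw [h, map_one, MulAut.one_apply]
    · rw [h, h0]
    · rw [h, h1]
    · rw [h, h2]
  have f01 : ∀ x, φ (w 0) x = x → φ (w 1) x = x → x = 1 := fun x h0 h1 =>
    hfix3 x h0 h1 (by rw [← hact 0 1 2 e01, h1, h0])
  have f12 : ∀ x, φ (w 1) x = x → φ (w 2) x = x → x = 1 := fun x h1 h2 =>
    hfix3 x (by rw [← hact 1 2 0 e12, h2, h1]) h1 h2
  have f20 : ∀ x, φ (w 2) x = x → φ (w 0) x = x → x = 1 := fun x h2 h0 =>
    hfix3 x h0 (by rw [← hact 2 0 1 e20, h0, h2]) h2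
  have m12 := sup_normal_and_commutator_le _ hroot hinj (φ (w 0)) (φ (w 1)) (φ (w 2))
    (hsq 0) (hsq 1) (hact 0 1 2 e01) (hact 1 0 2 e10) f01
  have m20 := sup_normal_and_commutator_le _ hroot hinj (φ (w 1)) (φ (w 2)) (φ (w 0))
    (hsq 1) (hsq 2) (hact 1 2 0 e12) (hact 2 1 0 e21) f12
  have m01 := sup_normal_and_commutator_le _ hroot hinj (φ (w 2)) (φ (w 0)) (φ (w 1))
    (hsq 2) (hsq 0) (hact 2 0 1 e20) (hact 0 2 1 e02) f20
  have hcm : ∀ i j k, w i * w j = w k → w j * w i = w k →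
      ∀ x, φ (w i) (φ (w j) x) = φ (w j) (φ (w i) x) := by
    intro i j k h h' x
    rw [hact i j k h, hact j i k h']
  have i01 := inverted_of_fixed _ hroot hinj (φ (w 0)) (φ (w 1)) (hsq 1) (hcm 0 1 2 e01 e10) f01
  have i12 := inverted_of_fixed _ hroot hinj (φ (w 1)) (φ (w 2)) (hsq 2) (hcm 1 2 0 e12 e21) f12
  have i20 := inverted_of_fixed _ hroot hinj (φ (w 2)) (φ (w 0)) (hsq 0) (hcm 2 0 1 e20 e02) f20
  have i10 := inverted_of_fixed _ hroot hinj (φ (w 1)) (φ (w 0)) (hsq 0) (hcm 1 0 2 e10 e01)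
    (fun x h h' => f01 x h' h)
  have i21 := inverted_of_fixed _ hroot hinj (φ (w 2)) (φ (w 1)) (hsq 1) (hcm 2 1 0 e21 e12)
    (fun x h h' => f12 x h' h)
  have i02 := inverted_of_fixed _ hroot hinj (φ (w 0)) (φ (w 2)) (hsq 2) (hcm 0 2 1 e02 e20)
    (fun x h h' => f20 x h' h)
  refine ⟨le_antisymm (le_inf m01.2 (le_inf m12.2 m20.2)) ?_, ?_⟩
  · rintro x ⟨hx01, hx12, hx20⟩
    have t2 := mul_map_mem_commutator (φ (w 2)) _ _ i02 i12 x hx01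
    have t0 := mul_map_mem_commutator (φ (w 0)) _ _ i10 i20 x hx12
    -- apply `w 1` to `w 0 x`, which also lies in the relevant subgroup modulo `G'`
    have hx20' : φ (w 0) x ∈ fixedSubgroup (φ (w 2)) ⊔ fixedSubgroup (φ (w 0)) := by
      have hle : fixedSubgroup (φ (w 2)) ⊔ fixedSubgroup (φ (w 0)) ≤
          (fixedSubgroup (φ (w 2)) ⊔ fixedSubgroup (φ (w 0))).comap (φ (w 0)).toMonoidHom := by
        refine sup_le ?_ ?_
        · intro y hy
          change φ (w 0) y ∈ fixedSubgroup (φ (w 2)) ⊔ fixedSubgroup (φ (w 0))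
          rw [i20 y hy]
          exact Subgroup.inv_mem _ ((le_sup_left : fixedSubgroup (φ (w 2)) ≤ _) hy)
        · intro y hy
          change φ (w 0) y ∈ fixedSubgroup (φ (w 2)) ⊔ fixedSubgroup (φ (w 0))
          rw [show φ (w 0) y = y from hy]
          exact (le_sup_right : fixedSubgroup (φ (w 0)) ≤ _) hy
      exact hle hx20
    have t1 := mul_map_mem_commutator (φ (w 1)) _ _ i21 i01 _ hx20'
    rw [hact 1 0 2 e10, t2, t0, inv_inv] at t1
    have hs : Abelianization.of x * Abelianization.of x = 1 := by
      nth_rewrite 1 [← t1]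
      exact inv_mul_cancel _
    have hker : x * x ∈ commutator G := by
      rw [← Abelianization.ker_of, MonoidHom.mem_ker, map_mul, hs]
    have hx := Subgroup.pow_mem _ hker ((Nat.card G + 1) / 2)
    rwa [hroot2] at hx
  · intro i j hij
    fin_cases i <;> fin_cases j <;> first
      | exact absurd rfl hij
      | exact m01
      | exact m12
      | exact m20
      | (rw [sup_comm]; exact m01)
      | (rw [sup_comm]; exact m12)
      | (rw [sup_comm]; exact m20)
end

section
/- Let V act on the finite group G as in the context with C_G(V) = 1, and let {i, j, k} = {1, 2, 3}. Let x ∈ G_i and y ∈ G_j, and set H = ⟨x, y⟩. Suppose s ∈ G_k and t ∈ G_j satisfy y^x = s·t·s (such a pair exists and is unique). Then the normal closure of s in H, i.e. the subgroup ⟨s^h : h ∈ H⟩, equals the derived subgroup H′ of H. -/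
theorem aux_sq_mem {G : Type} [Group G] (hodd : Odd (Nat.card G)) (N : Subgroup G)
    (g : G) (hg : g * g ∈ N) : g ∈ N := by
  obtain ⟨m, hm⟩ := hodd
  have h1 : g ^ (Nat.card G) = 1 := pow_card_eq_one'
  have h2 : (g * g) ^ (m + 1) = g := by
    rw [← pow_two, ← pow_mul, show 2 * (m + 1) = Nat.card G + 1 by omega, pow_succ, h1, one_mul]
  rw [← h2]
  exact N.pow_mem hg _

theorem aux_odd {V G : Type} [Group V] [Group G] [Finite G] (hV4 : Nat.card V = 4)
    (φ : V →* MulAut G) (hfpf : ∀ x : G, (∀ v : V, φ v x = x) → x = 1) :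
    Odd (Nat.card G) := by
  let _ : MulAction V G := MulAction.compHom G φ
  have : Fact (Nat.Prime 2) := ⟨Nat.prime_two⟩
  have hp : IsPGroup 2 V := IsPGroup.of_card (n := 2) (by rw [hV4]; norm_num)
  have h := hp.card_modEq_card_fixedPoints G
  have h1 : Nat.card (MulAction.fixedPoints V G) = 1 := by
    rw [Nat.card_eq_one_iff_unique]
    refine ⟨⟨fun a b => Subtype.ext ?_⟩, ⟨⟨1, fun v => ?_⟩⟩⟩
    · rw [hfpf a.1 (fun v => a.2 v), hfpf b.1 (fun v => b.2 v)]
    · exact map_one (φ v)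
  rw [h1] at h
  rw [Nat.odd_iff]
  exact h

theorem aux_inv {G : Type} [Group G] [Finite G] (e f : MulAut G)
    (hef : ∀ g, e (f g) = f (e g)) (hff : ∀ g, f (f g) = g)
    (hfix : ∀ g, e g = g → f g = g → g = 1) (x : G) (hx : e x = x) : f x = x⁻¹ := by
  let S := {g : G // e g = g}
  let F : S → S := fun g => ⟨g.1⁻¹ * f g.1, by rw [map_mul, map_inv, hef, g.2]⟩
  have hinj : Function.Injective F := by
    intro a b hab
    have h : a.1⁻¹ * f a.1 = b.1⁻¹ * f b.1 := congrArg Subtype.val hab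
    have h2 : a.1 * b.1⁻¹ = 1 := by
      apply hfix
      · rw [map_mul, map_inv, a.2, b.2]
      · rw [map_mul, map_inv]
        have : f a.1 = a.1 * (b.1⁻¹ * f b.1) := by rw [← h]; group
        rw [this]; group
    exact Subtype.ext (mul_inv_eq_one.mp h2)
  obtain ⟨g, hg⟩ := Finite.surjective_of_injective hinj ⟨x, hx⟩
  have hg' : g.1⁻¹ * f g.1 = x := congrArg Subtype.val hg
  rw [← hg', map_mul, map_inv, hff]
  group

/-- Elements `a` of `H` commuting with `c` modulo `N`. -/
def auxK {G : Type} [Group G] (H N : Subgroup G)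
    (hN : ∀ h ∈ H, ∀ n ∈ N, h * n * h⁻¹ ∈ N) (c : G) : Subgroup G where
  carrier := {a | a ∈ H ∧ a * c * a⁻¹ * c⁻¹ ∈ N}
  one_mem' := ⟨H.one_mem, by simp⟩
  mul_mem' := by
    rintro a b ⟨ha, ha'⟩ ⟨hb, hb'⟩
    refine ⟨H.mul_mem ha hb, ?_⟩
    have := N.mul_mem (hN a ha _ hb') ha'
    convert this using 1
    group
  inv_mem' := by
    rintro a ⟨ha, ha'⟩
    refine ⟨H.inv_mem ha, ?_⟩
    have := hN _ (H.inv_mem ha) _ (N.inv_mem ha')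
    convert this using 1
    group

theorem aux_comm {G : Type} [Group G] (x y : G) (H N : Subgroup G)
    (hH : H = Subgroup.closure {x, y})
    (hN : ∀ h ∈ H, ∀ n ∈ N, h * n * h⁻¹ ∈ N) (hxy : x * y * x⁻¹ * y⁻¹ ∈ N) :
    ⁅H, H⁆ ≤ N := by
  have hx : x ∈ H := hH ▸ Subgroup.subset_closure (by simp)
  have hy : y ∈ H := hH ▸ Subgroup.subset_closure (by simp)
  have key : ∀ c, x * c * x⁻¹ * c⁻¹ ∈ N → y * c * y⁻¹ * c⁻¹ ∈ N → H ≤ auxK H N hN c := by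
    intro c h1 h2
    conv_lhs => rw [hH]
    rw [Subgroup.closure_le]
    rintro z (rfl | rfl)
    · exact ⟨hx, h1⟩
    · exact ⟨hy, h2⟩
  have sw : ∀ a b, a * b * a⁻¹ * b⁻¹ ∈ N → b * a * b⁻¹ * a⁻¹ ∈ N := by
    intro a b h
    convert N.inv_mem h using 1
    group
  have kx := key x (by simp) (sw _ _ hxy)
  have ky := key y hxy (by simp)
  rw [Subgroup.commutator_le]
  intro a ha b hb
  exact (key b (sw _ _ (kx hb).2) (sw _ _ (ky hb).2) ha).2

theorem aux_fix {V : Type} [Group V] (w : Fin 3 → V)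
    (hV4 : Nat.card V = 4)
    (hinv : ∀ i, w i * w i = 1) (hne1 : ∀ i, w i ≠ 1)
    (hw2 : w 2 = w 0 * w 1) (v : V) : v = 1 ∨ v = w 0 ∨ v = w 1 ∨ v = w 2 := by
  classical
  have : Finite V := Nat.finite_of_card_ne_zero (by omega)
  have := Fintype.ofFinite V
  have h01 : w 0 ≠ w 1 := by
    intro h
    apply hne1 2
    rw [hw2, ← h, hinv]
  have h02 : w 0 ≠ w 2 := by
    intro h
    apply hne1 1
    rw [hw2] at h
    exact (mul_eq_left.mp h.symm)
  have h12 : w 1 ≠ w 2 := by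
    intro h
    apply hne1 0
    rw [hw2] at h
    exact (mul_eq_right.mp h.symm)
  have hc : ({1, w 0, w 1, w 2} : Finset V).card = 4 := by
    rw [Finset.card_insert_of_notMem, Finset.card_insert_of_notMem, Finset.card_pair h12]
    · simp [h01, h02]
    · simp [(hne1 0).symm, (hne1 1).symm, (hne1 2).symm]
  have hu : ({1, w 0, w 1, w 2} : Finset V) = Finset.univ := by
    apply Finset.eq_univ_of_card
    rw [hc, ← Nat.card_eq_fintype_card, hV4]
  have := Finset.mem_univ v
  rw [← hu] at this
  simpa using this

/-- **Lemma 4.5.**  Let the Klein four-group `V = {1, v₁, v₂, v₃}` (here `w 0 = v₁`,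
`w 1 = v₂`, `w 2 = v₃ = v₁v₂`) act by automorphisms on a finite group `G` with
`C_G(V) = 1`, and set `Gᵢ = C_G(vᵢ)`; let `{i, j, k} = {1, 2, 3}`.  Let `x ∈ Gᵢ`,
`y ∈ Gⱼ`, `H = ⟨x, y⟩`, and suppose `s ∈ G_k`, `t ∈ Gⱼ` satisfy `y^x = s·t·s`.
Then the normal closure `⟨s^H⟩` of `s` in `H` equals the derived subgroup `H'`. -/
theorem normal_closure_star_eq_derived_of_kleinFour_action
    (V : Type) [Group V] (w : Fin 3 → V)
    (hV4 : Nat.card V = 4)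
    (hinv : ∀ i, w i * w i = 1) (hne1 : ∀ i, w i ≠ 1)
    (hw01 : w 0 * w 1 = w 1 * w 0) (hw2 : w 2 = w 0 * w 1)
    (G : Type) [Group G] [Finite G] (φ : V →* MulAut G)
    (hfpf : ∀ x : G, (∀ v : V, φ v x = x) → x = 1)
    (i j k : Fin 3) (hij : i ≠ j) (hjk : j ≠ k) (hik : i ≠ k)
    (x y s t : G)
    (hx : φ (w i) x = x) (hy : φ (w j) y = y)
    (hs : φ (w k) s = s) (ht : φ (w j) t = t)
    (hconj : x⁻¹ * y * x = s * t * s) :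
    Subgroup.closure {g : G | ∃ h ∈ Subgroup.closure {x, y}, g = h⁻¹ * s * h} =
      ⁅Subgroup.closure {x, y}, Subgroup.closure {x, y}⁆ := by
  have hodd := aux_odd hV4 φ hfpf
  have hcomm : ∀ a b, w a * w b = w b * w a := by
    have e02 : w 0 * w 2 = w 2 * w 0 := by
      rw [hw2, mul_assoc (w 0), ← hw01]
    have e12 : w 1 * w 2 = w 2 * w 1 := by
      rw [hw2, ← mul_assoc, ← hw01]
    intro a b
    fin_cases a <;> fin_cases b <;> first | rfl | assumption | (symm; assumption)
  have hprod : ∀ a b c : Fin 3, a ≠ b → b ≠ c → a ≠ c → w c = w a * w b := by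
    have e02 : w 1 = w 0 * w 2 := by rw [hw2, ← mul_assoc, hinv, one_mul]
    have e12 : w 0 = w 2 * w 1 := by rw [hw2, mul_assoc, hinv, mul_one]
    have e20 : w 1 = w 2 * w 0 := by rw [hcomm, ← e02]
    have e21 : w 0 = w 1 * w 2 := by rw [hcomm, ← e12]
    have e10 : w 2 = w 1 * w 0 := by rw [hcomm, ← hw2]
    intro a b c h1 h2 h3
    fin_cases a <;> fin_cases b <;> fin_cases c <;> first | assumption | (simp at h1 h2 h3)
  have hfix : ∀ a b c : Fin 3, a ≠ b → b ≠ c → a ≠ c → ∀ g : G,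
      φ (w a) g = g → φ (w b) g = g → g = 1 := by
    intro a b c h1 h2 h3 g ha hb
    have hc : φ (w c) g = g := by
      rw [hprod a b c h1 h2 h3, map_mul, MulAut.mul_apply, hb, ha]
    have hall : ∀ d, φ (w d) g = g := by
      intro d
      have : d = a ∨ d = b ∨ d = c := by omega
      rcases this with rfl | rfl | rfl <;> assumption
    apply hfpf
    intro v
    rcases aux_fix w hV4 hinv hne1 hw2 v with rfl | rfl | rfl | rfl
    · simp
    all_goals exact hall _
  have hsq : ∀ g, φ (w j) (φ (w j) g) = g := by
    intro g
    rw [← MulAut.mul_apply, ← map_mul, hinv, map_one, MulAut.one_apply]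
  have hcm : ∀ a g, φ (w a) (φ (w j) g) = φ (w j) (φ (w a) g) := by
    intro a g
    rw [← MulAut.mul_apply, ← map_mul, hcomm, map_mul, MulAut.mul_apply]
  have hxi : φ (w j) x = x⁻¹ :=
    aux_inv (φ (w i)) (φ (w j)) (hcm i) hsq (hfix i j k hij hjk hik) x hx
  have hsi : φ (w j) s = s⁻¹ :=
    aux_inv (φ (w k)) (φ (w j)) (hcm k) hsq (hfix k j i hjk.symm hij.symm hik.symm) s hs
  have hconj2 : x * y * x⁻¹ = s⁻¹ * t * s⁻¹ := by
    have := congrArg (φ (w j)) hconj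
    simpa [hxi, hsi, hy, ht] using this
  generalize hH : Subgroup.closure {x, y} = H
  have hxH : x ∈ H := hH ▸ Subgroup.subset_closure (by simp)
  have hyH : y ∈ H := hH ▸ Subgroup.subset_closure (by simp)
  have haH : s * t * s ∈ H := hconj ▸ H.mul_mem (H.mul_mem (H.inv_mem hxH) hyH) hxH
  have hbH : s⁻¹ * t * s⁻¹ ∈ H := hconj2 ▸ H.mul_mem (H.mul_mem hxH hyH) (H.inv_mem hxH)
  have hsH : s ∈ H := by
    have hc : s * t * s⁻¹ ∈ H := by
      apply aux_sq_mem hodd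
      convert H.mul_mem haH hbH using 1
      group
    apply aux_sq_mem hodd
    convert H.mul_mem hc (H.inv_mem hbH) using 1
    group
  have htH : t ∈ H := by
    convert H.mul_mem (H.mul_mem (H.inv_mem hsH) haH) (H.inv_mem hsH) using 1
    group
  apply le_antisymm
  · have hD : ∀ a ∈ H, ∀ b ∈ H, a * b * a⁻¹ * b⁻¹ ∈ ⁅H, H⁆ := fun a ha b hb =>
      Subgroup.commutator_mem_commutator ha hb
    have hDn : ∀ h ∈ H, ∀ n ∈ H, n ∈ ⁅H, H⁆ → h * n * h⁻¹ ∈ ⁅H, H⁆ := by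
      intro h hh n hn hn'
      convert Subgroup.mul_mem _ (hD h hh n hn) hn' using 1
      group
    have hs4 : s ∈ ⁅H, H⁆ := by
      apply aux_sq_mem hodd
      apply aux_sq_mem hodd
      have h1 := hD x⁻¹ (H.inv_mem hxH) y hyH
      rw [inv_inv, hconj] at h1
      have h2 := hD x hxH y hyH
      rw [hconj2] at h2
      have hssH := H.mul_mem hsH hsH
      have h3 := hD t htH (s * s) hssH
      have h4 := hDn s hsH _ (H.mul_mem (H.mul_mem (H.mul_mem htH hssH) (H.inv_mem htH))
        (H.inv_mem hssH)) h3
      convert Subgroup.mul_mem _ (Subgroup.inv_mem _ h4)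
        (Subgroup.mul_mem _ h1 (Subgroup.inv_mem _ h2)) using 1
      simp [mul_assoc]
    rw [Subgroup.closure_le]
    rintro g ⟨h, hh, rfl⟩
    have := hDn h⁻¹ (H.inv_mem hh) s hsH hs4
    rwa [inv_inv] at this
  · generalize hNd : Subgroup.closure {g : G | ∃ h ∈ H, g = h⁻¹ * s * h} = N
    have hsN : s ∈ N := hNd ▸ Subgroup.subset_closure ⟨1, H.one_mem, by simp⟩
    have hN : ∀ h ∈ H, ∀ n ∈ N, h * n * h⁻¹ ∈ N := by
      intro h hh n hn
      have hle : N ≤ N.comap (MulAut.conj h).toMonoidHom := by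
        conv_lhs => rw [← hNd]
        rw [Subgroup.closure_le]
        rintro g ⟨a, ha, rfl⟩
        change h * (a⁻¹ * s * a) * h⁻¹ ∈ N
        rw [← hNd]
        refine Subgroup.subset_closure ⟨a * h⁻¹, H.mul_mem ha (H.inv_mem hh), ?_⟩
        group
      exact hle hn
    apply aux_comm x y H N hH.symm hN
    have hx2 : x * x ∈ auxK H N hN y := by
      refine ⟨H.mul_mem hxH hxH, ?_⟩
      have h5 := hN t htH _ (N.inv_mem (N.mul_mem hsN hsN))
      have h6 := hN x hxH _ (N.mul_mem (N.mul_mem (N.inv_mem hsN) h5) (N.inv_mem hsN))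
      have e : x * x * y * (x * x)⁻¹ * y⁻¹ =
          x * ((x * y * x⁻¹) * (x⁻¹ * y * x)⁻¹) * x⁻¹ := by group
      rw [e, hconj, hconj2]
      convert h6 using 1
      group
    exact (aux_sq_mem hodd _ _ hx2).2
end

section
/- Let V act on the finite group G as in the context with C_G(V) = 1, and suppose moreover that G is nilpotent. Let {i, j, k} = {1, 2, 3}. Then the subgroup of G generated by the set {s ∈ G_k : there exist a ∈ G_i, b ∈ G_j and t ∈ G_j with b^a = s·t·s} equals the subgroup of G generated by the set {s ∈ G_k : there exist a ∈ G_i, b ∈ G_j and t ∈ G_i with a^b = s·t·s}. -/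
namespace KleinStar

open scoped commutatorElement

/-- Two commuting involutive endomorphisms `α`, `β` of a group without common nontrivial fixed
points, where every element has the square root `x ^ m`. -/
structure KData (G : Type) [Group G] (m : ℕ) (α β : G →* G) : Prop where
  aa : ∀ x, α (α x) = x
  bb : ∀ x, β (β x) = x
  ab : ∀ x, α (β x) = β (α x)
  sq : ∀ x : G, x ^ m * x ^ m = x
  fpf : ∀ x, α x = x → β x = x → x = 1

section
variable {G : Type} [Group G] {m : ℕ}

lemma sq_pow (hsq : ∀ x : G, x ^ m * x ^ m = x) (x : G) : (x * x) ^ m = x := by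
  rw [(Commute.refl x).mul_pow, hsq]

lemma sq_inj (hsq : ∀ x : G, x ^ m * x ^ m = x) {x y : G} (h : x * x = y * y) : x = y := by
  rw [← sq_pow hsq x, h, sq_pow hsq]

lemma mem_of_sq (hsq : ∀ x : G, x ^ m * x ^ m = x) (K : Subgroup G) {x : G} (h : x * x ∈ K) :
    x ∈ K := by
  rw [← sq_pow hsq x]; exact K.pow_mem h m

lemma sq_quot (hsq : ∀ x : G, x ^ m * x ^ m = x) (K : Subgroup G) [K.Normal] (x : G ⧸ K) :
    x ^ m * x ^ m = x := by
  obtain ⟨y, rfl⟩ := QuotientGroup.mk'_surjective K x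
  rw [← map_pow, ← map_mul, hsq]

/-- lifting fixed points -/
lemma lift_fixed (hsq : ∀ x : G, x ^ m * x ^ m = x) {α : G →* G} (haa : ∀ x, α (α x) = x)
    (N : Subgroup G) (u : G) (hu : u⁻¹ * α u ∈ N) :
    ∃ n ∈ N, α (u * n) = u * n := by
  refine ⟨(u⁻¹ * α u) ^ m, N.pow_mem hu m, ?_⟩
  have h1 : α (u⁻¹ * α u) = (u⁻¹ * α u)⁻¹ := by simp [haa]
  rw [map_mul, map_pow, h1]
  have h2 := hsq (u⁻¹ * α u)
  have h3 : α u = u * (u⁻¹ * α u) := by group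
  generalize u⁻¹ * α u = n at *
  rw [h3, inv_pow, mul_assoc]
  congr 1
  rw [mul_inv_eq_iff_eq_mul, h2]

/-- congruence modulo a normal subgroup via the quotient map -/
lemma quot_one (N : Subgroup G) [N.Normal] (x : G) : QuotientGroup.mk' N x = 1 ↔ x ∈ N := by
  simp

variable {α β : G →* G}

namespace KData

lemma symm (h : KData G m α β) : KData G m β α :=
  ⟨h.bb, h.aa, fun x => (h.ab x).symm, h.sq, fun x hx hy => h.fpf x hy hx⟩

lemma inv_A (h : KData G m α β) {a : G} (ha : α a = a) : β a = a⁻¹ := by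
  obtain ⟨n, hn, hf⟩ := lift_fixed h.sq h.bb (Subgroup.zpowers (a⁻¹ * β a)) a
    (Subgroup.mem_zpowers _)
  have hαn : α n = n := by
    have : Subgroup.zpowers (a⁻¹ * β a) ≤ α.eqLocus (MonoidHom.id G) := by
      rw [Subgroup.zpowers_le]
      change α (a⁻¹ * β a) = a⁻¹ * β a
      rw [map_mul, map_inv, h.ab, ha]
    exact this hn
  have hβn : β n = n⁻¹ := by
    obtain ⟨k, rfl⟩ := hn
    simp only [map_zpow, map_mul, map_inv, h.bb]
    rw [← inv_zpow]; simp
  have h1 : a * n = 1 := h.fpf _ (by rw [map_mul, ha, hαn]) hf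
  have h2 : a = n⁻¹ := by rw [eq_inv_iff_mul_eq_one, h1]
  rw [h2, map_inv, hβn]

lemma inv_B (h : KData G m α β) {b : G} (hb : β b = b) : α b = b⁻¹ := h.symm.inv_A hb

lemma comm_A (h : KData G m α β) {a a' : G} (ha : α a = a) (ha' : α a' = a') :
    a * a' = a' * a := by
  have h1 : β (a * a') = (a * a')⁻¹ := h.inv_A (by rw [map_mul, ha, ha'])
  rw [map_mul, h.inv_A ha, h.inv_A ha', mul_inv_rev] at h1
  have := congrArg (·⁻¹) h1
  simpa using this.symm

/-- Existence of the decomposition `a⁻¹ b a = s t s`. -/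
lemma decomp (h : KData G m α β) {a b : G} (ha : α a = a) (hb : β b = b) :
    ∃ s t, α (β s) = s ∧ β t = t ∧ a⁻¹ * b * a = s * t * s ∧
      a⁻¹ * b * a = (s * s) * (a * b * a⁻¹) * (s * s) := by
  have hβa := h.inv_A ha
  have hαb := h.inv_B hb
  obtain ⟨x, hx⟩ : ∃ x, x = a⁻¹ * b * a := ⟨_, rfl⟩
  obtain ⟨y, hy⟩ : ∃ y, y = a * b * a⁻¹ := ⟨_, rfl⟩
  have hβx : β x = y := by rw [hx, hy]; simp [hβa, hb]
  have hβy : β y = x := by rw [hx, hy]; simp [hβa, hb]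
  have hαx : α x = x⁻¹ := by rw [hx]; simp [hαb, ha, mul_assoc]
  have hαy : α y = y⁻¹ := by rw [hy]; simp [hαb, ha, mul_assoc]
  rw [← hx, ← hy]
  clear hx hy
  obtain ⟨q, hq⟩ : ∃ q, q = (x * y) ^ m := ⟨_, rfl⟩
  have hqq : q * q = x * y := by rw [hq, h.sq]
  have hβq : β q = y * q * y⁻¹ := by
    apply sq_inj h.sq
    rw [← map_mul, hqq, map_mul, hβx, hβy]
    calc y * x = y * (x * y) * y⁻¹ := by group
      _ = _ := by rw [← hqq]; group
  have hαq : α q = y * q⁻¹ * y⁻¹ := by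
    apply sq_inj h.sq
    rw [← map_mul, hqq, map_mul, hαx, hαy]
    calc x⁻¹ * y⁻¹ = y * (x * y)⁻¹ * y⁻¹ := by group
      _ = _ := by rw [← hqq]; group
  obtain ⟨r, hr⟩ : ∃ r, r = q * y⁻¹ := ⟨_, rfl⟩
  have hri : y * q⁻¹ = r⁻¹ := by rw [hr]; group
  have hβr : β r = r⁻¹ := by
    have : x = q * q * y⁻¹ := by rw [hqq]; group
    rw [← hri, hr, map_mul, map_inv, hβq, hβy, this]; group
  have hαr : α r = r⁻¹ := by
    rw [← hri, hr, map_mul, map_inv, hαq, hαy]; group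
  have hxr : x = r * y * r := by
    rw [hr]
    calc x = x * y * y⁻¹ := by group
      _ = _ := by rw [← hqq]; group
  obtain ⟨s, hs⟩ : ∃ s, s = r ^ m := ⟨_, rfl⟩
  have hss : s * s = r := by rw [hs, h.sq]
  have hβs : β s = s⁻¹ := by rw [hs, map_pow, hβr, inv_pow]
  have hαs : α s = s⁻¹ := by rw [hs, map_pow, hαr, inv_pow]
  refine ⟨s, s⁻¹ * x * s⁻¹, ?_, ?_, by group, by rw [hss, hxr]⟩
  · rw [hβs, map_inv, hαs, inv_inv]
  · rw [map_mul, map_mul, map_inv, hβs, hβx, inv_inv]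
    rw [hxr, ← hss]; group

end KData

local notation "LC" => Subgroup.lowerCentralSeries (⊤ : Subgroup G)

lemma lc_map (f : G →* G) (n : ℕ) {x : G} (hx : x ∈ LC n) : f x ∈ LC n := by
  have h1 := Subgroup.mem_map_of_mem f hx
  rw [Subgroup.map_lowerCentralSeries] at h1
  exact Subgroup.lowerCentralSeries_mono n le_top h1

lemma lc_comm {n : ℕ} {x : G} (hx : x ∈ LC n) (g : G) : ⁅x, g⁆ ∈ LC (n + 1) :=
  Subgroup.commutator_mem_commutator hx (Subgroup.mem_top g)

lemma lc_central {n : ℕ} (K : Subgroup G) [K.Normal] (hK : LC (n + 1) ≤ K) {x : G}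
    (hx : x ∈ LC n) (g : G) :
    Commute (QuotientGroup.mk' K x) (QuotientGroup.mk' K g) := by
  rw [← commutatorElement_eq_one_iff_commute, ← map_commutatorElement, quot_one]
  exact hK (lc_comm hx g)

/-- Key lemma: commutators of `A` and `B` in the `n`-th term lie in `D` modulo the next term. -/
lemma key (h : KData G m α β) (D : Subgroup G)
    (hD : ∀ s a b t, α (β s) = s → α a = a → β b = b → β t = t → a⁻¹ * b * a = s * t * s → s ∈ D)
    {n : ℕ} {a b : G} (ha : α a = a) (hb : β b = b) (hz : b⁻¹ * a⁻¹ * b * a ∈ LC n) :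
    b⁻¹ * a⁻¹ * b * a ∈ D ⊔ LC (n + 1) := by
  obtain ⟨s, t, hs, ht, h1, h2⟩ := h.decomp ha hb
  have hsD : s ∈ D := hD s a b t hs ha hb ht h1
  obtain ⟨r, hr⟩ : ∃ r, r = s * s := ⟨_, rfl⟩
  have hrD : r ∈ D := hr ▸ D.mul_mem hsD hsD
  rw [← hr] at h2
  obtain ⟨z, hzz⟩ : ∃ z, z = b⁻¹ * a⁻¹ * b * a := ⟨_, rfl⟩
  rw [← hzz] at hz ⊢
  have e1 : a⁻¹ * b * a = b * z := by rw [hzz]; group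
  have e2 : b = (a * b * a⁻¹) * (a * z * a⁻¹) := by rw [hzz]; group
  have hrn : r ∈ LC n := by
    rw [← quot_one (LC n)]
    set f := QuotientGroup.mk' (LC n)
    have fz : f z = 1 := (quot_one _ _).2 hz
    have f1 := congrArg f e1
    have f2 := congrArg f e2
    have f3 := congrArg f h2
    simp only [map_mul, map_inv, fz, mul_one, mul_inv_cancel] at f1 f2 f3
    rw [f1, ← f2] at f3
    have : f r * f b = f b := by
      apply sq_inj (sq_quot h.sq (LC n))
      rw [← mul_assoc, ← f3]
    simpa using this
  set f := QuotientGroup.mk' (LC (n + 1)) with hf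
  have cz := lc_central (LC (n + 1)) le_rfl hz
  have cr := lc_central (LC (n + 1)) le_rfl hrn
  rw [← hf] at cz cr
  have hzr : f z = f r := by
    apply sq_inj (sq_quot h.sq (LC (n + 1)))
    have f1 := congrArg f e1
    have f2 := congrArg f e2
    have f3 := congrArg f h2
    simp only [map_mul, map_inv] at f1 f2 f3
    have e4 : f a * f z * (f a)⁻¹ = f z := by rw [← (cz a).eq]; group
    rw [e4] at f2
    have f2' : f a * f b * (f a)⁻¹ = f b * (f z)⁻¹ := by rw [eq_mul_inv_iff_mul_eq, ← f2]
    rw [f1, f2'] at f3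
    calc f z * f z = (f b)⁻¹ * (f b * f z) * f z := by group
      _ = (f b)⁻¹ * (f r * f b) * (f z)⁻¹ * (f r * f z) := by rw [f3]; group
      _ = f r * f r := by
        rw [(cr b).eq]
        calc (f b)⁻¹ * (f b * f r) * (f z)⁻¹ * (f r * f z)
            = f r * (f z)⁻¹ * (f r * f z) := by group
          _ = _ := by rw [(cr z).eq]; group
  have : r⁻¹ * z ∈ LC (n + 1) := by
    rw [← quot_one (LC (n + 1)), ← hf, map_mul, map_inv, hzr, inv_mul_cancel]
  rw [show z = r * (r⁻¹ * z) by group]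
  exact Subgroup.mul_mem_sup hrD this

/-- The subgroup generated by pure parts. -/
lemma pure_gen (h : KData G m α β) (n : ℕ) (W : Subgroup G)
    (hN : LC (n + 1) ≤ W)
    (hA : ∀ x ∈ LC n, α x = x → x ∈ W) (hB : ∀ x ∈ LC n, β x = x → x ∈ W)
    (hC : ∀ x ∈ LC n, α (β x) = x → x ∈ W) : LC n ≤ W := by
  have lift : ∀ γ : G →* G, (∀ x, γ (γ x) = x) → ∀ u ∈ LC n, u⁻¹ * γ u ∈ LC (n + 1) →
      ∃ v ∈ LC n, γ v = v ∧ u⁻¹ * v ∈ LC (n + 1) := by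
    intro γ hγ u hu hu'
    obtain ⟨k, hk, hk'⟩ := lift_fixed h.sq hγ _ u hu'
    exact ⟨u * k, Subgroup.mul_mem _ hu
      (Subgroup.lowerCentralSeries_antitone _ (Nat.le_succ n) hk), hk', by simpa using hk⟩
  have hpart : ∀ γ : G →* G, (∀ x, γ (γ x) = x) → (∀ x ∈ LC n, γ x = x → x ∈ W) →
      ∀ y ∈ LC n, y * γ y ∈ W := by
    intro γ hγ hW y hy
    have hu : y * γ y ∈ LC n := Subgroup.mul_mem _ hy (lc_map γ n hy)
    obtain ⟨v, hv, hv', hv''⟩ := lift γ hγ _ hu (by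
      have := lc_comm (Subgroup.inv_mem _ (lc_map γ n hy)) y⁻¹
      rw [commutatorElement_def] at this
      simpa [hγ, mul_assoc] using this)
    have := W.mul_mem (hW v hv hv') (W.inv_mem (hN hv''))
    simpa [mul_assoc] using this
  intro y hy
  have hαy := lc_map α n hy
  have hβy := lc_map β n hy
  have hγy := lc_map α n hβy
  have p1 := hpart α h.aa hA y hy
  have p2 := hpart β h.bb hB y hy
  have p3 := hpart (α.comp β) (fun x => by simp [← h.ab, h.aa, h.bb]) hC y hy
  set f := QuotientGroup.mk' (LC (n + 1)) with hf
  have cen : ∀ x ∈ LC n, ∀ g, Commute (f x) (f g) := fun x hx g => lc_central _ le_rfl hx g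
  obtain ⟨p, hp⟩ : ∃ p, p = y * α y * (β y * α (β y)) := ⟨_, rfl⟩
  have hpn : p ∈ LC n := hp ▸ Subgroup.mul_mem _ (Subgroup.mul_mem _ hy hαy)
    (Subgroup.mul_mem _ hβy hγy)
  have fα : f (α p) = f p := by
    rw [hp]
    simp only [map_mul, h.aa]
    rw [(cen _ hy (α y)).eq, (cen _ hβy (α (β y))).eq]
  have fβ : f (β p) = f p := by
    rw [hp]
    simp only [map_mul, ← h.ab, h.bb]
    have := (cen _ (Subgroup.mul_mem _ hy hαy) (β y * α (β y))).eq
    simp only [map_mul] at this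
    exact this.symm
  have hpN : p ∈ LC (n + 1) := by
    obtain ⟨v, hv, hv', hv''⟩ := lift α h.aa p hpn (by
      rw [← quot_one, ← hf, map_mul, map_inv, fα, inv_mul_cancel])
    have fv : f v = f p := by
      rw [← quot_one, ← hf, map_mul, map_inv, inv_mul_eq_one] at hv''
      exact hv''.symm
    have fβv : f (β v) = f v := by
      have := lc_map β (n + 1) hv''
      rw [← quot_one, ← hf, map_mul, map_mul, map_inv, map_inv, inv_mul_eq_one] at this
      rw [fv, ← this, fβ]
    rw [h.inv_A hv'] at fβv
    have : v ∈ LC (n + 1) := by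
      apply mem_of_sq h.sq
      rw [← quot_one, ← hf, map_mul]
      nth_rw 1 [← fβv]
      rw [← map_mul, inv_mul_cancel, map_one]
    rw [← quot_one, ← hf, ← fv]
    exact (quot_one _ _).2 this
  apply mem_of_sq h.sq
  have hprod := W.mul_mem (W.mul_mem p1 p2) p3
  have hdiff : (y * y)⁻¹ * ((y * α y) * (y * β y) * (y * (α.comp β) y)) ∈ LC (n + 1) := by
    rw [← quot_one, ← hf]
    have fp := (quot_one (LC (n + 1)) p).2 hpN
    rw [← hf, hp] at fp
    simp only [map_mul, map_inv, MonoidHom.comp_apply] at fp ⊢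
    have c2 := (cen _ hy (β y)).eq
    rw [inv_mul_eq_one]
    have c3 : Commute (f y * f (α y)) (f y * f y) :=
      ((Commute.refl _).mul_left (cen _ hy (α y)).symm).mul_right
        ((Commute.refl _).mul_left (cen _ hy (α y)).symm)
    symm
    calc f y * f (α y) * (f y * f (β y)) * (f y * f (α (β y)))
        = (f y * f (α y)) * f y * (f (β y) * f y) * f (α (β y)) := by group
      _ = (f y * f (α y)) * (f y * f y) * (f (β y) * f (α (β y))) := by
          rw [← c2]; group
      _ = (f y * f y) * (f y * f (α y) * (f (β y) * f (α (β y)))) := by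
          rw [c3.eq]; group
      _ = f y * f y := by rw [fp, mul_one]
  have := W.mul_mem hprod (W.inv_mem (hN hdiff))
  simpa [mul_assoc] using this

/-- The subgroup of `y` in the `n`-th term with `y * κ y` in `E`. -/
def T (n : ℕ) (κ : G →* G) (E : Subgroup G) (hE : LC (n + 1) ≤ E) : Subgroup G where
  carrier := {y | y ∈ LC n ∧ y * κ y ∈ E}
  one_mem' := by simp [Subgroup.one_mem]
  mul_mem' := by
    rintro x y ⟨hx, hx'⟩ ⟨hy, hy'⟩
    refine ⟨Subgroup.mul_mem _ hx hy, ?_⟩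
    have h1 := hE (lc_comm (Subgroup.inv_mem _ (lc_map κ n hx)) y)
    have := E.mul_mem (E.mul_mem hx' h1) hy'
    rw [commutatorElement_def] at this
    simpa [mul_assoc] using this
  inv_mem' := by
    rintro x ⟨hx, hx'⟩
    refine ⟨Subgroup.inv_mem _ hx, ?_⟩
    have h1 := hE (lc_comm (lc_map κ n hx) x)
    have := E.inv_mem (E.mul_mem h1 hx')
    rw [commutatorElement_def] at this
    simpa [mul_assoc] using this

lemma mem_T {n : ℕ} {κ : G →* G} {E : Subgroup G} {hE : LC (n + 1) ≤ E} {y : G} :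
    y ∈ T n κ E hE ↔ y ∈ LC n ∧ y * κ y ∈ E := Iff.rfl

lemma le_T {n : ℕ} {κ : G →* G} {E : Subgroup G} (hE : LC (n + 1) ≤ E) :
    LC (n + 1) ≤ T n κ E hE := fun y hy =>
  ⟨Subgroup.lowerCentralSeries_antitone _ (Nat.le_succ n) hy,
    E.mul_mem (hE hy) (hE (lc_map κ _ hy))⟩

lemma T_normal {n : ℕ} {κ : G →* G} {E : Subgroup G} (hE : LC (n + 1) ≤ E) :
    (T n κ E hE).Normal := by
  constructor
  intro y hy g
  have h1 := le_T (κ := κ) hE (lc_comm (Subgroup.inv_mem _ hy.1) g)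
  have := (T n κ E hE).mul_mem hy h1
  rw [commutatorElement_def] at this
  simpa [mul_assoc] using this

lemma step (h : KData G m α β) (D : Subgroup G)
    (hgen : Subgroup.closure ({x | α x = x} ∪ {x | β x = x}) = ⊤)
    (hDC : ∀ s ∈ D, α (β s) = s)
    (hD : ∀ s a b t, α (β s) = s → α a = a → β b = b → β t = t → a⁻¹ * b * a = s * t * s → s ∈ D)
    (n : ℕ) : LC n ≤ T n (α.comp β) (D ⊔ LC (n + 1)) le_sup_right := by
  set κ := α.comp β with hκ
  have hκA : ∀ a, α a = a → κ a = a⁻¹ := fun a ha => by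
    simp [hκ, h.inv_A ha, ha]
  have hκB : ∀ b, β b = b → κ b = b⁻¹ := fun b hb => by
    simp [hκ, h.inv_B hb, hb]
  set E := D ⊔ LC (n + 1) with hE
  have hle : LC (n + 1) ≤ E := le_sup_right
  have hκE : ∀ x ∈ E, κ x ∈ E := by
    have : E ≤ E.comap κ := by
      rw [hE, sup_le_iff]
      refine ⟨fun x hx => ?_, fun x hx => hle (lc_map κ _ hx)⟩
      have : κ x = x := hDC x hx
      rw [Subgroup.mem_comap, this]
      exact Subgroup.mem_sup_left hx
    exact this
  cases n with
  | zero =>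
    refine le_trans (le_of_eq hgen.symm) ?_
    rw [Subgroup.closure_le]
    rintro x (hx | hx)
    · exact ⟨Subgroup.mem_top _, by rw [hκA x hx, mul_inv_cancel]; exact E.one_mem⟩
    · exact ⟨Subgroup.mem_top _, by rw [hκB x hx, mul_inv_cancel]; exact E.one_mem⟩
  | succ n =>
    have hN := T_normal (κ := κ) hle
    obtain ⟨S, hS⟩ : ∃ S, S = T (n + 1) κ E hle := ⟨_, rfl⟩
    rw [← hS] at hN ⊢
    set f := QuotientGroup.mk' S with hf
    have inS : ∀ x ∈ LC (n + 1), x ∈ E → x ∈ S := fun x hx hx' => by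
      rw [hS]; exact ⟨hx, E.mul_mem hx' (hκE x hx')⟩
    have hcomm : ∀ x g, ⁅x, g⁆ ∈ S → Commute (f x) (f g) := by
      intro x g hx
      rw [← commutatorElement_eq_one_iff_commute, ← map_commutatorElement]
      exact (quot_one S _).2 hx
    -- mixed commutators
    have mixed : ∀ a b, α a = a → β b = b → (a ∈ LC n ∨ b ∈ LC n) → ⁅a, b⁆ ∈ S := by
      intro a b ha hb hab
      have hz : b⁻¹ * a⁻¹ * b * a ∈ LC (n + 1) := by
        rcases hab with hab | hab
        · have := (inferInstance : (LC (n + 1)).Normal).conj_mem _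
            (lc_comm (Subgroup.inv_mem _ hab) b) b⁻¹
          rw [commutatorElement_def] at this
          simpa [mul_assoc] using this
        · have := lc_comm (Subgroup.inv_mem _ hab) a⁻¹
          rw [commutatorElement_def] at this
          simpa [mul_assoc] using this
      have hzS := inS _ hz (key h D hD ha hb hz)
      have h3 := S.inv_mem (hN.conj_mem _ hzS (a * b))
      rw [commutatorElement_def]
      convert h3 using 1
      group
    have skew : ∀ c g, c ∈ LC n → κ c = c → κ g = g⁻¹ → ⁅c, g⁆ ∈ S := by
      intro c g hc hκc hκg
      have h1 := lc_comm hc g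
      rw [hS]
      refine ⟨h1, hle ?_⟩
      rw [map_commutatorElement, hκc, hκg]
      have h2 := lc_comm h1 g⁻¹
      convert h2 using 1
      simp only [commutatorElement_def]
      group
    have trivA : ∀ x g, α x = x → α g = g → ⁅x, g⁆ ∈ S := fun x g hx hg => by
      rw [commutatorElement_eq_one_iff_mul_comm.2 (h.comm_A hx hg)]; exact S.one_mem
    have trivB : ∀ x g, β x = x → β g = g → ⁅x, g⁆ ∈ S := fun x g hx hg => by
      rw [commutatorElement_eq_one_iff_mul_comm.2 (h.symm.comm_A hx hg)]; exact S.one_mem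
    have cen : ∀ x, (∀ a, α a = a → ⁅x, a⁆ ∈ S) → (∀ b, β b = b → ⁅x, b⁆ ∈ S) →
        x ∈ (Subgroup.center (G ⧸ S)).comap f := by
      intro x h1 h2
      rw [Subgroup.mem_comap, Subgroup.mem_center_iff]
      intro g'
      obtain ⟨g, rfl⟩ := QuotientGroup.mk'_surjective S g'
      have : (⊤ : Subgroup G) ≤ (Subgroup.centralizer {f x}).comap f := by
        rw [← hgen, Subgroup.closure_le]
        rintro y (hy | hy)
        · exact Subgroup.mem_centralizer_singleton_iff.2 (hcomm x y (h1 y hy)).eq.symm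
        · exact Subgroup.mem_centralizer_singleton_iff.2 (hcomm x y (h2 y hy)).eq.symm
      exact Subgroup.mem_centralizer_singleton_iff.1 (this (Subgroup.mem_top g))
    have hW : LC n ≤ (Subgroup.center (G ⧸ S)).comap f := by
      apply pure_gen h n
      · intro x hx
        have hh : ∀ g, ⁅x, g⁆ ∈ S := fun g => by
          rw [hS]; exact le_T hle (lc_comm hx g)
        exact cen x (fun a _ => hh a) (fun b _ => hh b)
      · intro x hx hα
        exact cen x (fun a ha => trivA x a hα ha) (fun b hb => mixed x b hα hb (Or.inl hx))
      · intro x hx hβ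
        refine cen x (fun a ha => ?_) (fun b hb => trivB x b hβ hb)
        rw [← commutatorElement_inv]
        exact S.inv_mem (mixed a x ha hβ (Or.inr hx))
      · intro x hx hc
        exact cen x (fun a ha => skew x a hx hc (hκA a ha)) (fun b hb => skew x b hx hc (hκB b hb))
    rw [Subgroup.lowerCentralSeries_succ, Subgroup.commutator_le]
    intro x hx g _
    rw [← quot_one S, map_commutatorElement, commutatorElement_eq_one_iff_mul_comm]
    exact (Subgroup.mem_center_iff.1 (hW hx) (f g)).symm

theorem core [hnil : Group.IsNilpotent G] (h : KData G m α β) (D : Subgroup G)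
    (hgen : Subgroup.closure ({x | α x = x} ∪ {x | β x = x}) = ⊤)
    (hDC : ∀ s ∈ D, α (β s) = s)
    (hD : ∀ s a b t, α (β s) = s → α a = a → β b = b → β t = t → a⁻¹ * b * a = s * t * s → s ∈ D)
    (c : G) (hc : α (β c) = c) : c ∈ D := by
  obtain ⟨N, hN⟩ := Subgroup.nilpotent_iff_lowerCentralSeries.1 hnil
  have : ∀ n, c ∈ D ⊔ LC n := by
    intro n
    induction n with
    | zero => exact Subgroup.mem_sup_right (Subgroup.mem_top c)
    | succ n ih =>
      obtain ⟨d, hd, z, hz, rfl⟩ := Subgroup.mem_sup_of_normal_right.1 ih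
      have hzc : α (β z) = z := by
        rw [map_mul, map_mul, hDC d hd] at hc
        exact mul_left_cancel hc
      have h1 := (step h D hgen hDC hD n hz).2
      rw [MonoidHom.comp_apply, hzc] at h1
      exact Subgroup.mul_mem _ (Subgroup.mem_sup_left hd) (mem_of_sq h.sq _ h1)
  simpa [hN] using this N

/-- The star subgroup is the centralizer of `αβ` in `⟨A, B⟩`. -/
theorem star_eq [hnil : Group.IsNilpotent G] (h : KData G m α β) :
    (Subgroup.closure {s : G | α (β s) = s ∧ ∃ a b t : G,
        α a = a ∧ β b = b ∧ β t = t ∧ a⁻¹ * b * a = s * t * s} : Set G) =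
      {c | α (β c) = c ∧ c ∈ Subgroup.closure ({x | α x = x} ∪ {x | β x = x})} := by
  obtain ⟨H, hH⟩ : ∃ H, H = Subgroup.closure ({x | α x = x} ∪ {x | β x = x}) := ⟨_, rfl⟩
  obtain ⟨D, hDdef⟩ : ∃ D, D = Subgroup.closure {s : G | α (β s) = s ∧ ∃ a b t : G,
        α a = a ∧ β b = b ∧ β t = t ∧ a⁻¹ * b * a = s * t * s} := ⟨_, rfl⟩
  rw [← hH, ← hDdef]
  have hAH : ∀ a, α a = a → a ∈ H := fun a ha => hH ▸ Subgroup.subset_closure (Or.inl ha)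
  have hBH : ∀ b, β b = b → b ∈ H := fun b hb => hH ▸ Subgroup.subset_closure (Or.inr hb)
  have hDC : ∀ s ∈ D, α (β s) = s := by
    have : D ≤ (α.comp β).eqLocus (MonoidHom.id G) := by
      rw [hDdef, Subgroup.closure_le]
      exact fun s hs => hs.1
    exact this
  have hDH : D ≤ H := by
    rw [hDdef, Subgroup.closure_le]
    rintro s ⟨hs, a, b, t, ha, hb, ht, e⟩
    have h1 : (s * t) * (s * t) ∈ H := by
      rw [show (s * t) * (s * t) = (s * t * s) * t by group, ← e]
      exact H.mul_mem (H.mul_mem (H.mul_mem (H.inv_mem (hAH a ha)) (hBH b hb)) (hAH a ha))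
        (hBH t ht)
    have h2 := mem_of_sq h.sq H h1
    simpa using H.mul_mem h2 (H.inv_mem (hBH t ht))
  have hαH : ∀ x ∈ H, α x ∈ H := by
    have : H ≤ H.comap α := by
      nth_rw 1 [hH]
      rw [Subgroup.closure_le]
      rintro x (hx | hx)
      · change α x ∈ H
        rw [hx]; exact hAH x hx
      · change α x ∈ H
        rw [h.inv_B hx]; exact H.inv_mem (hBH x hx)
    exact this
  have hβH : ∀ x ∈ H, β x ∈ H := by
    have : H ≤ H.comap β := by
      nth_rw 1 [hH]
      rw [Subgroup.closure_le]
      rintro x (hx | hx)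
      · change β x ∈ H
        rw [h.inv_A hx]; exact H.inv_mem (hAH x hx)
      · change β x ∈ H
        rw [hx]; exact hBH x hx
    exact this
  ext c
  refine ⟨fun hc => ⟨hDC c hc, hDH hc⟩, ?_⟩
  rintro ⟨hc, hcH⟩
  let α' : H →* H := (α.comp H.subtype).codRestrict H (fun x => hαH x x.2)
  let β' : H →* H := (β.comp H.subtype).codRestrict H (fun x => hβH x x.2)
  have hα' : ∀ x : H, ((α' x : H) : G) = α x := fun _ => rfl
  have hβ' : ∀ x : H, ((β' x : H) : G) = β x := fun _ => rfl
  have h' : KData H m α' β' := by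
    refine ⟨fun x => ?_, fun x => ?_, fun x => ?_, fun x => ?_, fun x hx hy => ?_⟩
    · ext; simp [hα', h.aa]
    · ext; simp [hβ', h.bb]
    · ext; simp [hα', hβ', h.ab]
    · ext; simp [h.sq]
    · ext
      exact h.fpf x (by rw [← hα', hx]) (by rw [← hβ', hy])
  have hgen : Subgroup.closure ({x | α' x = x} ∪ {x | β' x = x}) = ⊤ := by
    rw [eq_top_iff, ← Subgroup.map_subtype_le_map_subtype, MonoidHom.map_closure]
    rw [← MonoidHom.range_eq_map, Subgroup.range_subtype]
    nth_rw 1 [hH]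
    apply Subgroup.closure_mono
    rintro x (hx | hx)
    · exact ⟨⟨x, hAH x hx⟩, Or.inl (Subtype.ext hx), rfl⟩
    · exact ⟨⟨x, hBH x hx⟩, Or.inr (Subtype.ext hx), rfl⟩
  have := core h' (D.comap H.subtype) hgen
    (fun s hs => Subtype.ext (hDC s hs))
    (fun s a b t hs ha hb ht e => by
      rw [Subgroup.mem_comap, hDdef]
      apply Subgroup.subset_closure
      exact ⟨congrArg Subtype.val hs, a, b, t, congrArg Subtype.val ha, congrArg Subtype.val hb,
        congrArg Subtype.val ht, congrArg Subtype.val e⟩)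
    ⟨c, hcH⟩ (Subtype.ext hc)
  exact this

end

end KleinStar



/-- **Lemma 4.6.**  Let the Klein four-group `V = {1, v₁, v₂, v₃}` (here `w 0 = v₁`,
`w 1 = v₂`, `w 2 = v₃ = v₁v₂`) act by automorphisms on a finite nilpotent group `G`
with `C_G(V) = 1`, and set `Gᵢ = C_G(vᵢ)`; let `{i, j, k} = {1, 2, 3}`.  Then
`⟨a*b | a ∈ Gᵢ, b ∈ Gⱼ⟩ = ⟨b*a | a ∈ Gᵢ, b ∈ Gⱼ⟩`, where `a*b` (resp. `b*a`)
denotes the unique `s ∈ G_k` for which `b^a = s·t·s` with `t ∈ Gⱼ` (resp.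
`a^b = s·t·s` with `t ∈ Gᵢ`). -/
theorem star_subgroups_eq_of_kleinFour_action_of_nilpotent
    (V : Type) [Group V] (w : Fin 3 → V)
    (hV4 : Nat.card V = 4)
    (hinv : ∀ i, w i * w i = 1) (hne1 : ∀ i, w i ≠ 1)
    (hw01 : w 0 * w 1 = w 1 * w 0) (hw2 : w 2 = w 0 * w 1)
    (G : Type) [Group G] [Finite G] (φ : V →* MulAut G)
    (hfpf : ∀ x : G, (∀ v : V, φ v x = x) → x = 1)
    (hnil : Group.IsNilpotent G)
    (i j k : Fin 3) (hij : i ≠ j) (hjk : j ≠ k) (hik : i ≠ k) :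
    Subgroup.closure {s : G | φ (w k) s = s ∧ ∃ a b t : G,
        φ (w i) a = a ∧ φ (w j) b = b ∧ φ (w j) t = t ∧ a⁻¹ * b * a = s * t * s} =
      Subgroup.closure {s : G | φ (w k) s = s ∧ ∃ a b t : G,
        φ (w i) a = a ∧ φ (w j) b = b ∧ φ (w i) t = t ∧ b⁻¹ * a * b = s * t * s} := by
  classical
  have hcomm : ∀ p q : Fin 3, w p * w q = w q * w p := by
    have h3 : ∀ q, w 0 * w q = w q * w 0 := by
      intro q; fin_cases q
      · rfl
      · exact hw01
      · change w 0 * w 2 = w 2 * w 0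
        rw [hw2, mul_assoc, hw01]
    have h4 : ∀ q, w 1 * w q = w q * w 1 := by
      intro q; fin_cases q
      · exact hw01.symm
      · rfl
      · change w 1 * w 2 = w 2 * w 1
        rw [hw2, ← mul_assoc, ← hw01]
    intro p q
    fin_cases p
    · exact h3 q
    · exact h4 q
    · change w 2 * w q = w q * w 2
      rw [hw2, mul_assoc, h4, ← mul_assoc, h3, mul_assoc]
  have hprod : w k = w i * w j := by
    have e01 : w 2 = w 0 * w 1 := hw2
    have e02 : w 1 = w 0 * w 2 := by rw [hw2, ← mul_assoc, hinv, one_mul]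
    have e12 : w 0 = w 1 * w 2 := by rw [hw2, hw01, ← mul_assoc, hinv, one_mul]
    have e10 : w 2 = w 1 * w 0 := by rw [hcomm]; exact e01
    have e20 : w 1 = w 2 * w 0 := by rw [hcomm]; exact e02
    have e21 : w 0 = w 2 * w 1 := by rw [hcomm]; exact e12
    fin_cases i <;> fin_cases j <;> fin_cases k <;> first | assumption | (exfalso; simp at hij hjk hik)
  have hall : ∀ v : V, v = 1 ∨ v = w i ∨ v = w j ∨ v = w k := by
    haveI : Finite V := Nat.finite_of_card_ne_zero (by omega)
    letI := Fintype.ofFinite V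
    have hd1 : w i ≠ w j := fun e => hne1 k (by rw [hprod, e, hinv])
    have hd2 : w i ≠ w k := fun e => hne1 j (by
      rw [hprod] at e; exact (left_eq_mul.1 e))
    have hd3 : w j ≠ w k := fun e => hne1 i (by
      rw [hprod] at e; exact (right_eq_mul.1 e))
    have hc : ({1, w i, w j, w k} : Finset V) = Finset.univ := by
      apply Finset.eq_univ_of_card
      rw [← Nat.card_eq_fintype_card, hV4]
      rw [Finset.card_insert_of_notMem, Finset.card_insert_of_notMem, Finset.card_pair hd3]
      · simp [hd1, hd2]
      · simp [(hne1 i).symm, (hne1 j).symm, (hne1 k).symm]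
    intro v
    have : v ∈ ({1, w i, w j, w k} : Finset V) := hc ▸ Finset.mem_univ v
    simpa using this
  have hodd : Nat.card G % 2 = 1 := by
    letI : MulAction V G := MulAction.compHom G φ
    haveI : Fact (Nat.Prime 2) := ⟨Nat.prime_two⟩
    have hp : IsPGroup 2 V := IsPGroup.of_card (n := 2) (by rw [hV4]; norm_num)
    have h1 := hp.card_modEq_card_fixedPoints G
    have h2 : MulAction.fixedPoints V G = {1} := by
      ext x
      constructor
      · intro hx
        exact hfpf x hx
      · rintro rfl v
        exact map_one (φ v)
    rw [h2] at h1
    simpa [Nat.ModEq] using h1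
  obtain ⟨m, hm⟩ : ∃ m, m + m = Nat.card G + 1 := ⟨(Nat.card G + 1) / 2, by omega⟩
  have hk : ∀ x, φ (w k) x = φ (w i) (φ (w j) x) := fun x => by
    rw [hprod, map_mul]; rfl
  have hk' : ∀ x, φ (w k) x = φ (w j) (φ (w i) x) := fun x => by
    rw [hprod, hcomm, map_mul]; rfl
  have hii : ∀ p x, φ (w p) (φ (w p) x) = x := fun p x => by
    have : φ (w p * w p) x = x := by rw [hinv, map_one]; rfl
    rwa [map_mul] at this
  have hK : KleinStar.KData G m (φ (w i)).toMonoidHom (φ (w j)).toMonoidHom := by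
    refine ⟨hii i, hii j, fun x => (hk x).symm.trans (hk' x), fun x => ?_, fun x hx hy => ?_⟩
    · rw [← pow_add, hm, pow_succ, pow_card_eq_one', one_mul]
    · apply hfpf
      have hx' : φ (w i) x = x := hx
      have hy' : φ (w j) x = x := hy
      intro v
      rcases hall v with rfl | rfl | rfl | rfl
      · rw [map_one]; rfl
      · exact hx'
      · exact hy'
      · rw [hk, hy', hx']
  have s1 := KleinStar.star_eq hK
  have s2 := KleinStar.star_eq hK.symm
  apply SetLike.coe_injective
  have t1 : {s : G | φ (w k) s = s ∧ ∃ a b t : G,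
        φ (w i) a = a ∧ φ (w j) b = b ∧ φ (w j) t = t ∧ a⁻¹ * b * a = s * t * s} =
      {s : G | φ (w i) (φ (w j) s) = s ∧ ∃ a b t : G,
        φ (w i) a = a ∧ φ (w j) b = b ∧ φ (w j) t = t ∧ a⁻¹ * b * a = s * t * s} := by
    simp only [hk]
  have t2 : {s : G | φ (w k) s = s ∧ ∃ a b t : G,
        φ (w i) a = a ∧ φ (w j) b = b ∧ φ (w i) t = t ∧ b⁻¹ * a * b = s * t * s} =
      {s : G | φ (w j) (φ (w i) s) = s ∧ ∃ a b t : G,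
        φ (w j) a = a ∧ φ (w i) b = b ∧ φ (w i) t = t ∧ a⁻¹ * b * a = s * t * s} := by
    ext s
    rw [Set.mem_ofPred_eq, Set.mem_ofPred_eq, hk']
    constructor
    · rintro ⟨h1, a, b, t, ha, hb, ht, e⟩
      exact ⟨h1, b, a, t, hb, ha, ht, e⟩
    · rintro ⟨h1, a, b, t, ha, hb, ht, e⟩
      exact ⟨h1, b, a, t, hb, ha, ht, e⟩
  rw [t1, t2]
  refine s1.trans (Eq.trans ?_ s2.symm)
  rw [Set.union_comm]
  ext c
  exact and_congr_left fun _ => by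
    rw [hK.ab]
end
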